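/- arXiv:1009.3531 — 2 statements merged into one kernel-verified Lean document; each statement's English description precedes it below -/
import Mathlib

section
/- Let (R, 𝔪) be a commutative Noetherian local ring and M a generalized Cohen-Macaulay R-module of dimension d > 0. Let n₀ be the least positive integer such that 𝔪^{n₀}·H^i_𝔪(M) = 0 for all i < d. Then for every parameter element x of M with x ∈ 𝔪^{2n₀}, there is an isomorphism (0 :_{H^{d−1}_𝔪(M/xM)} 𝔪^{n₀}) ≅ H^{d−1}_𝔪(M) ⊕ (0 :_{H^d_𝔪(M)} 𝔪^{n₀}). -/
open CategoryTheory IsLocalRing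

section
open Opposite

namespace LCaux
noncomputable section
variable {R : Type} [CommRing R]
variable {X : ModuleCat.{0} R} (P : ProjectiveResolution X) (Y : ModuleCat.{0} R) (n : ℕ)

abbrev FY : ModuleCat.{0} R ⥤ (ModuleCat.{0} R)ᵒᵖ := ((linearYoneda R (ModuleCat.{0} R)).obj Y).rightOp

abbrev LY : ChainComplex (ModuleCat.{0} R)ᵒᵖ ℕ := ((FY Y).mapHomologicalComplex _).obj P.complex

abbrev EE (X Y : ModuleCat.{0} R) (n : ℕ) : ModuleCat.{0} R := ((Ext R (ModuleCat.{0} R) n).obj (op X)).obj Y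

abbrev Cyc : ModuleCat.{0} R := ((LY P Y).opcycles n).unop

def pp : Cyc P Y n ⟶ ModuleCat.of R (P.complex.X n ⟶ Y) := ((LY P Y).pOpcycles n).unop

def isoL : ((FY Y).leftDerived n).obj X ≅ (LY P Y).homology n := P.isoLeftDerivedObj (FY Y) n

def qq : Cyc P Y n ⟶ EE X Y n := ((isoL P Y n).hom ≫ (LY P Y).homologyι n).unop

lemma pp_inj : Function.Injective (pp P Y n) := by
  rw [← ModuleCat.mono_iff_injective]
  exact unop_mono_of_epi ((LY P Y).pOpcycles n)

lemma qq_surj : Function.Surjective (qq P Y n) := by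
  rw [← ModuleCat.epi_iff_surjective]
  exact unop_epi_of_mono ((isoL P Y n).hom ≫ (LY P Y).homologyι n)

lemma d_pp (m : ℕ) (z : Cyc P Y n) : P.complex.d m n ≫ (pp P Y n z : P.complex.X n ⟶ Y) = 0 := by
  have h := (LY P Y).d_pOpcycles m n
  have h2 := congrArg Quiver.Hom.unop h
  exact congrArg (fun g => g.hom z) h2

lemma pp_range (f : P.complex.X n ⟶ Y) (hf : P.complex.d (n+1) n ≫ f = 0) :
    ∃ z, pp P Y n z = f := by
  have hex' := (ShortComplex.exact_of_g_is_cokernel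
    (ShortComplex.mk _ _ ((LY P Y).d_pOpcycles (n+1) n))
    ((LY P Y).opcyclesIsCokernel (n+1) n (by simp)))
  have hex := hex'.unop
  have := (ShortComplex.moduleCat_exact_iff _).1 hex
  exact this f hf

lemma ker_unop_of_kernel {A B D : (ModuleCat.{0} R)ᵒᵖ} (i : A ⟶ B) (g : B ⟶ D) (w : i ≫ g = 0)
    (h : (ShortComplex.mk i g w).Exact) (z : B.unop) :
    i.unop z = 0 ↔ ∃ y : D.unop, g.unop y = z := by
  have h1 := (ShortComplex.moduleCat_exact_iff _).1 h.unop z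
  refine ⟨h1, ?_⟩
  rintro ⟨y, rfl⟩
  have h2 := congrArg Quiver.Hom.unop w
  exact congrArg (fun g => g.hom y) h2

lemma qq_zero' (z : Cyc P Y n) : qq P Y n z = 0 ↔ ((LY P Y).homologyι n).unop z = 0 := by
  have : Function.Injective ((isoL P Y n).hom.unop) := by
    rw [← ModuleCat.mono_iff_injective]
    exact unop_mono_of_epi _
  constructor
  · intro h
    apply this
    rw [map_zero]
    exact h
  · intro h
    have h2 := congrArg ((isoL P Y n).hom.unop) h
    rw [map_zero] at h2
    exact h2

lemma qq_zero (z : Cyc P Y (n+1)) :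
    qq P Y (n+1) z = 0 ↔ ∃ g : P.complex.X n ⟶ Y, P.complex.d (n+1) n ≫ g = pp P Y (n+1) z := by
  have hex := (ShortComplex.exact_of_f_is_kernel
    (ShortComplex.mk _ _ ((LY P Y).homologyι_comp_fromOpcycles (n+1) n))
    ((LY P Y).homologyIsKernel (n+1) n (by simp)))
  rw [qq_zero', ker_unop_of_kernel _ _ _ hex]
  refine exists_congr fun g => ?_
  have h3 : pp P Y (n+1) (((LY P Y).fromOpcycles (n+1) n).unop g) = P.complex.d (n+1) n ≫ (g : P.complex.X n ⟶ Y) := by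
    have := congrArg Quiver.Hom.unop ((LY P Y).p_fromOpcycles (n+1) n)
    exact congrArg (fun a => a.hom g) this
  rw [← (pp_inj P Y (n+1)).eq_iff, h3]

lemma qq_zero0 (z : Cyc P Y 0) :
    qq P Y 0 z = 0 ↔ z = 0 := by
  rw [qq_zero']
  have : IsIso ((LY P Y).homologyι 0) := (LY P Y).isIso_homologyι 0 _ rfl (by simp [LY])
  have h : Function.Injective ((LY P Y).homologyι 0).unop := by
    rw [← ModuleCat.mono_iff_injective]
    exact unop_mono_of_epi _
  rw [← h.eq_iff, map_zero]

variable {Y} in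
lemma qq_natY {Y' : ModuleCat.{0} R} (g : Y ⟶ Y') (z : Cyc P Y n) (z' : Cyc P Y' n)
    (h : pp P Y' n z' = (pp P Y n z : P.complex.X n ⟶ Y) ≫ g) :
    ((Ext R (ModuleCat.{0} R) n).obj (op X)).map g (qq P Y n z) = qq P Y' n z' := by
  let α : FY Y' ⟶ FY Y := ((linearYoneda R (ModuleCat.{0} R)).map g).rightOp
  let β : LY P Y' ⟶ LY P Y := (NatTrans.mapHomologicalComplex α _).app P.complex
  have h1 : (NatTrans.leftDerived α n).app X ≫ (isoL P Y n).hom ≫ (LY P Y).homologyι n =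
      ((isoL P Y' n).hom ≫ (LY P Y').homologyι n) ≫ HomologicalComplex.opcyclesMap β n := by
    rw [ProjectiveResolution.leftDerived_app_eq α P n, Category.assoc, Category.assoc]
    erw [Iso.inv_hom_id_assoc]
    erw [HomologicalComplex.homologyι_naturality]
    rfl
  have h2 := congrArg Quiver.Hom.unop h1
  have h3 : ((Ext R (ModuleCat.{0} R) n).obj (op X)).map g (qq P Y n z) =
      qq P Y' n ((HomologicalComplex.opcyclesMap β n).unop z) := congrArg (fun a => a.hom z) h2
  rw [h3]
  congr 1
  apply pp_inj
  rw [h]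
  have h4 := congrArg Quiver.Hom.unop (HomologicalComplex.p_opcyclesMap β n)
  exact congrArg (fun a => a.hom z) h4

lemma qq_natX {X' : ModuleCat.{0} R} (P' : ProjectiveResolution X') (f : X' ⟶ X)
    (φ : P'.complex ⟶ P.complex) (comm : φ.f 0 ≫ P.π.f 0 = P'.π.f 0 ≫ f)
    (z : Cyc P Y n) (z' : Cyc P' Y n)
    (h : pp P' Y n z' = φ.f n ≫ (pp P Y n z : P.complex.X n ⟶ Y)) :
    ((Ext R (ModuleCat.{0} R) n).map f.op).app Y (qq P Y n z) = qq P' Y n z' := by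
  let β : LY P' Y ⟶ LY P Y := ((FY Y).mapHomologicalComplex _).map φ
  have h1 : ((FY Y).leftDerived n).map f ≫ (isoL P Y n).hom ≫ (LY P Y).homologyι n =
      ((isoL P' Y n).hom ≫ (LY P' Y).homologyι n) ≫ HomologicalComplex.opcyclesMap β n := by
    have h0 : ((FY Y).leftDerived n).map f ≫ (isoL P Y n).hom =
      (isoL P' Y n).hom ≫ HomologicalComplex.homologyMap β n :=
      ProjectiveResolution.isoLeftDerivedObj_hom_naturality f P' P φ comm (FY Y) n
    rw [← Category.assoc, h0, Category.assoc, Category.assoc,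
      HomologicalComplex.homologyι_naturality]
  have h2 := congrArg Quiver.Hom.unop h1
  have h3 : ((Ext R (ModuleCat.{0} R) n).map f.op).app Y (qq P Y n z) =
      qq P' Y n ((HomologicalComplex.opcyclesMap β n).unop z) := congrArg (fun a => a.hom z) h2
  rw [h3]
  congr 1
  apply pp_inj
  rw [h]
  have h4 := congrArg Quiver.Hom.unop (HomologicalComplex.p_opcyclesMap β n)
  exact congrArg (fun a => a.hom z) h4

def psi : Cyc P Y n →ₗ[R] Abelian.Ext.{0} X Y n where
  toFun z := P.extMk (pp P Y n z) (n+1) rfl (d_pp P Y n _ z)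
  map_add' z w := by
    rw [P.add_extMk]
    congr 1
    exact map_add (pp P Y n).hom z w
  map_smul' r z := by
    rw [RingHom.id_apply, Abelian.Ext.smul_eq_comp_mk₀, P.extMk_comp_mk₀]
    congr 1
    rw [Linear.comp_smul, Category.comp_id]
    exact map_smul (pp P Y n).hom r z

lemma psi_surj : Function.Surjective (psi P Y n) := by
  intro a
  obtain ⟨f, hf, rfl⟩ := P.extMk_surjective a (n+1) rfl
  obtain ⟨z, rfl⟩ := pp_range P Y n f hf
  exact ⟨z, rfl⟩

lemma extMk_zero_zero (f : P.complex.X 0 ⟶ Y)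
    (hf : P.complex.d 1 0 ≫ f = 0) (h : P.extMk f 1 rfl hf = 0) : f = 0 := by
  rw [← P.extEquivCohomologyClass.apply_eq_iff_eq,
    P.extEquivCohomologyClass_extMk, P.extEquivCohomologyClass_zero,
    CochainComplex.HomComplex.CohomologyClass.mk_eq_zero_iff] at h
  rw [CochainComplex.HomComplex.Cocycle.toSingleMk_mem_coboundaries_iff _ _ _ _ _ 1 (by simp)] at h
  obtain ⟨g, hg⟩ := h
  have hz : Limits.IsZero (P.cochainComplex.X 1) :=
    P.cochainComplex.isZero_of_isStrictlyLE 0 1 (by simp)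
  rw [hz.eq_of_src g 0, Limits.comp_zero] at hg
  rw [← cancel_epi (P.cochainComplexXIso (-(0:ℕ)) 0 rfl).hom, ← hg, Limits.comp_zero]

lemma psi_ker : LinearMap.ker (psi P Y n) = LinearMap.ker (qq P Y n).hom := by
  ext z
  rw [LinearMap.mem_ker, LinearMap.mem_ker]
  cases n with
  | zero =>
    refine Iff.trans ?_ (qq_zero0 P Y z).symm
    refine ⟨fun h => ?_, fun h => by rw [h, map_zero]⟩
    have h5 : P.extMk (pp P Y 0 z) 1 rfl (d_pp P Y 0 _ z) = 0 := h
    have h6 := extMk_zero_zero P Y _ _ h5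
    apply pp_inj
    rw [h6]
    exact (map_zero (pp P Y 0).hom).symm
  | succ n =>
    refine Iff.trans ?_ (qq_zero P Y n z).symm
    exact P.extMk_eq_zero_iff _ _ rfl (d_pp P Y (n+1) _ z) n rfl

def cmp : EE X Y n ≃ₗ[R] Abelian.Ext.{0} X Y n :=
  ((qq P Y n).hom.quotKerEquivOfSurjective (qq_surj P Y n)).symm ≪≫ₗ
    (Submodule.quotEquivOfEq _ _ (psi_ker P Y n).symm) ≪≫ₗ
    ((psi P Y n).quotKerEquivOfSurjective (psi_surj P Y n))

lemma cmp_qq (z : Cyc P Y n) : cmp P Y n (qq P Y n z) = psi P Y n z := by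
  have : ((qq P Y n).hom.quotKerEquivOfSurjective (qq_surj P Y n)).symm (qq P Y n z) =
    Submodule.Quotient.mk z := by
    rw [LinearEquiv.symm_apply_eq]; rfl
  simp only [cmp, LinearEquiv.trans_apply]
  rw [this]
  rfl

variable {Y} in
lemma cmp_natY {Y' : ModuleCat.{0} R} (g : Y ⟶ Y') (e : EE X Y n) :
    cmp P Y' n (((Ext R (ModuleCat.{0} R) n).obj (op X)).map g e) =
      (cmp P Y n e).comp (Abelian.Ext.mk₀ g) (add_zero _) := by
  obtain ⟨z, rfl⟩ := qq_surj P Y n e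
  obtain ⟨z', hz'⟩ := pp_range P Y' n ((pp P Y n z : P.complex.X n ⟶ Y) ≫ g)
    (by rw [← Category.assoc, d_pp, Limits.zero_comp])
  rw [qq_natY P n g z z' hz', cmp_qq, cmp_qq]
  change P.extMk _ _ rfl (d_pp P Y' n _ z') = (P.extMk _ _ rfl (d_pp P Y n _ z)).comp _ _
  rw [P.extMk_comp_mk₀]
  congr 1

lemma cmp_natX {X' : ModuleCat.{0} R} (P' : ProjectiveResolution X') (f : X' ⟶ X) (e : EE X Y n) :
    cmp P' Y n (((Ext R (ModuleCat.{0} R) n).map f.op).app Y e) =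
      (Abelian.Ext.mk₀ f).comp (cmp P Y n e) (zero_add _) := by
  obtain ⟨z, rfl⟩ := qq_surj P Y n e
  let φ : ProjectiveResolution.Hom P' P f :=
    ⟨ProjectiveResolution.lift f P' P, ProjectiveResolution.lift_commutes_zero f P' P⟩
  obtain ⟨z', hz'⟩ := pp_range P' Y n (φ.hom.f n ≫ (pp P Y n z : P.complex.X n ⟶ Y))
    (by rw [← Category.assoc, ← φ.hom.comm, Category.assoc, d_pp, Limits.comp_zero])
  rw [qq_natX P Y n P' f φ.hom (ProjectiveResolution.lift_commutes_zero f P' P) z z' hz', cmp_qq, cmp_qq]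
  change P'.extMk _ _ rfl (d_pp P' Y n _ z') =
    (Abelian.Ext.mk₀ f).comp (P.extMk _ _ rfl (d_pp P Y n _ z)) _
  rw [P.mk₀_comp_extMk _ _ _ _ φ]
  congr 1


abbrev Xt (J : Ideal R) (t : ℕ) : ModuleCat.{0} R := ModuleCat.of R (R ⧸ J ^ t)

def tr (J : Ideal R) {s t : ℕ} (h : s ≤ t) : Xt J t ⟶ Xt J s :=
  ModuleCat.ofHom (Submodule.mapQ _ _ LinearMap.id (Ideal.pow_le_pow_right h))

abbrev LC (J : Ideal R) (i : ℕ) (M : ModuleCat.{0} R) : ModuleCat.{0} R := (localCohomology J i).obj M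

abbrev Dg (J : Ideal R) (i : ℕ) := localCohomology.diagram (localCohomology.idealPowersDiagram J) i

def coc (J : Ideal R) (i : ℕ) (M : ModuleCat.{0} R) :=
  ((evaluation _ _).obj M).mapCocone (Limits.colimit.cocone (Dg J i))

def cocIs (J : Ideal R) (i : ℕ) (M : ModuleCat.{0} R) : Limits.IsColimit (coc J i M) :=
  Limits.isColimitOfPreserves _ (Limits.colimit.isColimit (Dg J i))

def io0 (J : Ideal R) (i : ℕ) (M : ModuleCat.{0} R) (t : ℕ) : EE (Xt J t) M i ⟶ LC J i M :=
  (coc J i M).ι.app (op (op t))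

lemma io0_map (J : Ideal R) (i : ℕ) {M N : ModuleCat.{0} R} (f : M ⟶ N) (t : ℕ)
    (e : EE (Xt J t) M i) :
    (localCohomology J i).map f (io0 J i M t e) = 
      io0 J i N t (((Ext R (ModuleCat.{0} R) i).obj (op (Xt J t))).map f e) := by
  have := ((Limits.colimit.ι (Dg J i) (op (op t))).naturality f)
  exact (congrArg (fun a => a.hom e) this).symm

lemma io0_tr (J : Ideal R) (i : ℕ) (M : ModuleCat.{0} R) {s t : ℕ} (h : s ≤ t)
    (e : EE (Xt J s) M i) :
    io0 J i M t (((Ext R (ModuleCat.{0} R) i).map (tr J h).op).app M e) = io0 J i M s e := by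
  have := (coc J i M).w (homOfLE h).op.op
  exact (congrArg (fun a => a.hom e) this)

lemma io0_surj (J : Ideal R) (i : ℕ) (M : ModuleCat.{0} R) (z : LC J i M) :
    ∃ t e, io0 J i M t e = z := by
  obtain ⟨j, y, h⟩ := Limits.Concrete.isColimit_exists_rep _ (cocIs J i M) z
  exact ⟨j.unop.unop, y, h⟩

lemma io0_zero (J : Ideal R) (i : ℕ) (M : ModuleCat.{0} R) (s : ℕ) (e : EE (Xt J s) M i)
    (h : io0 J i M s e = 0) : ∃ t, ∃ h : s ≤ t,
      ((Ext R (ModuleCat.{0} R) i).map (tr J h).op).app M e = 0 := by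
  obtain ⟨k, f, g, h⟩ := Limits.Concrete.isColimit_exists_of_rep_eq _ (cocIs J i M)
    (i := op (op s)) (j := op (op s)) e 0 (h.trans (map_zero (io0 J i M s).hom).symm)
  refine ⟨k.unop.unop, leOfHom f.unop.unop, ?_⟩
  refine h.trans ?_
  exact map_zero ((((Ext R (ModuleCat.{0} R) i).map (tr J (leOfHom g.unop.unop)).op).app M).hom)

abbrev AE (J : Ideal R) (i : ℕ) (M : ModuleCat.{0} R) (t : ℕ) := Abelian.Ext.{0} (Xt J t) M i

def io (J : Ideal R) (i : ℕ) (M : ModuleCat.{0} R) (t : ℕ) : AE J i M t →ₗ[R] LC J i M :=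
  (io0 J i M t).hom ∘ₗ (cmp (projectiveResolution (Xt J t)) M i).symm.toLinearMap

lemma io_cmp (J : Ideal R) (i : ℕ) (M : ModuleCat.{0} R) (t : ℕ) (e) :
    io J i M t (cmp (projectiveResolution (Xt J t)) M i e) = io0 J i M t e := by
  simp [io]

def trE (J : Ideal R) (i : ℕ) (M : ModuleCat.{0} R) {s t : ℕ} (h : s ≤ t) (e : AE J i M s) : AE J i M t :=
  (Abelian.Ext.mk₀ (tr J h)).comp e (zero_add _)

lemma io_map (J : Ideal R) (i : ℕ) {M N : ModuleCat.{0} R} (f : M ⟶ N) (t : ℕ)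
    (e : AE J i M t) :
    (localCohomology J i).map f (io J i M t e) = io J i N t (e.comp (Abelian.Ext.mk₀ f) (add_zero _)) := by
  obtain ⟨e, rfl⟩ := (cmp (projectiveResolution (Xt J t)) M i).surjective e
  rw [← cmp_natY, io_cmp, io_cmp, io0_map]

lemma io_tr (J : Ideal R) (i : ℕ) (M : ModuleCat.{0} R) {s t : ℕ} (h : s ≤ t)
    (e : AE J i M s) :
    io J i M t (trE J i M h e) = io J i M s e := by
  obtain ⟨e, rfl⟩ := (cmp (projectiveResolution (Xt J s)) M i).surjective e
  rw [trE, ← cmp_natX _ _ _ (projectiveResolution (Xt J t)), io_cmp, io_cmp, io0_tr]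

lemma io_surj (J : Ideal R) (i : ℕ) (M : ModuleCat.{0} R) (z : LC J i M) :
    ∃ t e, io J i M t e = z := by
  obtain ⟨t, e, rfl⟩ := io0_surj J i M z
  exact ⟨t, _, io_cmp J i M t e⟩

lemma io_zero (J : Ideal R) (i : ℕ) (M : ModuleCat.{0} R) (s : ℕ) (e : AE J i M s)
    (h : io J i M s e = 0) : ∃ t, ∃ h : s ≤ t, trE J i M h e = 0 := by
  obtain ⟨e, rfl⟩ := (cmp (projectiveResolution (Xt J s)) M i).surjective e
  rw [io_cmp] at h
  obtain ⟨t, h, ht⟩ := io0_zero J i M s e h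
  refine ⟨t, h, ?_⟩
  rw [trE, ← cmp_natX _ _ _ (projectiveResolution (Xt J t)), ht, map_zero]

lemma trE_trE (J : Ideal R) (i : ℕ) (M : ModuleCat.{0} R) {s t u : ℕ} (h : s ≤ t) (h' : t ≤ u)
    (e : AE J i M s) : trE J i M h' (trE J i M h e) = trE J i M (h.trans h') e := by
  have : tr J (h.trans h') = tr J h' ≫ tr J h := by
    apply ModuleCat.hom_ext
    apply Submodule.linearMap_qext
    rfl
  rw [trE, trE, trE, this]
  exact Abelian.Ext.mk₀_comp_mk₀_assoc (tr J h') (tr J h) e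

/-- universal property -/
lemma exists_lift (J : Ideal R) (i : ℕ) (M : ModuleCat.{0} R) {N : Type} [AddCommGroup N] [Module R N]
    (g : ∀ t, AE J i M t →ₗ[R] N)
    (hg : ∀ s t (h : s ≤ t) e, g t (trE J i M h e) = g s e) :
    ∃ G : LC J i M →ₗ[R] N, ∀ t e, G (io J i M t e) = g t e := by
  have key : ∀ s t e e', io J i M s e = io J i M t e' → g s e = g t e' := by
    intro s t e e' h
    rw [← io_tr J i M (le_max_left s t) e, ← io_tr J i M (le_max_right s t) e', ← sub_eq_zero,
      ← map_sub] at h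
    obtain ⟨u, hu, h⟩ := io_zero _ _ _ _ _ h
    have := congrArg (g u) h
    rw [hg, map_zero, map_sub, hg, hg, sub_eq_zero] at this
    exact this
  choose T E hE using io_surj J i M
  have hG : ∀ t e, g (T (io J i M t e)) (E (io J i M t e)) = g t e := fun t e => key _ _ _ _ (hE _)
  refine ⟨{ toFun := fun z => g (T z) (E z), map_add' := ?_, map_smul' := ?_ }, hG⟩
  · intro z w
    have : io J i M (max (T z) (T w)) (trE J i M (le_max_left _ _) (E z) +
        trE J i M (le_max_right _ _) (E w)) = z + w := by
      rw [map_add, io_tr, io_tr, hE, hE]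
    conv_lhs => rw [← this]
    rw [hG, map_add, hg, hg]
  · intro r z
    have : io J i M (T z) (r • E z) = r • z := by rw [map_smul, hE]
    conv_lhs => rw [← this]
    rw [hG, map_smul]
    rfl

end
end LCaux

namespace LCaux
noncomputable section
variable {R : Type} [CommRing R]

/-- short exact sequences -/
structure SES {A B C : Type} [AddCommGroup A] [Module R A] [AddCommGroup B] [Module R B]
    [AddCommGroup C] [Module R C] (f : A →ₗ[R] B) (g : B →ₗ[R] C) : Prop where
  inj : Function.Injective f
  ex : Function.Exact f g
  surj : Function.Surjective g

abbrev HH (J : Ideal R) (i : ℕ) (A : Type) [AddCommGroup A] [Module R A] : ModuleCat.{0} R :=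
  (localCohomology J i).obj (ModuleCat.of R A)

variable {A B C A' B' C' : Type} [AddCommGroup A] [Module R A] [AddCommGroup B] [Module R B]
    [AddCommGroup C] [Module R C] [AddCommGroup A'] [Module R A'] [AddCommGroup B'] [Module R B']
    [AddCommGroup C'] [Module R C']

def hm (J : Ideal R) (i : ℕ) (f : A →ₗ[R] B) : HH J i A →ₗ[R] HH J i B :=
  ((localCohomology J i).map (ModuleCat.ofHom f)).hom

lemma hm_io (J : Ideal R) (i : ℕ) (f : A →ₗ[R] B) (t : ℕ) (e : AE J i (ModuleCat.of R A) t) :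
    hm J i f (io J i _ t e) = io J i _ t (e.comp (Abelian.Ext.mk₀ (ModuleCat.ofHom f)) (add_zero _)) :=
  io_map J i _ t e

lemma hm_id (J : Ideal R) (i : ℕ) : hm J i (LinearMap.id : A →ₗ[R] A) = LinearMap.id := by
  rw [hm, ModuleCat.ofHom_id, CategoryTheory.Functor.map_id]; rfl

lemma hm_comp (J : Ideal R) (i : ℕ) (g : B →ₗ[R] C) (f : A →ₗ[R] B) :
    hm J i (g ∘ₗ f) = hm J i g ∘ₗ hm J i f := by
  rw [hm, ModuleCat.ofHom_comp, CategoryTheory.Functor.map_comp]; rfl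

lemma hm_comp_apply (J : Ideal R) (i : ℕ) (g : B →ₗ[R] C) (f : A →ₗ[R] B) (z) :
    hm J i g (hm J i f z) = hm J i (g ∘ₗ f) z := by
  rw [hm_comp]; rfl

lemma hm_add (J : Ideal R) (i : ℕ) (f g : A →ₗ[R] B) : hm J i (f + g) = hm J i f + hm J i g := by
  ext z
  obtain ⟨t, e, rfl⟩ := io_surj _ _ _ z
  rw [LinearMap.add_apply, hm_io, hm_io, hm_io, ← map_add, ← Abelian.Ext.comp_add, ← Abelian.Ext.mk₀_add]
  rfl

lemma hm_smul (J : Ideal R) (i : ℕ) (r : R) (f : A →ₗ[R] B) : hm J i (r • f) = r • hm J i f := by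
  ext z
  obtain ⟨t, e, rfl⟩ := io_surj _ _ _ z
  rw [LinearMap.smul_apply, hm_io, hm_io, ← map_smul, ← Abelian.Ext.comp_smul, ← Abelian.Ext.mk₀_smul]
  rfl

lemma hm_zero (J : Ideal R) (i : ℕ) : hm J i (0 : A →ₗ[R] B) = 0 := by
  have := hm_smul J i 0 (0 : A →ₗ[R] B)
  simpa using this

lemma hm_sum (J : Ideal R) (i : ℕ) {ι : Type} (s : Finset ι) (f : ι → A →ₗ[R] B) :
    hm J i (∑ j ∈ s, f j) = ∑ j ∈ s, hm J i (f j) := by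
  classical
  induction s using Finset.induction_on with
  | empty => simp [hm_zero]
  | insert a s ha ih => rw [Finset.sum_insert ha, Finset.sum_insert ha, hm_add, ih]

abbrev scx (f : A →ₗ[R] B) (g : B →ₗ[R] C) (h : SES f g) : ShortComplex (ModuleCat.{0} R) :=
  ShortComplex.mk (ModuleCat.ofHom f) (ModuleCat.ofHom g) (by
    ext z; exact h.ex.apply_apply_eq_zero z)

lemma scx_ex (f : A →ₗ[R] B) (g : B →ₗ[R] C) (h : SES f g) : (scx f g h).ShortExact where
  exact := (ShortComplex.ShortExact.moduleCat_exact_iff_function_exact _).2 h.ex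
  mono_f := (ModuleCat.mono_iff_injective _).2 h.inj
  epi_g := (ModuleCat.epi_iff_surjective _).2 h.surj

def ecl {f : A →ₗ[R] B} {g : B →ₗ[R] C} (h : SES f g) :
   Abelian.Ext.{0} (ModuleCat.of R C) (ModuleCat.of R A) 1 := (scx_ex f g h).extClass

lemma trE_comp (J : Ideal R) (i k l : ℕ) (M N : ModuleCat.{0} R) {s t : ℕ} (hst : s ≤ t)
    (e : AE J i M s) (c : Abelian.Ext.{0} M N k) (h : i + k = l) :
    trE J l N hst (e.comp c h) = (trE J i M hst e).comp c h := by
  rw [trE, trE, Abelian.Ext.comp_assoc _ _ _ _ (by omega)]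
  lia

lemma dl_ex (J : Ideal R) (i : ℕ) {f : A →ₗ[R] B} {g : B →ₗ[R] C} (h : SES f g) :
    ∃ G : HH J i C →ₗ[R] HH J (i+1) A, ∀ t (e : AE J i (ModuleCat.of R C) t), G (io J i _ t e) =
      io J (i+1) (ModuleCat.of R A) t (e.comp (ecl h) rfl) := by
  refine exists_lift J i _ (fun t => (io J (i+1) (ModuleCat.of R A) t) ∘ₗ
    { toFun := fun e => e.comp (ecl h) rfl
      map_add' := fun a b => Abelian.Ext.add_comp _ _ _ _
      map_smul' := fun r a => Abelian.Ext.smul_comp _ _ _ _ }) ?_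
  intro s t hst e
  change io J (i+1) _ t ((trE J i _ hst e).comp (ecl h) rfl) = io J (i+1) _ s (e.comp (ecl h) rfl)
  rw [← io_tr J (i+1) _ hst, trE_comp]

def dl (J : Ideal R) (i : ℕ) {f : A →ₗ[R] B} {g : B →ₗ[R] C} (h : SES f g) :
    HH J i C →ₗ[R] HH J (i+1) A := (dl_ex J i h).choose

lemma dl_io (J : Ideal R) (i : ℕ) {f : A →ₗ[R] B} {g : B →ₗ[R] C} (h : SES f g) (t)
    (e : AE J i (ModuleCat.of R C) t) : dl J i h (io J i _ t e) =
      io J (i+1) (ModuleCat.of R A) t (e.comp (ecl h) rfl) := (dl_ex J i h).choose_spec t e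

lemma ex_mid (J : Ideal R) (i : ℕ) {f : A →ₗ[R] B} {g : B →ₗ[R] C} (h : SES f g) :
    Function.Exact (hm J i f) (hm J i g) := by
  intro z
  constructor
  · intro hz
    obtain ⟨t, e, rfl⟩ := io_surj _ _ _ z
    rw [hm_io] at hz
    obtain ⟨u, hu, hz⟩ := io_zero _ _ _ _ _ hz
    rw [trE_comp] at hz
    obtain ⟨e', he'⟩ := Abelian.Ext.covariant_sequence_exact₂ _ (scx_ex f g h) _ hz
    refine ⟨io J i _ u e', ?_⟩
    rw [hm_io, ← io_tr _ _ _ hu]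
    exact congrArg _ he'
  · rintro ⟨y, rfl⟩
    rw [hm_comp_apply, h.ex.linearMap_comp_eq_zero, hm_zero]; rfl

lemma ex_right (J : Ideal R) (i : ℕ) {f : A →ₗ[R] B} {g : B →ₗ[R] C} (h : SES f g) :
    Function.Exact (hm J i g) (dl J i h) := by
  intro z
  constructor
  · intro hz
    obtain ⟨t, e, rfl⟩ := io_surj _ _ _ z
    rw [dl_io] at hz
    obtain ⟨u, hu, hz⟩ := io_zero _ _ _ _ _ hz
    rw [trE_comp] at hz
    obtain ⟨e', he'⟩ := Abelian.Ext.covariant_sequence_exact₃ _ (scx_ex f g h) _ rfl hz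
    refine ⟨io J i _ u e', ?_⟩
    rw [hm_io, ← io_tr _ _ _ hu]
    exact congrArg _ he'
  · rintro ⟨y, rfl⟩
    obtain ⟨t, e, rfl⟩ := io_surj _ _ _ y
    rw [hm_io, dl_io, Abelian.Ext.comp_assoc _ _ _ _ (zero_add 1) (by omega)]
    erw [(scx_ex f g h).comp_extClass]
    rw [Abelian.Ext.comp_zero, map_zero]

lemma ex_left (J : Ideal R) (i : ℕ) {f : A →ₗ[R] B} {g : B →ₗ[R] C} (h : SES f g) :
    Function.Exact (dl J i h) (hm J (i+1) f) := by
  intro z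
  constructor
  · intro hz
    obtain ⟨t, e, rfl⟩ := io_surj _ _ _ z
    rw [hm_io] at hz
    obtain ⟨u, hu, hz⟩ := io_zero _ _ _ _ _ hz
    rw [trE_comp] at hz
    obtain ⟨e', he'⟩ := Abelian.Ext.covariant_sequence_exact₁ _ (scx_ex f g h) _ hz rfl
    refine ⟨io J i _ u e', ?_⟩
    rw [dl_io, ← io_tr _ _ _ hu]
    exact congrArg _ he'
  · rintro ⟨y, rfl⟩
    obtain ⟨t, e, rfl⟩ := io_surj _ _ _ y
    rw [dl_io, hm_io, Abelian.Ext.comp_assoc _ _ _ _ (add_zero 1) (by omega)]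
    erw [(scx_ex f g h).extClass_comp]
    rw [Abelian.Ext.comp_zero, map_zero]

lemma dl_nat (J : Ideal R) (i : ℕ) {f : A →ₗ[R] B} {g : B →ₗ[R] C} (h : SES f g)
    {f' : A' →ₗ[R] B'} {g' : B' →ₗ[R] C'} (h' : SES f' g') (a : A →ₗ[R] A') (b : B →ₗ[R] B')
    (c : C →ₗ[R] C') (h1 : b ∘ₗ f = f' ∘ₗ a) (h2 : c ∘ₗ g = g' ∘ₗ b) (z : HH J i C) :
    dl J i h' (hm J i c z) = hm J (i+1) a (dl J i h z) := by
  obtain ⟨t, e, rfl⟩ := io_surj _ _ _ z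
  rw [dl_io, hm_io, hm_io, dl_io]
  let φ : scx f g h ⟶ scx f' g' h' :=
    { τ₁ := ModuleCat.ofHom a
      τ₂ := ModuleCat.ofHom b
      τ₃ := ModuleCat.ofHom c
      comm₁₂ := by ext z; exact (LinearMap.congr_fun h1 z).symm
      comm₂₃ := by ext z; exact (LinearMap.congr_fun h2 z).symm }
  have := ShortComplex.ShortExact.extClass_naturality (scx_ex f g h) (scx_ex f' g' h') φ
  congr 1
  rw [Abelian.Ext.comp_assoc _ _ _ _ (add_zero 1) (by omega), Abelian.Ext.comp_assoc _ _ _ _ (zero_add 1) (by omega)]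
  congr 1
  exact this.symm

end
end LCaux

namespace LCaux
noncomputable section
variable {R : Type} [CommRing R]
variable {A B C A' B' C' : Type} [AddCommGroup A] [Module R A] [AddCommGroup B] [Module R B]
    [AddCommGroup C] [Module R C] [AddCommGroup A'] [Module R A'] [AddCommGroup B'] [Module R B']
    [AddCommGroup C'] [Module R C']

/-- power torsion -/
def Gam (J : Ideal R) (A : Type) [AddCommGroup A] [Module R A] : Submodule R A where
  carrier := {a | ∃ t : ℕ, ∀ r ∈ J ^ t, r • a = 0}
  zero_mem' := ⟨0, fun r _ => smul_zero r⟩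
  add_mem' := by
    rintro a b ⟨s, hs⟩ ⟨t, ht⟩
    refine ⟨max s t, fun r hr => ?_⟩
    rw [smul_add, hs r (Ideal.pow_le_pow_right (le_max_left _ _) hr),
      ht r (Ideal.pow_le_pow_right (le_max_right _ _) hr), add_zero]
  smul_mem' := by
    rintro c a ⟨s, hs⟩
    exact ⟨s, fun r hr => by rw [smul_comm, hs r hr, smul_zero]⟩

lemma mem_Gam (J : Ideal R) (a : A) : a ∈ Gam J A ↔ ∃ t : ℕ, ∀ r ∈ J ^ t, r • a = 0 := Iff.rfl

lemma unif (J : Ideal R) (N : Submodule R A) (hN : N.FG) (h : N ≤ Gam J A) :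
    ∃ n : ℕ, ∀ r ∈ J ^ n, ∀ a ∈ N, r • a = 0 := by
  obtain ⟨S, rfl⟩ := hN
  have h1 : ∀ a : A, ∃ t : ℕ, a ∈ S → ∀ r ∈ J ^ t, r • a = 0 := by
    intro a
    by_cases ha : a ∈ S
    · obtain ⟨t, ht⟩ := h (Submodule.subset_span ha)
      exact ⟨t, fun _ => ht⟩
    · exact ⟨0, fun h => absurd h ha⟩
  choose t ht using h1
  refine ⟨S.sup t, fun r hr a ha => ?_⟩
  have : Submodule.span R (S : Set A) ≤ Submodule.torsionBy R A r := by
    rw [Submodule.span_le]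
    intro b hb
    exact ht b hb r (Ideal.pow_le_pow_right (Finset.le_sup hb) hr)
  exact this ha

lemma th_ex (J : Ideal R) (A : Type) [AddCommGroup A] [Module R A] :
    ∃ G : HH J 0 A →ₗ[R] A, ∀ t (e : AE J 0 (ModuleCat.of R A) t), G (io J 0 _ t e) =
      (Abelian.Ext.linearEquiv₀ (R := R) e).hom (1 : R ⧸ J ^ t) := by
  refine exists_lift J 0 _ (fun t =>
    { toFun := fun e => (Abelian.Ext.linearEquiv₀ (R := R) e).hom (1 : R ⧸ J ^ t)
      map_add' := fun a b => by rw [map_add]; rfl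
      map_smul' := fun a b => by rw [map_smul]; rfl }) ?_
  intro s t hst e
  obtain ⟨φ, rfl⟩ := (Abelian.Ext.linearEquiv₀ (R := R)).symm.surjective e
  change (Abelian.Ext.linearEquiv₀ (R := R) ((Abelian.Ext.mk₀ (tr J hst)).comp (Abelian.Ext.mk₀ φ) _)).hom (1 : R ⧸ J ^ t) = 
    (Abelian.Ext.linearEquiv₀ (R := R) (Abelian.Ext.mk₀ φ)).hom (1 : R ⧸ J ^ s)
  rw [Abelian.Ext.mk₀_comp_mk₀]
  have h : ∀ {X Y : ModuleCat.{0} R} (f : X ⟶ Y), Abelian.Ext.linearEquiv₀ (R := R) (Abelian.Ext.mk₀ f) = f :=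
    fun f => (Abelian.Ext.linearEquiv₀ (R := R)).apply_symm_apply f
  rw [h, h]
  rfl

def th (J : Ideal R) (A : Type) [AddCommGroup A] [Module R A] : HH J 0 A →ₗ[R] A := (th_ex J A).choose

lemma th_mk (J : Ideal R) (t) (φ : Xt J t ⟶ ModuleCat.of R A) :
    th J A (io J 0 _ t (Abelian.Ext.mk₀ φ)) = φ.hom (1 : R ⧸ J ^ t) := by
  refine ((th_ex J A).choose_spec t _).trans ?_
  have h : ∀ {X Y : ModuleCat.{0} R} (f : X ⟶ Y), Abelian.Ext.linearEquiv₀ (R := R) (Abelian.Ext.mk₀ f) = f :=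
    fun f => (Abelian.Ext.linearEquiv₀ (R := R)).apply_symm_apply f
  rw [h]

lemma io0_rep (J : Ideal R) (z : HH J 0 A) : ∃ t, ∃ φ : Xt J t ⟶ ModuleCat.of R A,
    z = io J 0 _ t (Abelian.Ext.mk₀ φ) := by
  obtain ⟨t, e, rfl⟩ := io_surj _ _ _ z
  obtain ⟨φ, rfl⟩ := (Abelian.Ext.linearEquiv₀ (R := R)).symm.surjective e
  exact ⟨t, φ, rfl⟩

lemma th_inj (J : Ideal R) : Function.Injective (th J A) := by
  rw [injective_iff_map_eq_zero]
  intro z hz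
  obtain ⟨t, φ, rfl⟩ := io0_rep J z
  rw [th_mk] at hz
  have : φ = 0 := by
    apply ModuleCat.hom_ext
    apply Submodule.linearMap_qext
    ext
    exact hz
  rw [this, Abelian.Ext.mk₀_zero, map_zero]

lemma th_nat (J : Ideal R) (f : A →ₗ[R] B) (z : HH J 0 A) : th J B (hm J 0 f z) = f (th J A z) := by
  obtain ⟨t, φ, rfl⟩ := io0_rep J z
  rw [hm_io, Abelian.Ext.mk₀_comp_mk₀, th_mk, th_mk]
  rfl

lemma th_mem (J : Ideal R) (z : HH J 0 A) : th J A z ∈ Gam J A := by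
  obtain ⟨t, φ, rfl⟩ := io0_rep J z
  refine ⟨t, fun r hr => ?_⟩
  rw [th_mk, ← map_smul]
  have : r • (1 : R ⧸ J ^ t) = 0 := by
    rw [← Submodule.Quotient.mk_eq_zero] at hr
    rw [← hr, Algebra.smul_def, mul_one]; rfl
  exact (congrArg _ this).trans (map_zero _)

lemma th_surj (J : Ideal R) (a : A) (ha : a ∈ Gam J A) : ∃ z, th J A z = a := by
  obtain ⟨t, ht⟩ := ha
  let φ : Xt J t ⟶ ModuleCat.of R A := ModuleCat.ofHom
    (Submodule.liftQ (J ^ t) (LinearMap.toSpanSingleton R A a) (fun r hr => ht r hr))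
  refine ⟨io J 0 _ t (Abelian.Ext.mk₀ φ), ?_⟩
  rw [th_mk]
  change (1 : R) • a = a
  exact one_smul _ _

lemma hm0_inj (J : Ideal R) (f : A →ₗ[R] B) (hf : Function.Injective f) :
    Function.Injective (hm J 0 f) := by
  intro z w h
  apply th_inj J
  apply hf
  rw [← th_nat, ← th_nat, h]

lemma inj_van (J : Ideal R) (i : ℕ) (E : Type) [AddCommGroup E] [Module R E] [Module.Injective R E]
    (z : HH J (i+1) E) : z = 0 := by
  obtain ⟨t, e, rfl⟩ := io_surj _ _ _ z
  have := Module.injective_object_of_injective_module R E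
  rw [Abelian.Ext.eq_zero_of_injective e, map_zero]

lemma Gam_inj [IsNoetherianRing R] (J : Ideal R) (E : Type) [AddCommGroup E] [Module R E]
    [Module.Injective R E] : Module.Injective R (Gam J E) := by
  apply Module.Baer.injective
  intro I f
  obtain ⟨n, hn⟩ := unif J (LinearMap.range ((Gam J E).subtype ∘ₗ f))
    (by
      rw [LinearMap.range_eq_map]
      exact Submodule.FG.map _ (Module.Finite.fg_top)) (by
      rintro _ ⟨a, rfl⟩
      exact (f a).2)
  obtain ⟨k, hk⟩ := Ideal.exists_pow_inf_eq_pow_smul J (I : Submodule R R)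
  have hk := hk (n + k) (by omega)
  rw [Nat.add_sub_cancel] at hk
  have key : ∀ a : I, (a : R) ∈ J ^ (n + k) → f a = 0 := by
    intro a ha
    have h1 : (a : R) ∈ (J ^ (n+k) • ⊤ ⊓ I : Submodule R R) := ⟨by simpa using ha, a.2⟩
    rw [hk] at h1
    have h2 : (a : R) ∈ J ^ n • (I : Submodule R R) := Submodule.smul_mono le_rfl inf_le_right h1
    have h3 : (a : I) ∈ J ^ n • (⊤ : Submodule R I) := by
      have h4 : (J ^ n • (⊤ : Submodule R I)).map I.subtype = J ^ n • (I : Submodule R R) := by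
        rw [Submodule.map_smul'', Submodule.map_top]
        congr 1
        exact Submodule.range_subtype I
      rw [← h4] at h2
      obtain ⟨b, hb, hba⟩ := h2
      rwa [← Subtype.ext hba]
    have h5 : J ^ n • (⊤ : Submodule R I) ≤ LinearMap.ker f := by
      rw [Submodule.smul_le]
      intro r hr b _
      rw [LinearMap.mem_ker, map_smul]
      exact Subtype.ext (hn r hr _ ⟨b, rfl⟩)
    exact h5 h3
  let φ : I →ₗ[R] (R ⧸ J ^ (n+k)) := (Submodule.mkQ (J ^ (n+k))) ∘ₗ I.subtype
  have hφ : LinearMap.ker φ ≤ LinearMap.ker ((Gam J E).subtype ∘ₗ f) := by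
    intro a ha
    have : (a : R) ∈ J ^ (n + k) := (Submodule.Quotient.mk_eq_zero _).1 ha
    simp [key a this]
  obtain ⟨h, hh⟩ := Module.Injective.out ((LinearMap.ker φ).liftQ φ le_rfl)
    (by rw [← LinearMap.ker_eq_bot]; exact Submodule.ker_liftQ_eq_bot _ _ _ le_rfl)
    ((LinearMap.ker φ).liftQ _ hφ)
  refine ⟨(h ∘ₗ Submodule.mkQ (J ^ (n+k))).codRestrict (Gam J E) ?_, ?_⟩
  · intro c
    refine ⟨n + k, fun r hr => ?_⟩
    rw [← map_smul, LinearMap.comp_apply]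
    have : Submodule.mkQ (J ^ (n+k)) (r • c) = 0 :=
      (Submodule.Quotient.mk_eq_zero _).2 (Ideal.mul_mem_right _ _ hr)
    rw [this, map_zero]
  · intro a ha
    apply Subtype.ext
    exact hh (Submodule.Quotient.mk ⟨a, ha⟩)

lemma ses_mk (N : Submodule R A) : SES N.subtype N.mkQ where
  inj := N.injective_subtype
  ex := by
    rw [LinearMap.exact_iff]; simp
  surj := N.mkQ_surjective

lemma ses_range (f : A →ₗ[R] B) (hf : Function.Injective f) : SES f (LinearMap.range f).mkQ where
  inj := hf
  ex := by
    rw [LinearMap.exact_iff]; simp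
  surj := Submodule.mkQ_surjective _

lemma tors_van [IsNoetherianRing R] (J : Ideal R) (i : ℕ) : ∀ (U : Type) [AddCommGroup U] [Module R U]
    (hU : ∀ a : U, a ∈ Gam J U) (z : HH J (i+1) U), z = 0 := by
  induction i with
  | zero =>
    intro U _ _ hU z
    obtain ⟨⟨E, hE, f, hf⟩⟩ := EnoughInjectives.presentation (ModuleCat.of R U)
    have : Module.Injective R E := Module.injective_module_of_injective_object R E
    have := Gam_inj J E
    have hG : ∀ a : U, f.hom a ∈ Gam J E := by
      intro a
      obtain ⟨t, ht⟩ := hU a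
      exact ⟨t, fun r hr => by rw [← map_smul, ht r hr, map_zero]⟩
    let g : U →ₗ[R] Gam J E := f.hom.codRestrict _ hG
    have hg : Function.Injective g := by
      intro a b h
      exact (ModuleCat.mono_iff_injective f).1 hf (congrArg Subtype.val h)
    have S := ses_range g hg
    obtain ⟨w, rfl⟩ := (ex_left J 0 S z).1 (inj_van J 0 _ _)
    refine (ex_right J 0 S w).2 ?_
    obtain ⟨y, hy⟩ := S.surj (th J _ w)
    obtain ⟨v, hv⟩ := th_surj J y (by
      obtain ⟨t, ht⟩ := y.2
      exact ⟨t, fun r hr => Subtype.ext (ht r hr)⟩)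
    refine ⟨v, th_inj J ?_⟩
    rw [th_nat, hv, hy]
  | succ i ih =>
    intro U _ _ hU z
    obtain ⟨⟨E, hE, f, hf⟩⟩ := EnoughInjectives.presentation (ModuleCat.of R U)
    have : Module.Injective R E := Module.injective_module_of_injective_object R E
    have := Gam_inj J E
    have hG : ∀ a : U, f.hom a ∈ Gam J E := by
      intro a
      obtain ⟨t, ht⟩ := hU a
      exact ⟨t, fun r hr => by rw [← map_smul, ht r hr, map_zero]⟩
    let g : U →ₗ[R] Gam J E := f.hom.codRestrict _ hG
    have hg : Function.Injective g := by
      intro a b h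
      exact (ModuleCat.mono_iff_injective f).1 hf (congrArg Subtype.val h)
    have S := ses_range g hg
    obtain ⟨w, rfl⟩ := (ex_left J (i+1) S z).1 (inj_van J (i+1) _ _)
    rw [ih _ _ w, map_zero]
    intro a
    obtain ⟨y, rfl⟩ := S.surj a
    obtain ⟨t, ht⟩ := y.2
    exact ⟨t, fun r hr => by
      have h0 : r • y = 0 := Subtype.ext (ht r hr)
      rw [← map_smul, h0, map_zero]⟩

end
end LCaux

namespace LCaux
noncomputable section
variable {R : Type} [CommRing R]
variable {A B C A' B' C' : Type} [AddCommGroup A] [Module R A] [AddCommGroup B] [Module R B]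
    [AddCommGroup C] [Module R C] [AddCommGroup A'] [Module R A'] [AddCommGroup B'] [Module R B']
    [AddCommGroup C'] [Module R C']

lemma hm_quot_surj [IsNoetherianRing R] (J : Ideal R) (i : ℕ) (U : Submodule R A) (hU : U ≤ Gam J A) :
    Function.Surjective (hm J i U.mkQ) := by
  intro z
  refine (ex_right J i (ses_mk U) z).1 ?_
  refine tors_van J i _ ?_ _
  intro a
  obtain ⟨t, ht⟩ := hU a.2
  exact ⟨t, fun r hr => Subtype.ext (ht r hr)⟩

lemma hm_quot_inj [IsNoetherianRing R] (J : Ideal R) (i : ℕ) (U : Submodule R A) (hU : U ≤ Gam J A) :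
    Function.Injective (hm J (i+1) U.mkQ) := by
  rw [injective_iff_map_eq_zero]
  intro z hz
  obtain ⟨w, rfl⟩ := (ex_mid J (i+1) (ses_mk U) z).1 hz
  rw [tors_van J i _ ?_ w, map_zero]
  intro a
  obtain ⟨t, ht⟩ := hU a.2
  exact ⟨t, fun r hr => Subtype.ext (ht r hr)⟩

def Kl (J : Ideal R) (n i : ℕ) (A : Type) [AddCommGroup A] [Module R A] : Prop :=
  ∀ r ∈ J ^ n, ∀ z : HH J i A, r • z = 0

def ch : ℕ → Ideal R → Prop
  | 0, _ => True
  | (d+1), p => ∃ q : Ideal R, q.IsPrime ∧ p < q ∧ ch d q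

lemma ch_dim (I : Ideal R) (d : ℕ) : ∀ (p : Ideal R) (hp : p.IsPrime) (h : I ≤ p), ch d p →
    (d : ℕ∞) ≤ Order.coheight (⟨⟨p, hp⟩, h⟩ : PrimeSpectrum.zeroLocus (I : Set R)) := by
  induction d with
  | zero => intro p hp h _; simp
  | succ d ih =>
    rintro p hp h ⟨q, hq, hpq, hc⟩
    have h1 := ih q hq (h.trans hpq.le) hc
    have h2 := Order.coheight_add_one_le (α := PrimeSpectrum.zeroLocus (I : Set R)) (b := ⟨⟨p, hp⟩, h⟩)
      (a := ⟨⟨q, hq⟩, h.trans hpq.le⟩) hpq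
    refine le_trans ?_ h2
    push_cast
    gcongr

lemma exists_reg [IsNoetherianRing R] [IsLocalRing R] [Module.Finite R A]
    (h : Gam (maximalIdeal R) A = ⊥) : ∃ y ∈ maximalIdeal R, IsSMulRegular A y := by
  have : Subsingleton ((R ⧸ maximalIdeal R) →ₗ[R] A) := by
    refine subsingleton_of_forall_eq 0 fun φ => ?_
    apply Submodule.linearMap_qext
    ext
    have h1 : φ ((maximalIdeal R).mkQ 1) ∈ Gam (maximalIdeal R) A := by
      refine ⟨1, fun r hr => ?_⟩
      rw [pow_one] at hr
      rw [← map_smul, ← map_smul]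
      have : (maximalIdeal R).mkQ (r • 1) = 0 := by
        rw [Submodule.mkQ_apply, Submodule.Quotient.mk_eq_zero]; simpa using hr
      rw [this, map_zero]
    rw [h] at h1
    exact h1
  obtain ⟨y, hy, hr⟩ := IsSMulRegular.subsingleton_linearMap_iff.1 this
  rw [Ideal.annihilator_quotient] at hy
  exact ⟨y, hy, hr⟩

lemma Gam_quot [IsNoetherianRing R] [Module.Finite R A] (J : Ideal R) : Gam J (A ⧸ Gam J A) = ⊥ := by
  rw [eq_bot_iff]
  rintro b ⟨t, ht⟩
  obtain ⟨a, rfl⟩ := Submodule.mkQ_surjective _ b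
  have h1 : J ^ t • Submodule.span R {a} ≤ Gam J A := by
    rw [Submodule.smul_le]
    intro r hr c hc
    obtain ⟨s, rfl⟩ := Submodule.mem_span_singleton.1 hc
    have := ht r hr
    rw [← map_smul, Submodule.mkQ_apply, Submodule.Quotient.mk_eq_zero] at this
    rw [smul_comm]
    exact Submodule.smul_mem _ _ this
  obtain ⟨n, hn⟩ := unif J _ (IsNoetherian.noetherian _) h1
  have : a ∈ Gam J A := by
    refine ⟨n + t, fun r hr => ?_⟩
    rw [pow_add] at hr
    induction hr using Submodule.mul_induction_on' with
    | mem_mul_mem u hu v hv =>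
      rw [mul_smul]
      exact hn u hu _ (Submodule.smul_mem_smul hv (Submodule.mem_span_singleton_self a))
    | add u _ v _ hu hv => rw [add_smul, hu, hv, add_zero]
  simpa using this

lemma reg_ses (y : R) (hy : IsSMulRegular A y) :
    SES (y • (LinearMap.id : A →ₗ[R] A)) (LinearMap.range (y • (LinearMap.id : A →ₗ[R] A))).mkQ :=
  ses_range _ hy

/-- key contradiction -/
lemma case_b [IsNoetherianRing R] [IsLocalRing R] [Module.Finite R A] (p : Ideal R) 
    (h : Gam (maximalIdeal R) A = ⊥) (n : ℕ) (h1 : Kl (maximalIdeal R) n 1 A)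
    (y : R) (hy : y ∈ maximalIdeal R) (hr : IsSMulRegular A y) (N : Submodule R A) (hN : N = Gam p A)
    (hN0 : N ≠ ⊥)
    (ht : ∀ a : N ⧸ LinearMap.range (y ^ (n+1) • (LinearMap.id : N →ₗ[R] N)), a ∈ Gam (maximalIdeal R) _) :
    False := by
  set J := maximalIdeal R with hJ
  -- H^0(A/N)=0
  have hq : Gam J (A ⧸ N) = ⊥ := by
    rw [eq_bot_iff]
    rintro b ⟨t, htb⟩
    obtain ⟨a, rfl⟩ := Submodule.mkQ_surjective _ b
    have h1 : J ^ t • Submodule.span R {a} ≤ Gam p A := by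
      rw [Submodule.smul_le]
      intro r hr c hc
      obtain ⟨s, rfl⟩ := Submodule.mem_span_singleton.1 hc
      have := htb r hr
      rw [← map_smul, Submodule.mkQ_apply, Submodule.Quotient.mk_eq_zero, hN] at this
      rw [smul_comm]
      exact Submodule.smul_mem _ _ this
    obtain ⟨m, hm⟩ := unif p _ (IsNoetherian.noetherian _) h1
    have : a ∈ Gam p A := by
      refine ⟨m, fun r hr => ?_⟩
      have : r • a ∈ Gam J A := ⟨t, fun s hs => by
        rw [smul_comm]
        exact hm r hr _ (Submodule.smul_mem_smul hs (Submodule.mem_span_singleton_self a))⟩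
      rw [h] at this
      exact this
    rw [← hN] at this
    simpa using this
  have hN' : Gam J N = ⊥ := by
    rw [eq_bot_iff]
    rintro b ⟨t, htb⟩
    have : (b : A) ∈ Gam J A := ⟨t, fun r hr => congrArg Subtype.val (htb r hr)⟩
    rw [h] at this
    exact Subtype.ext this
  have z0 : ∀ {B : Type} [AddCommGroup B] [Module R B], Gam J B = ⊥ → ∀ z : HH J 0 B, z = 0 := by
    intro B _ _ hB z
    apply th_inj J
    have := th_mem J z
    rw [hB] at this
    rw [map_zero]; exact this
  have hK : Kl J n 1 N := by
    intro r hr z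
    have hi : Function.Injective (hm J 1 N.subtype) := by
      rw [injective_iff_map_eq_zero]
      intro z hz
      obtain ⟨w, rfl⟩ := (ex_left J 0 (ses_mk N) z).1 hz
      rw [z0 hq w, map_zero]
    apply hi
    rw [map_smul, map_zero]
    exact h1 r hr _
  have hyr : IsSMulRegular N (y ^ (n+1)) := by
    have := hr.pow (n+1)
    intro a b hab
    exact Subtype.ext (this (congrArg Subtype.val hab))
  have hyr1 : IsSMulRegular N (y ^ n) := by
    have := hr.pow n
    intro a b hab
    exact Subtype.ext (this (congrArg Subtype.val hab))
  have S := reg_ses (A := N) (y ^ (n+1)) hyr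
  have hd : Function.Injective (dl J 0 S) := by
    rw [injective_iff_map_eq_zero]
    intro z hz
    obtain ⟨w, rfl⟩ := (ex_right J 0 S z).1 hz
    rw [z0 hN' w, map_zero]
  have hdiv : ∀ v : N, ∃ w : N, v = y • w := by
    intro v
    obtain ⟨z, hz⟩ := th_surj J _ (ht (Submodule.mkQ _ v))
    have hk : y ^ n • z = 0 := by
      apply hd
      rw [map_smul, map_zero]
      exact hK _ (Ideal.pow_mem_pow hy n) _
    have h2 := congrArg (th J _) hk
    rw [map_smul, hz, map_zero, ← map_smul, Submodule.mkQ_apply, Submodule.Quotient.mk_eq_zero] at h2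
    obtain ⟨w, hw⟩ := h2
    refine ⟨w, hyr1 ?_⟩
    change y ^ n • v = y ^ n • y • w
    rw [← hw, smul_smul, ← pow_succ]
    rfl
  apply hN0
  refine Submodule.eq_bot_of_le_smul_of_le_jacobson_bot J N (IsNoetherian.noetherian _) ?_
    (IsLocalRing.jacobson_eq_maximalIdeal ⊥ bot_ne_top).ge
  intro v hv
  obtain ⟨w, hw⟩ := hdiv ⟨v, hv⟩
  have : v = y • (w : A) := congrArg Subtype.val hw
  rw [this]
  exact Submodule.smul_mem_smul hy w.2

lemma ass_claim [IsNoetherianRing R] [IsLocalRing R] (d : ℕ) :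
    ∀ (A : Type) [AddCommGroup A] [Module R A] [Module.Finite R A]
      (n : ℕ) (_ : ∀ i < d, Kl (maximalIdeal R) n i A) (p : Ideal R) (_ : p.IsPrime)
      (_ : p ≠ maximalIdeal R) (a : A) (_ : ∀ r, r ∈ p ↔ r • a = 0), ch d p := by
  induction d with
  | zero => intros; trivial
  | succ d ih =>
    intro A _ _ _ n hK p hp hpm a ha
    have hlt : p < maximalIdeal R := lt_of_le_of_ne (le_maximalIdeal hp.ne_top) hpm
    rcases Nat.eq_zero_or_pos d with rfl | hd
    · exact ⟨maximalIdeal R, inferInstance, hlt, trivial⟩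
    set J := maximalIdeal R with hJ
    -- reduce to torsion-free
    wlog hG : Gam J A = ⊥ generalizing A
    · refine this (A ⧸ Gam J A) ((Gam J A).mkQ a) ?_ ?_ (Gam_quot J)
      rotate_left
      · intro i hi r hr z
        obtain ⟨w, rfl⟩ := hm_quot_surj J i (Gam J A) le_rfl z
        rw [← map_smul, hK i hi r hr, map_zero]
      · intro r
        rw [← map_smul, Submodule.mkQ_apply, Submodule.Quotient.mk_eq_zero, ha]
        constructor
        · intro h; rw [h]; exact zero_mem _
        · rintro ⟨t, ht⟩
          obtain ⟨s, hs, hsp⟩ := Set.not_subset.1 hlt.not_ge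
          have := ht (s ^ t) (Ideal.pow_mem_pow hs t)
          rw [← mul_smul, ← ha] at this
          rw [← ha]
          rcases hp.mem_or_mem this with h | h
          · exact absurd (hp.mem_of_pow_mem _ h) hsp
          · exact h
    obtain ⟨y, hy, hr⟩ := exists_reg hG
    have hr' := hr.pow (n+1)
    have hy' : y ^ (n+1) ∈ J := Ideal.pow_mem_of_mem _ hy _ (by omega)
    set N := Gam p A with hN
    have haN : a ∈ N := ⟨1, fun r hr => by rw [pow_one] at hr; exact (ha r).1 hr⟩
    have ha0 : a ≠ 0 := by
      rintro rfl
      exact hp.ne_top ((Ideal.eq_top_iff_one _).2 ((ha 1).2 (smul_zero _)))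
    have S := reg_ses (A := A) _ hr'
    let L := N ⧸ LinearMap.range (y ^ (n+1) • (LinearMap.id : N →ₗ[R] N))
    by_cases hq : ∃ q ∈ (Module.annihilator R L).minimalPrimes, q ≠ J
    · obtain ⟨q, hq, hqJ⟩ := hq
      have hqp : q.IsPrime := hq.1.1
      have hqa : q ∈ associatedPrimes R L :=
        Module.associatedPrimes.minimalPrimes_annihilator_subset_associatedPrimes R L hq
      let φ : L →ₗ[R] (A ⧸ LinearMap.range (y ^ (n+1) • (LinearMap.id : A →ₗ[R] A))) :=
        Submodule.mapQ _ _ N.subtype (by rintro _ ⟨v, rfl⟩; exact ⟨v, rfl⟩)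
      have hφ : Function.Injective φ := by
        rw [injective_iff_map_eq_zero]
        intro l hl
        obtain ⟨v, rfl⟩ := Submodule.mkQ_surjective _ l
        have h1 : (v : A) ∈ LinearMap.range (y ^ (n+1) • (LinearMap.id : A →ₗ[R] A)) :=
          (Submodule.Quotient.mk_eq_zero _).1 hl
        obtain ⟨w, hw⟩ := h1
        have hw : y ^ (n+1) • w = v := hw
        have hwN : w ∈ N := by
          obtain ⟨t, ht⟩ := v.2
          refine ⟨t, fun r hrt => hr' ?_⟩
          change y ^ (n+1) • r • w = y ^ (n+1) • 0
          rw [smul_comm, hw, ht r hrt, smul_zero]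
        rw [Submodule.mkQ_apply, Submodule.Quotient.mk_eq_zero]
        exact ⟨⟨w, hwN⟩, Subtype.ext hw⟩
      have hqa := IsAssociatedPrime.map_of_injective φ hqa hφ
      rw [isAssociatedPrime_iff] at hqa
      obtain ⟨_, b, hb⟩ := hqa
      refine ⟨q, hqp, ?_, ih (A ⧸ LinearMap.range (y ^ (n+1) • (LinearMap.id : A →ₗ[R] A))) (n + n) ?_ q hqp hqJ b ?_⟩
      · have hyq : y ^ (n+1) ∈ q := by
          apply hq.1.2
          rw [Module.mem_annihilator]
          intro l
          obtain ⟨v, rfl⟩ := Submodule.mkQ_surjective _ l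
          rw [← map_smul, Submodule.mkQ_apply, Submodule.Quotient.mk_eq_zero]
          exact ⟨v, rfl⟩
        have hyp : y ^ (n+1) ∉ p := by
          intro h
          rw [ha] at h
          exact ha0 (hr' (h.trans (smul_zero _).symm))
        have hpq : p ≤ q := by
          obtain ⟨m, hm⟩ := unif p N (IsNoetherian.noetherian _) le_rfl
          have : p ^ m ≤ q := by
            refine le_trans ?_ hq.1.2
            intro r hr
            rw [Module.mem_annihilator]
            intro l
            obtain ⟨v, rfl⟩ := Submodule.mkQ_surjective _ l
            have h0 : r • v = 0 := Subtype.ext (hm r hr v v.2)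
            rw [← map_smul, h0, map_zero]
          exact hqp.le_of_pow_le this
        exact lt_of_le_of_ne hpq (fun h => hyp (h ▸ hyq))
      · intro i hi r hr z
        rw [pow_add] at hr
        induction hr using Submodule.mul_induction_on' with
        | mem_mul_mem u hu v hv =>
          rw [mul_smul]
          have h1 : dl J i S (v • z) = 0 := by
            rw [map_smul]; exact hK (i+1) (by omega) v hv _
          obtain ⟨w, hw⟩ := (ex_right J i S _).1 h1
          rw [← hw, ← map_smul, hK i (by omega) u hu, map_zero]
        | add u _ v _ hu hv => rw [add_smul, hu, hv, add_zero]
      · intro r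
        rw [hb]; simp [Submodule.mem_colon_singleton]
    · exfalso
      push Not at hq
      refine case_b p hG n (hK 1 (by omega)) y hy hr N rfl ?_ ?_
      · intro h
        rw [h] at haN
        exact ha0 haN
      · have h1 : J ≤ (Module.annihilator R L).radical := by
          rw [← Ideal.sInf_minimalPrimes]
          exact le_sInf fun q h => (hq q h).ge
        obtain ⟨k, hk⟩ := Ideal.exists_pow_le_of_le_radical_of_fg h1 (IsNoetherian.noetherian J)
        intro l
        exact ⟨k, fun r hr => Module.mem_annihilator.1 (hk hr) l⟩

end
end LCaux

namespace LCaux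
noncomputable section
variable {R : Type} [CommRing R]

lemma mul_rep (I K : Ideal R) (x : R) (hx : x ∈ I * K) : ∃ (ι : Type) (_ : Fintype ι) (a b : ι → R),
    (∀ j, a j ∈ I) ∧ (∀ j, b j ∈ K) ∧ x = ∑ j, a j * b j := by
  induction hx using Submodule.mul_induction_on' with
  | mem_mul_mem u hu v hv =>
    exact ⟨Unit, inferInstance, fun _ => u, fun _ => v, fun _ => hu, fun _ => hv, by simp⟩
  | add u _ v _ hu hv =>
    obtain ⟨ι, _, a, b, ha, hb, rfl⟩ := hu
    obtain ⟨κ, _, a', b', ha', hb', rfl⟩ := hv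
    refine ⟨ι ⊕ κ, inferInstance, Sum.elim a a', Sum.elim b b', ?_, ?_, ?_⟩
    · rintro (j | j)
      exacts [ha j, ha' j]
    · rintro (j | j)
      exacts [hb j, hb' j]
    · simp

theorem core [IsNoetherianRing R] (J : Ideal R) (M : Type) [AddCommGroup M] [Module R M]
    (e n : ℕ) (h0 : Kl J n 0 M) (he : Kl J n e M) (x : R) (hx : x ∈ J ^ (2 * n))
    (hU : ∀ m : M, x • m = 0 → m ∈ Gam J M) (X : Submodule R M)
    (hX : X = LinearMap.range (x • (LinearMap.id : M →ₗ[R] M))) :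
    Nonempty (Submodule.torsionBySet R (HH J e (M ⧸ X)) ((J ^ n : Ideal R) : Set R) ≃ₗ[R]
      HH J e M × Submodule.torsionBySet R (HH J (e+1) M) ((J ^ n : Ideal R) : Set R)) := by
  set U := Gam J M with hUdef
  have hUk : ∀ r ∈ J ^ n, ∀ u ∈ U, r • u = 0 := by
    intro r hr u hu
    obtain ⟨z, rfl⟩ := th_surj J u hu
    rw [← map_smul, h0 r hr, map_zero]
  have hxn : x ∈ J ^ n := Ideal.pow_le_pow_right (by omega) hx
  let x' : (M ⧸ U) →ₗ[R] M := U.liftQ (x • LinearMap.id) (fun u hu =>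
    LinearMap.mem_ker.2 (hUk x hxn u hu))
  have hx'π : x' ∘ₗ U.mkQ = x • LinearMap.id := U.liftQ_mkQ _ _
  have hx' : Function.Injective x' := by
    rw [injective_iff_map_eq_zero]
    intro v hv
    obtain ⟨m, rfl⟩ := U.mkQ_surjective v
    rw [Submodule.mkQ_apply, Submodule.Quotient.mk_eq_zero]
    exact hU m hv
  have hrx : LinearMap.range x' = X := by
    rw [hX, ← hx'π, LinearMap.range_comp_of_range_eq_top _ (Submodule.range_mkQ U)]
  have Sx : SES x' X.mkQ := by
    have := ses_range x' hx'
    rw [hrx] at this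
    exact this
  rw [two_mul, pow_add] at hx
  obtain ⟨ι, _, a, b, ha, hb, hab⟩ := mul_rep _ _ _ hx
  classical
  let b0 : M →ₗ[R] (ι → M) := ∑ j, b j • LinearMap.single R (fun _ : ι => M) j
  let aa : (ι → M) →ₗ[R] M := ∑ j, a j • LinearMap.proj j
  have hb0 : ∀ m j, b0 m j = b j • m := by
    intro m j
    simp [b0, Finset.sum_apply, Pi.single_apply]
  have haa : ∀ f, aa f = ∑ j, a j • f j := by
    intro f
    simp [aa]
  let bb : (M ⧸ U) →ₗ[R] (ι → M) := U.liftQ b0 (fun u hu => by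
    rw [LinearMap.mem_ker]
    ext j
    rw [hb0, hUk _ (hb j) u hu]; rfl)
  have hbπ : bb ∘ₗ U.mkQ = b0 := U.liftQ_mkQ _ _
  have hab' : aa ∘ₗ bb = x' := by
    apply Submodule.linearMap_qext
    ext m
    change aa (b0 m) = x • m
    rw [haa, hab, Finset.sum_smul]
    refine Finset.sum_congr rfl fun j _ => ?_
    rw [hb0, mul_smul]
  have hbb : Function.Injective bb := by
    have : Function.Injective (aa ∘ₗ bb) := by rw [hab']; exact hx'
    exact Function.Injective.of_comp this
  have Sb := ses_range bb hbb
  let ab : ((ι → M) ⧸ LinearMap.range bb) →ₗ[R] (M ⧸ X) := Submodule.mapQ _ _ aa (by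
    rintro _ ⟨v, rfl⟩
    rw [Submodule.mem_comap, ← hrx]
    exact ⟨v, by rw [← hab']; rfl⟩)
  have habq : ab ∘ₗ (LinearMap.range bb).mkQ = X.mkQ ∘ₗ aa := Submodule.mapQ_mkQ _ _ _
  have Haa : hm J e aa = 0 := by
    rw [hm_sum]
    refine Finset.sum_eq_zero fun j _ => ?_
    rw [hm_smul]
    ext z
    exact he _ (ha j) _
  -- well-definedness
  have wd : ∀ c, dl J e Sb c = 0 → hm J e ab c = 0 := by
    intro c hc
    obtain ⟨v, rfl⟩ := (ex_right J e Sb c).1 hc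
    rw [hm_comp_apply, habq, hm_comp, Haa]; simp
  let T := Submodule.torsionBySet R (HH J (e+1) M) ((J ^ n : Ideal R) : Set R)
  have hT : ∀ w : T, ∀ r ∈ J ^ n, r • (w : HH J (e+1) M) = 0 := fun w r hr =>
    (Submodule.mem_torsionBySet_iff _ _).1 w.2 ⟨r, hr⟩
  have exc : ∀ w : T, ∃ c, dl J e Sb c = hm J (e+1) U.mkQ w := by
    intro w
    refine (ex_left J e Sb _).1 ?_
    rw [hm_comp_apply, hbπ, hm_sum, LinearMap.sum_apply]
    refine Finset.sum_eq_zero fun j _ => ?_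
    rw [hm_smul, LinearMap.smul_apply, ← map_smul, hT w _ (hb j), map_zero]
  choose c hc using exc
  let σ : T →ₗ[R] HH J e (M ⧸ X) :=
    { toFun := fun w => hm J e ab (c w)
      map_add' := fun v w => by
        rw [← sub_eq_zero, ← map_add, ← map_sub]
        apply wd
        rw [map_sub, map_add, hc, hc, hc]
        simp
      map_smul' := fun r v => by
        rw [← sub_eq_zero, RingHom.id_apply, ← map_smul, ← map_sub]
        apply wd
        rw [map_sub, map_smul, hc, hc]
        simp }
  have hσ : ∀ w, dl J e Sx (σ w) = hm J (e+1) U.mkQ w := by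
    intro w
    change dl J e Sx (hm J e ab (c w)) = _
    rw [dl_nat J e Sb Sx LinearMap.id aa ab (by rw [hab']; rfl) habq, hm_id, LinearMap.id_apply, hc]
  have hinj1 : Function.Injective (hm J e X.mkQ) := by
    rw [injective_iff_map_eq_zero]
    intro u hu
    obtain ⟨v, rfl⟩ := (ex_mid J e Sx u).1 hu
    obtain ⟨v', rfl⟩ := hm_quot_surj J e U le_rfl v
    rw [hm_comp_apply, hx'π, hm_smul, hm_id]
    exact he x hxn _
  let Φ0 : (HH J e M × T) →ₗ[R] HH J e (M ⧸ X) := (hm J e X.mkQ).coprod σ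
  have hΦ : ∀ v, Φ0 v ∈ Submodule.torsionBySet R (HH J e (M ⧸ X)) ((J ^ n : Ideal R) : Set R) := by
    rintro ⟨u, w⟩
    rw [Submodule.mem_torsionBySet_iff]
    rintro ⟨r, hr⟩
    change r • Φ0 (u, w) = 0
    rw [← map_smul]
    have h1 : r • (u, w) = 0 := Prod.ext (he r hr u) (Subtype.ext (hT w r hr))
    rw [h1, map_zero]
  refine ⟨(LinearEquiv.ofBijective (Φ0.codRestrict _ hΦ) ⟨?_, ?_⟩).symm⟩
  · rw [injective_iff_map_eq_zero]
    rintro ⟨u, w⟩ h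
    have h : hm J e X.mkQ u + σ w = 0 := congrArg Subtype.val h
    have h1 := congrArg (dl J e Sx) h
    rw [map_add, (ex_right J e Sx).apply_apply_eq_zero, hσ, zero_add, map_zero] at h1
    have hw : w = 0 := Subtype.ext (hm_quot_inj J e U le_rfl (h1.trans (map_zero _).symm))
    subst hw
    rw [map_zero, add_zero] at h
    have hu : u = 0 := hinj1 (h.trans (map_zero _).symm)
    rw [hu]; rfl
  · rintro ⟨z, hz⟩
    rw [Submodule.mem_torsionBySet_iff] at hz
    obtain ⟨w, hw⟩ := hm_quot_surj J (e+1) U le_rfl (dl J e Sx z)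
    have hwT : w ∈ T := by
      rw [Submodule.mem_torsionBySet_iff]
      rintro ⟨r, hr⟩
      apply hm_quot_inj J e U le_rfl
      change hm J (e+1) U.mkQ (r • w) = _
      rw [map_smul, hw, ← map_smul, map_zero]
      have : r • z = 0 := hz ⟨r, hr⟩
      rw [this, map_zero]
    have : dl J e Sx (z - σ ⟨w, hwT⟩) = 0 := by
      rw [map_sub, hσ, ← hw, sub_self]
    obtain ⟨u, hu⟩ := (ex_right J e Sx _).1 this
    refine ⟨(u, ⟨w, hwT⟩), Subtype.ext ?_⟩
    change hm J e X.mkQ u + σ ⟨w, hwT⟩ = z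
    rw [hu, sub_add_cancel]

theorem par_tors [IsNoetherianRing R] [IsLocalRing R] (M : Type) [AddCommGroup M] [Module R M]
    [Module.Finite R M] (e n : ℕ) (hK : ∀ i < e + 1, Kl (maximalIdeal R) n i M) (x : R)
    (hpar : ringKrullDim (R ⧸ Module.annihilator R
      (M ⧸ (Ideal.span {x} • (⊤ : Submodule R M)))) = (e : WithBot (WithTop ℕ)))
    (m : M) (hm0 : x • m = 0) : m ∈ Gam (maximalIdeal R) M := by
  by_contra hmG
  set J := maximalIdeal R with hJ
  have hne : (Gam J M).mkQ m ≠ 0 := by simpa using hmG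
  obtain ⟨P, hP, hle⟩ := exists_le_isAssociatedPrime_of_isNoetherianRing R _ hne
  have hxP : x ∈ P := hle (by
    have : x • (Gam J M).mkQ m = 0 := by rw [← map_smul, hm0, map_zero]
    simpa [Submodule.mem_colon_singleton] using this)
  have hann := hP.annihilator_le
  rw [Submodule.annihilator_top] at hann
  rw [isAssociatedPrime_iff] at hP
  obtain ⟨hPp, b, hb⟩ := hP
  have hb' : ∀ r, r ∈ P ↔ r • b = 0 := by
    intro r; rw [hb]; simp [Submodule.mem_colon_singleton]
  have hPm : P ≠ J := by
    intro h
    have : b ∈ Gam J (M ⧸ Gam J M) := ⟨1, fun r hr => by rw [pow_one, ← h] at hr; exact (hb' r).1 hr⟩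
    rw [Gam_quot] at this
    have h1 := (hb' 1).2 (by rw [one_smul]; exact this)
    exact hPp.ne_top ((Ideal.eq_top_iff_one _).2 h1)
  have hch := ass_claim (e+1) (M ⧸ Gam J M) n (by
    intro i hi r hr z
    obtain ⟨w, rfl⟩ := hm_quot_surj J i (Gam J M) le_rfl z
    rw [← map_smul, hK i hi r hr, map_zero]) P hPp hPm b hb'
  have hannM : Module.annihilator R M ≤ P := by
    refine le_trans ?_ hann
    exact LinearMap.annihilator_le_of_surjective (Gam J M).mkQ (Gam J M).mkQ_surjective
  have hI : Module.annihilator R (M ⧸ (Ideal.span {x} • (⊤ : Submodule R M))) ≤ P := by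
    have h1 : (⟨P, hPp⟩ : PrimeSpectrum R) ∈ Module.support R M :=
      Module.mem_support_iff_of_finite.2 hannM
    have h2 : (⟨P, hPp⟩ : PrimeSpectrum R) ∈ Module.support R (M ⧸ (Ideal.span {x} • (⊤ : Submodule R M))) := by
      rw [Module.support_quotient]
      refine ⟨h1, ?_⟩
      rw [PrimeSpectrum.zeroLocus_span]
      exact Set.singleton_subset_iff.2 hxP
    exact Module.mem_support_iff_of_finite.1 h2
  have h3 := ch_dim _ (e+1) P hPp hI hch
  have h4 := Order.coheight_le_krullDim (⟨⟨P, hPp⟩, hI⟩ : PrimeSpectrum.zeroLocus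
    ((Module.annihilator R (M ⧸ (Ideal.span {x} • (⊤ : Submodule R M))) : Ideal R) : Set R))
  rw [← ringKrullDim_quotient, hpar] at h4
  have h5 : (((e + 1 : ℕ) : ℕ∞) : WithBot ℕ∞) ≤ ((e : ℕ∞) : WithBot ℕ∞) := 
    le_trans (WithBot.coe_le_coe.2 h3) h4
  rw [WithBot.coe_le_coe] at h5
  have h6 : e + 1 ≤ e := by exact_mod_cast h5
  omega

end
end LCaux

end

/-- **Corollary 4.1, second part.** Let `M` be a generalized Cohen-Macaulay module of
dimension `d > 0` over a Noetherian local ring `(R, 𝔪)` and let `n₀` be the least positive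
integer with `𝔪^{n₀}·H^i_𝔪(M) = 0` for all `i < d`. Then for every parameter element
`x ∈ 𝔪^{2n₀}` of `M`,
`(0 :_{H^{d-1}_𝔪(M/xM)} 𝔪^{n₀}) ≅ H^{d-1}_𝔪(M) ⊕ (0 :_{H^d_𝔪(M)} 𝔪^{n₀})`. -/
theorem localCohomology_top_torsion_splitting_of_generalizedCM
    {R : Type} [CommRing R] [IsNoetherianRing R] [IsLocalRing R]
    (M : Type) [AddCommGroup M] [Module R M] [Module.Finite R M]
    (d : ℕ) (hd : 0 < d)
    (hdim : ringKrullDim (R ⧸ Module.annihilator R M) = (d : WithBot (WithTop ℕ)))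
    (n₀ : ℕ)
    (hn₀ : IsLeast {k : ℕ | 0 < k ∧ ∀ i < d,
      (maximalIdeal R) ^ k ≤ Module.annihilator R
        ((localCohomology (maximalIdeal R) i).obj (ModuleCat.of R M))} n₀)
    (x : R) (hx : x ∈ (maximalIdeal R) ^ (2 * n₀))
    (hpar : ringKrullDim (R ⧸ Module.annihilator R
      (M ⧸ (Ideal.span {x} • (⊤ : Submodule R M)))) = ((d - 1 : ℕ) : WithBot (WithTop ℕ))) :
    Nonempty ((Submodule.torsionBySet R
        ((localCohomology (maximalIdeal R) (d - 1)).obj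
          (ModuleCat.of R (M ⧸ (Ideal.span {x} • (⊤ : Submodule R M)))))
        (((maximalIdeal R) ^ n₀ : Ideal R) : Set R)) ≃ₗ[R]
      ((localCohomology (maximalIdeal R) (d - 1)).obj (ModuleCat.of R M)) ×
      (Submodule.torsionBySet R
        ((localCohomology (maximalIdeal R) d).obj (ModuleCat.of R M))
        (((maximalIdeal R) ^ n₀ : Ideal R) : Set R))) := by

  obtain ⟨e, rfl⟩ : ∃ e, d = e + 1 := ⟨d - 1, by omega⟩
  have hK : ∀ i < e + 1, LCaux.Kl (maximalIdeal R) n₀ i M := fun i hi r hr z =>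
    Module.mem_annihilator.1 (hn₀.1.2 i hi hr) z
  refine LCaux.core (maximalIdeal R) M e n₀ (hK 0 (by omega)) (hK e (by omega)) x hx
    (LCaux.par_tors M e n₀ hK x hpar) _ ?_
  ext m
  rw [Submodule.ideal_span_singleton_smul, Submodule.mem_smul_pointwise_iff_exists]
  simp
end

section
/- Let R be a commutative Noetherian ring, 𝔞 an ideal, M a finitely generated R-module, and t, n₀ positive integers with 𝔞^{n₀}·H^i_𝔞(M) = 0 for all i < t. Let x₁, …, x_t be an 𝔞-filter regular sequence of M contained in 𝔞^{2n₀}. Then for every positive integer k ≤ n₀ and every j with 1 ≤ j ≤ t, there is an isomorphism Hom_R(R/𝔞^k, M/(x₁,…,x_j)M) ≅ ⨁_{i=0}^{j} Hom_R(R/𝔞^k, H^i_𝔞(M))^{⊕ binom(j,i)}; in particular Hom_R(R/𝔞^k, M/(x₁,…,x_j)M) is, up to isomorphism, independent of the choice of the 𝔞-filter regular sequence x₁, …, x_j in 𝔞^{2n₀}. -/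
open CategoryTheory


namespace FRS

/-- A cochain complex of modules indexed by the integers. -/
structure Cx (R : Type) [CommRing R] where
  X : ℤ → ModuleCat.{0} R
  d : ∀ i, X i →ₗ[R] X (i + 1)
  dd : ∀ i x, d (i + 1) (d i x) = 0

section
variable {R : Type} [CommRing R]

/-- cohomology in degree `i + 1` -/
abbrev Cx.H (D : Cx R) (i : ℤ) : Type :=
  LinearMap.ker (D.d (i + 1)) ⧸ (LinearMap.range (D.d i)).submoduleOf (LinearMap.ker (D.d (i + 1)))

/-- class of a cocycle -/
def Cx.cls (D : Cx R) (i : ℤ) : LinearMap.ker (D.d (i + 1)) →ₗ[R] D.H i := Submodule.mkQ _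

lemma Cx.cls_surj (D : Cx R) (i : ℤ) : Function.Surjective (D.cls i) := Submodule.mkQ_surjective _

lemma Cx.cls_eq_zero (D : Cx R) (i : ℤ) (z) : D.cls i z = 0 ↔ ∃ y, D.d i y = z.1 := by
  rw [Cx.cls, Submodule.mkQ_apply, Submodule.Quotient.mk_eq_zero]
  exact Iff.rfl

lemma factor {G E H : Type} [AddCommGroup G] [Module R G] [AddCommGroup E] [Module R E]
    [AddCommGroup H] [Module R H] (f : G →ₗ[R] E) (hf : Function.Surjective f) (ρ : G →ₗ[R] H)
    (h : ∀ g, f g = 0 → ρ g = 0) : ∃ κ : E →ₗ[R] H, ∀ g, κ (f g) = ρ g := by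
  refine ⟨(LinearMap.ker f).liftQ ρ (fun g hg => h g hg) ∘ₗ
    (f.quotKerEquivOfSurjective hf).symm.toLinearMap, fun g => ?_⟩
  have : (f.quotKerEquivOfSurjective hf).symm (f g) = Submodule.Quotient.mk g := by
    rw [LinearEquiv.symm_apply_eq]; rfl
  rw [LinearMap.comp_apply, LinearEquiv.coe_coe, this]
  exact Submodule.liftQ_apply _ _ _

lemma hom_split {A E B W : Type} [AddCommGroup A] [Module R A] [AddCommGroup E] [Module R E]
    [AddCommGroup B] [Module R B] [AddCommGroup W] [Module R W]
    (ι : A →ₗ[R] E) (hι : Function.Injective ι) (π : E →ₗ[R] B)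
    (hex : ∀ e, π e = 0 ↔ ∃ a, ι a = e) (N : Submodule R B) (s : N →ₗ[R] E)
    (hs : ∀ n, π (s n) = n) (hW : ∀ (v : W →ₗ[R] B) w, v w ∈ N) :
    Nonempty ((W →ₗ[R] E) ≃ₗ[R] (W →ₗ[R] A) × (W →ₗ[R] B)) := by
  let F : ((W →ₗ[R] A) × (W →ₗ[R] B)) →ₗ[R] (W →ₗ[R] E) :=
    { toFun := fun p => ι ∘ₗ p.1 + s ∘ₗ (p.2.codRestrict N (hW p.2))
      map_add' := by
        intro p q
        ext w
        have : (p.2 + q.2).codRestrict N (hW (p.2 + q.2)) w =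
          p.2.codRestrict N (hW p.2) w + q.2.codRestrict N (hW q.2) w := by
          ext; simp
        simp only [Prod.fst_add, Prod.snd_add, LinearMap.add_apply, LinearMap.comp_apply, map_add,
          this]
        abel
      map_smul' := by
        intro r p
        ext w
        have : (r • p.2).codRestrict N (hW (r • p.2)) w =
          r • p.2.codRestrict N (hW p.2) w := by
          ext; simp
        simp only [Prod.smul_fst, Prod.smul_snd, LinearMap.add_apply, LinearMap.comp_apply,
          map_smul, this, LinearMap.smul_apply, RingHom.id_apply, smul_add] }
  have hF : ∀ p w, F p w = ι (p.1 w) + s ⟨p.2 w, hW p.2 w⟩ := fun p w => rfl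
  have hπι : ∀ a, π (ι a) = 0 := fun a => (hex _).2 ⟨a, rfl⟩
  refine ⟨(LinearEquiv.ofBijective F ⟨?_, ?_⟩).symm⟩
  · rw [injective_iff_map_eq_zero]
    intro p hp
    have h2 : p.2 = 0 := by
      ext w
      have := congrArg π (LinearMap.congr_fun hp w)
      rw [hF, map_add, hπι, hs] at this
      simpa using this
    have h1 : p.1 = 0 := by
      ext w
      apply hι
      have := LinearMap.congr_fun hp w
      rw [hF] at this
      have e : (⟨p.2 w, hW p.2 w⟩ : N) = 0 := by ext; simp [h2]
      rw [e] at this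
      simpa using this
    exact Prod.ext h1 h2
  · intro u
    have hm : ∀ w, ∃ a, ι a = u w - s ⟨π (u w), hW (π ∘ₗ u) w⟩ := by
      intro w
      rw [← hex, map_sub, hs]
      simp
    choose a ha using hm
    refine ⟨⟨⟨⟨a, ?_⟩, ?_⟩, π ∘ₗ u⟩, ?_⟩
    · intro v w
      apply hι
      rw [map_add, ha, ha, ha]
      have : (⟨π (u (v + w)), hW (π ∘ₗ u) (v + w)⟩ : N) =
        ⟨π (u v), hW (π ∘ₗ u) v⟩ + ⟨π (u w), hW (π ∘ₗ u) w⟩ := by ext; simp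
      rw [this, map_add, map_add]; abel
    · intro r w
      apply hι
      simp only [map_smul, RingHom.id_apply]
      rw [ha, ha]
      have : (⟨π (u (r • w)), hW (π ∘ₗ u) (r • w)⟩ : N) =
        r • ⟨π (u w), hW (π ∘ₗ u) w⟩ := by ext; simp
      rw [this, map_smul, map_smul, smul_sub]
    · ext w
      rw [hF]
      simp only [LinearMap.coe_mk, AddHom.coe_mk, ha, LinearMap.comp_apply]
      abel

/-- mapping cone of multiplication by `x` -/
def cone (x : R) (D : Cx R) : Cx R where
  X i := ModuleCat.of R (D.X i × D.X (i + 1))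
  d i := ((D.d i ∘ₗ LinearMap.fst R _ _) + x • LinearMap.snd R _ _).prod
    (-(D.d (i + 1) ∘ₗ LinearMap.snd R _ _))
  dd i p := by
    obtain ⟨a, b⟩ := p
    apply Prod.ext
    · simp [D.dd]
    · simp [D.dd]

/-- first component -/
def cfst (x : R) (D : Cx R) (i : ℤ) : (cone x D).X i →ₗ[R] D.X i := LinearMap.fst R _ _
/-- second component -/
def csnd (x : R) (D : Cx R) (i : ℤ) : (cone x D).X i →ₗ[R] D.X (i + 1) := LinearMap.snd R _ _
/-- pairing -/
def cmk (x : R) (D : Cx R) (i : ℤ) (a : D.X i) (b : D.X (i + 1)) : (cone x D).X i := (a, b)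

@[simp] lemma cfst_mk (x : R) (D : Cx R) (i : ℤ) (a b) : cfst x D i (cmk x D i a b) = a := rfl
@[simp] lemma csnd_mk (x : R) (D : Cx R) (i : ℤ) (a b) : csnd x D i (cmk x D i a b) = b := rfl
lemma cext (x : R) (D : Cx R) (i : ℤ) {p q : (cone x D).X i} (h1 : cfst x D i p = cfst x D i q)
    (h2 : csnd x D i p = csnd x D i q) : p = q := Prod.ext h1 h2
@[simp] lemma cfst_d (x : R) (D : Cx R) (i : ℤ) (p) : cfst x D (i + 1) ((cone x D).d i p) =
    D.d i (cfst x D i p) + x • csnd x D i p := rfl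
@[simp] lemma csnd_d (x : R) (D : Cx R) (i : ℤ) (p) : csnd x D (i + 1) ((cone x D).d i p) =
    - D.d (i + 1) (csnd x D i p) := rfl

lemma cone_ker (x : R) (D : Cx R) (i : ℤ) (p : (cone x D).X i) :
    (cone x D).d i p = 0 ↔
    D.d i (cfst x D i p) + x • csnd x D i p = 0 ∧ D.d (i + 1) (csnd x D i p) = 0 := by
  constructor
  · intro h
    have h1 := congrArg (cfst x D (i + 1)) h
    have h2 := congrArg (csnd x D (i + 1)) h
    rw [cfst_d, map_zero] at h1
    rw [csnd_d, map_zero, neg_eq_zero] at h2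
    exact ⟨h1, h2⟩
  · rintro ⟨h1, h2⟩
    apply cext
    · rw [cfst_d, h1, map_zero]
    · rw [csnd_d, h2, neg_zero, map_zero]

/-- iterated cones -/
def K (x : ℕ → R) (D : Cx R) : ℕ → Cx R
  | 0 => D
  | j + 1 => cone (x j) (K x D j)

lemma exists_mu (D : Cx R) (i : ℤ) (I : Ideal R)
    (hk : ∀ r ∈ I, ∀ h : D.H i, r • h = 0) (N : Submodule R (D.X (i + 1 + 1)))
    (hN : ∀ c ∈ N, ∀ r ∈ I, ∃ b, D.d (i + 1) b = r • c) (x : R) (hx : x ∈ I * I) :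
    ∃ μ : N → D.X (i + 1), (∀ c, D.d (i + 1) (μ c) = x • c.1) ∧
      (∀ c c', ∃ p, D.d i p = μ (c + c') - μ c - μ c') ∧
      (∀ (r : R) c, ∃ p, D.d i p = μ (r • c) - r • μ c) ∧
      (∀ c e, D.d (i + 1) e = c.1 → ∃ p, D.d i p = μ c - x • e) := by
  have hk' : ∀ r ∈ I, ∀ b, D.d (i + 1) b = 0 → ∃ p, D.d i p = r • b := by
    intro r hr b hb
    have := hk r hr (D.cls i ⟨b, hb⟩)
    rw [← map_smul, Cx.cls_eq_zero] at this
    exact this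
  induction hx using Submodule.mul_induction_on' with
  | mem_mul_mem y hy z hz =>
    have : ∀ c : N, ∃ b, D.d (i + 1) b = y • c.1 := fun c => hN c.1 c.2 y hy
    choose b hb using this
    refine ⟨fun c => z • b c, ?_, ?_, ?_, ?_⟩
    · intro c; rw [map_smul, hb, smul_smul, mul_comm]
    · intro c c'
      obtain ⟨p, hp⟩ := hk' z hz (b (c + c') - b c - b c') (by simp [hb])
      exact ⟨p, by rw [hp, smul_sub, smul_sub]⟩
    · intro r c
      obtain ⟨p, hp⟩ := hk' z hz (b (r • c) - r • b c) (by
        rw [map_sub, map_smul, hb, hb, smul_comm r y]; exact sub_self _)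
      exact ⟨p, by rw [hp, smul_sub, smul_comm]⟩
    · intro c e he
      obtain ⟨p, hp⟩ := hk' z hz (b c - y • e) (by simp [hb, he])
      exact ⟨p, by rw [hp, smul_sub, smul_smul, mul_comm]⟩
  | add x hx y hy ih1 ih2 =>
    obtain ⟨μ, h1, h2, h3, h4⟩ := ih1
    obtain ⟨ν, k1, k2, k3, k4⟩ := ih2
    refine ⟨fun c => μ c + ν c, ?_, ?_, ?_, ?_⟩
    · intro c; rw [map_add, h1, k1, add_smul]
    · intro c c'
      obtain ⟨p, hp⟩ := h2 c c'
      obtain ⟨q, hq⟩ := k2 c c'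
      exact ⟨p + q, by rw [map_add, hp, hq]; beta_reduce; abel⟩
    · intro r c
      obtain ⟨p, hp⟩ := h3 r c
      obtain ⟨q, hq⟩ := k3 r c
      exact ⟨p + q, by rw [map_add, hp, hq]; beta_reduce; rw [smul_add]; abel⟩
    · intro c e he
      obtain ⟨p, hp⟩ := h4 c e he
      obtain ⟨q, hq⟩ := k4 c e he
      exact ⟨p + q, by rw [map_add, hp, hq]; beta_reduce; rw [add_smul]; abel⟩


/-- the map from the cohomology of `D` to that of the cone -/
lemma exists_iota (x : R) (D : Cx R) (i : ℤ) : ∃ ι : D.H i →ₗ[R] (cone x D).H i,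
    (∀ z w, cfst x D _ w.1 = z.1 → csnd x D _ w.1 = 0 → ι (D.cls i z) = (cone x D).cls i w) ∧
    (∀ h, ι h = 0 ↔ ∃ k, h = x • k) := by
  let ρ : LinearMap.ker (D.d (i + 1)) →ₗ[R] LinearMap.ker ((cone x D).d (i + 1)) :=
    { toFun := fun z => ⟨cmk x D _ z.1 0, by
        rw [LinearMap.mem_ker, cone_ker, cfst_mk, csnd_mk, LinearMap.mem_ker.1 z.2]
        simp⟩
      map_add' := fun z w => Subtype.ext (cext _ _ _ (by simp) (by simp))
      map_smul' := fun z w => Subtype.ext (cext _ _ _ (by simp) (by simp)) }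
  have hρ : ∀ z, (ρ z).1 = cmk x D _ z.1 0 := fun z => rfl
  have key : ∀ z, (cone x D).cls i (ρ z) = 0 ↔ ∃ k, D.cls i z = x • k := by
    intro z
    rw [Cx.cls_eq_zero]
    constructor
    · rintro ⟨p, h⟩
      have h1 := congrArg (cfst x D (i + 1)) h
      have h2 := congrArg (csnd x D (i + 1)) h
      rw [hρ, cfst_d, cfst_mk] at h1
      rw [hρ, csnd_d, csnd_mk, neg_eq_zero] at h2
      refine ⟨D.cls i ⟨_, h2⟩, ?_⟩
      rw [← map_smul, ← sub_eq_zero, ← map_sub, Cx.cls_eq_zero]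
      exact ⟨cfst x D _ p, by simp [← h1]⟩
    · rintro ⟨k, h⟩
      obtain ⟨q, rfl⟩ := D.cls_surj i k
      rw [← map_smul, ← sub_eq_zero, ← map_sub, Cx.cls_eq_zero] at h
      obtain ⟨p, hp⟩ := h
      refine ⟨cmk x D _ p q.1, ?_⟩
      apply cext
      · rw [hρ]; simp [hp]
      · rw [hρ]; simp
  obtain ⟨ι, hι⟩ := factor (D.cls i) (D.cls_surj i) ((cone x D).cls i ∘ₗ ρ) (by
    intro g hg
    rw [LinearMap.comp_apply, key]
    exact ⟨0, by simp [hg]⟩)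
  refine ⟨ι, ?_, ?_⟩
  · intro z w hw hw'
    rw [hι, LinearMap.comp_apply]
    congr 1
    apply Subtype.ext
    apply cext
    · rw [hw, hρ, cfst_mk]
    · rw [hw', hρ, csnd_mk]
  · intro h
    obtain ⟨z, rfl⟩ := D.cls_surj i h
    rw [hι, LinearMap.comp_apply, key]

lemma exists_pi (x : R) (D : Cx R) (i : ℤ) (ι : D.H i →ₗ[R] (cone x D).H i)
    (hι : ∀ z w, cfst x D _ w.1 = z.1 → csnd x D _ w.1 = 0 →
      ι (D.cls i z) = (cone x D).cls i w) : ∃ π : (cone x D).H i →ₗ[R] D.H (i + 1),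
    (∀ w z, csnd x D _ w.1 = z.1 → π ((cone x D).cls i w) = D.cls (i + 1) z) ∧
    (∀ h, π h = 0 ↔ ∃ a, ι a = h) ∧ (∀ h, x • π h = 0) := by
  let ρ : LinearMap.ker ((cone x D).d (i + 1)) →ₗ[R] LinearMap.ker (D.d (i + 1 + 1)) :=
    LinearMap.codRestrict _ (csnd x D _ ∘ₗ (Submodule.subtype _)) (by
      rintro ⟨p, h⟩
      exact ((cone_ker x D _ p).1 h).2)
  have hρ : ∀ z, (ρ z).1 = csnd x D _ z.1 := fun z => rfl
  obtain ⟨π, hπ⟩ := factor ((cone x D).cls i) ((cone x D).cls_surj i) (D.cls (i + 1) ∘ₗ ρ) (by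
    intro g hg
    rw [Cx.cls_eq_zero] at hg
    obtain ⟨p, hp⟩ := hg
    rw [LinearMap.comp_apply, Cx.cls_eq_zero, hρ, ← hp]
    exact ⟨- csnd x D _ p, by simp⟩)
  refine ⟨π, ?_, ?_, ?_⟩
  · intro w z h
    rw [hπ, LinearMap.comp_apply]
    congr 1
    exact Subtype.ext h
  · intro h
    obtain ⟨z, rfl⟩ := (cone x D).cls_surj i h
    rw [hπ, LinearMap.comp_apply, Cx.cls_eq_zero, hρ]
    have hz := (cone_ker x D _ _).1 (LinearMap.mem_ker.1 z.2)
    constructor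
    · rintro ⟨y, hy⟩
      refine ⟨D.cls i ⟨cfst x D _ z.1 + x • y, ?_⟩, ?_⟩
      · rw [LinearMap.mem_ker, map_add, map_smul, hy]
        exact hz.1
      · rw [hι _ (z + ⟨_, (cone x D).dd i (cmk x D _ 0 y)⟩)]
        · rw [← sub_eq_zero, ← map_sub, Cx.cls_eq_zero]
          exact ⟨cmk x D _ 0 y, by simp⟩
        · simp
        · simp [hy]
    · rintro ⟨a, ha⟩
      obtain ⟨b, rfl⟩ := D.cls_surj i a
      rw [hι b ⟨cmk x D _ b.1 0, by
        rw [LinearMap.mem_ker, cone_ker, cfst_mk, csnd_mk, LinearMap.mem_ker.1 b.2]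
        simp⟩ (by simp) (by simp), ← sub_eq_zero, ← map_sub, Cx.cls_eq_zero] at ha
      obtain ⟨y, hy⟩ := ha
      have h2 := congrArg (csnd x D (i + 1)) hy
      refine ⟨csnd x D _ y, ?_⟩
      simpa using h2
  · intro h
    obtain ⟨z, rfl⟩ := (cone x D).cls_surj i h
    have hz := (cone_ker x D _ _).1 (LinearMap.mem_ker.1 z.2)
    rw [hπ, LinearMap.comp_apply, ← map_smul, Cx.cls_eq_zero]
    refine ⟨- cfst x D _ z.1, ?_⟩
    rw [map_neg, Submodule.coe_smul, hρ, neg_eq_iff_add_eq_zero]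
    exact hz.1

lemma cone_split (x : R) (D : Cx R) (i : ℤ) (I : Ideal R)
    (hk : ∀ r ∈ I, ∀ h : D.H i, r • h = 0) (hx : x ∈ I * I) :
    ∃ (ι : D.H i →ₗ[R] (cone x D).H i) (π : (cone x D).H i →ₗ[R] D.H (i + 1))
      (N : Submodule R (D.H (i + 1))) (s : N →ₗ[R] (cone x D).H i),
      Function.Injective ι ∧ (∀ h, π h = 0 ↔ ∃ a, ι a = h) ∧ (∀ n, π (s n) = n) ∧
      (∀ h : D.H (i + 1), (∀ r ∈ I, r • h = 0) → h ∈ N) := by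
  obtain ⟨ι, hι, hι0⟩ := exists_iota x D i
  obtain ⟨π, hπ, hπ0, -⟩ := exists_pi x D i ι hι
  let N : Submodule R (D.H (i + 1)) :=
    { carrier := {h | ∀ r ∈ I, r • h = 0}
      add_mem' := fun {a b} ha hb r hr => by rw [smul_add, ha r hr, hb r hr, add_zero]
      zero_mem' := fun r _ => smul_zero r
      smul_mem' := fun c a ha r hr => by rw [smul_comm, ha r hr, smul_zero] }
  let N₁ : Submodule R (LinearMap.ker (D.d (i + 1 + 1))) := N.comap (D.cls (i + 1))
  let N' : Submodule R (D.X (i + 1 + 1)) := N₁.map (Submodule.subtype _)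
  have hN' : ∀ c : N', ∃ h : D.d (i + 1 + 1) c.1 = 0, D.cls (i + 1) ⟨c.1, h⟩ ∈ N := by
    rintro ⟨c, ⟨w, hw, rfl⟩⟩
    exact ⟨LinearMap.mem_ker.1 w.2, hw⟩
  obtain ⟨μ, h1, h2, h3, h4⟩ := exists_mu D i I hk N' (by
    intro c hc r hr
    obtain ⟨h, hh⟩ := hN' ⟨c, hc⟩
    have := hh r hr
    rw [← map_smul, Cx.cls_eq_zero] at this
    exact this) x hx
  let f : N' →ₗ[R] N :=
    { toFun := fun c => ⟨D.cls (i + 1) ⟨c.1, (hN' c).1⟩, (hN' c).2⟩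
      map_add' := fun c c' => Subtype.ext
        ((D.cls (i + 1)).map_add ⟨c.1, (hN' c).1⟩ ⟨c'.1, (hN' c').1⟩)
      map_smul' := fun r c => Subtype.ext
        ((D.cls (i + 1)).map_smul r ⟨c.1, (hN' c).1⟩) }
  have hf : ∀ c, (f c).1 = D.cls (i + 1) ⟨c.1, (hN' c).1⟩ := fun c => rfl
  have fsurj : Function.Surjective f := by
    rintro ⟨n, hn⟩
    obtain ⟨z, rfl⟩ := D.cls_surj _ n
    exact ⟨⟨z.1, ⟨z, hn, rfl⟩⟩, rfl⟩
  have hc0 : ∀ c : N', cmk x D (i + 1) (-μ c) c.1 ∈ LinearMap.ker ((cone x D).d (i + 1)) := by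
    intro c
    rw [LinearMap.mem_ker, cone_ker, cfst_mk, csnd_mk, map_neg, h1]
    exact ⟨by simp, (hN' c).1⟩
  let g : N' →ₗ[R] (cone x D).H i :=
    { toFun := fun c => (cone x D).cls i ⟨_, hc0 c⟩
      map_add' := fun c c' => by
        obtain ⟨p, hp⟩ := h2 c c'
        rw [← sub_eq_zero, ← map_add, ← map_sub, Cx.cls_eq_zero]
        refine ⟨cmk x D _ (-p) 0, cext _ _ _ ?_ ?_⟩
        · simp [hp]; abel
        · simp
      map_smul' := fun r c => by
        obtain ⟨p, hp⟩ := h3 r c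
        rw [RingHom.id_apply, ← sub_eq_zero, ← map_smul, ← map_sub, Cx.cls_eq_zero]
        refine ⟨cmk x D _ (-p) 0, cext _ _ _ ?_ ?_⟩
        · simp [hp]; abel
        · simp }
  have hg : ∀ c, g c = (cone x D).cls i ⟨_, hc0 c⟩ := fun c => rfl
  obtain ⟨s, hs⟩ := factor f fsurj g (by
    intro c hc
    have hc' := congrArg Subtype.val hc
    rw [hf, Submodule.coe_zero, Cx.cls_eq_zero] at hc'
    obtain ⟨e, he⟩ := hc'
    obtain ⟨p, hp⟩ := h4 c e he
    rw [hg, Cx.cls_eq_zero]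
    refine ⟨-cmk x D _ p e, cext _ _ _ ?_ ?_⟩
    · simp [hp]
    · simp [he])
  refine ⟨ι, π, N, s, ?_, hπ0, ?_, fun h hh => hh⟩
  · rw [injective_iff_map_eq_zero]
    intro a ha
    obtain ⟨k, rfl⟩ := (hι0 a).1 ha
    exact hk x (Ideal.mul_le_right hx) k
  · intro n
    obtain ⟨c, rfl⟩ := fsurj n
    rw [hs, hg, hf]
    exact hπ _ _ rfl

lemma cone_kills (x : R) (D : Cx R) (i : ℤ) (I : Ideal R)
    (hk : ∀ r ∈ I, ∀ h : D.H i, r • h = 0) (hk' : ∀ r ∈ I, ∀ h : D.H (i + 1), r • h = 0)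
    (hx : x ∈ I * I) : ∀ r ∈ I, ∀ h : (cone x D).H i, r • h = 0 := by
  obtain ⟨ι, π, N, s, h1, h2, h3, h4⟩ := cone_split x D i I hk hx
  intro r hr h
  obtain ⟨a, ha⟩ := (h2 (h - s ⟨π h, h4 _ fun r hr => hk' r hr _⟩)).1 (by
    rw [map_sub, h3]; simp)
  rw [eq_sub_iff_add_eq] at ha
  rw [← ha, smul_add, ← map_smul, ← map_smul, hk r hr]
  have : r • (⟨π h, h4 _ fun r hr => hk' r hr _⟩ : N) = 0 := Subtype.ext (hk' r hr _)
  rw [this]; simp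

lemma cone_hom (x : R) (D : Cx R) (i : ℤ) (I : Ideal R)
    (hk : ∀ r ∈ I, ∀ h : D.H i, r • h = 0) (hx : x ∈ I * I)
    (W : Type) [AddCommGroup W] [Module R W] (hW : ∀ r ∈ I, ∀ w : W, r • w = 0) :
    Nonempty ((W →ₗ[R] (cone x D).H i) ≃ₗ[R] (W →ₗ[R] D.H i) × (W →ₗ[R] D.H (i + 1))) := by
  obtain ⟨ι, π, N, s, h1, h2, h3, h4⟩ := cone_split x D i I hk hx
  exact hom_split ι h1 π h2 N s h3 (fun v w => h4 _ fun r hr => by rw [← map_smul, hW r hr, map_zero])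

lemma K_kills (x : ℕ → R) (D : Cx R) (I : Ideal R) (t : ℕ)
    (hk : ∀ i : ℤ, -1 ≤ i → i + 1 < t → ∀ r ∈ I, ∀ h : D.H i, r • h = 0)
    (hx : ∀ j < t, x j ∈ I * I) (j : ℕ) :
    ∀ i : ℤ, -1 ≤ i → i + 1 + j < t → ∀ r ∈ I, ∀ h : (K x D j).H i, r • h = 0 := by
  induction j with
  | zero => intro i h1 h2; exact hk i h1 (by simpa using h2)
  | succ j ih =>
    intro i h1 h2
    push_cast at h2
    exact cone_kills (x j) (K x D j) i I (ih i h1 (by lia)) (ih (i + 1) (by lia) (by lia))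
      (hx j (by lia))

/-- Recursive Pascal-type product. -/
lemma pascal (N : ℤ → Type) [∀ i, AddCommGroup (N i)] [∀ i, Module R (N i)] (j : ℕ) (i : ℤ) :
    Nonempty (((Π l : ℕ, Fin (j.choose l) → N (i + l)) ×
      (Π l : ℕ, Fin (j.choose l) → N (i + 1 + l))) ≃ₗ[R]
      (Π l : ℕ, Fin ((j + 1).choose l) → N (i + l))) := by
  let c : ∀ {a b : ℤ}, a = b → (N a ≃ₗ[R] N b) := fun h => h ▸ LinearEquiv.refl R _
  let e0 : ∀ (l : ℕ) (k : ℤ), (Fin ((j + 1).choose (l + 1)) → N k) ≃ₗ[R]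
      (Fin (j.choose l) → N k) × (Fin (j.choose (l + 1)) → N k) := fun l k =>
    (LinearEquiv.funCongrLeft R (N k) (finSumFinEquiv.trans (finCongr (by
      rw [Nat.choose_succ_succ])))).trans (LinearEquiv.sumArrowLequivProdArrow _ _ R _)
  have split : ∀ (m : ℕ) , Nonempty ((Π l : ℕ, Fin (m.choose l) → N (i + l)) ≃ₗ[R]
      (N i) × (Π l : ℕ, Fin (m.choose (l + 1)) → N (i + (l + 1 : ℕ)))) := by
    intro m
    refine ⟨LinearEquiv.ofBijective (LinearMap.prod
      ((c (by simp)).toLinearMap ∘ₗ (LinearMap.proj (R := R)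
          (φ := fun _ : Fin (m.choose 0) => N (i + (0 : ℕ))) ⟨0, by simp⟩) ∘ₗ LinearMap.proj 0)
      (LinearMap.pi fun l => LinearMap.proj (l + 1))) ⟨?_, ?_⟩⟩
    · rw [injective_iff_map_eq_zero]
      intro f hf
      have hf1 := congrArg Prod.fst hf
      have hf2 := congrArg Prod.snd hf
      funext l
      cases l with
      | zero =>
        funext k
        have : k = ⟨0, by simp⟩ := Fin.ext (by have := k.2; simp at this; lia)
        subst this
        simpa using hf1
      | succ l => exact congrFun hf2 l
    · rintro ⟨a, f⟩
      refine ⟨fun l => match l with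
        | 0 => fun _ => (c (by simp)).symm a
        | l + 1 => f l, ?_⟩
      apply Prod.ext
      · simp
      · rfl
  obtain ⟨s1⟩ := split j
  obtain ⟨s2⟩ := split (j + 1)
  let e1 : (Π l : ℕ, Fin ((j + 1).choose (l + 1)) → N (i + (l + 1 : ℕ))) ≃ₗ[R]
      (Π l : ℕ, Fin (j.choose l) → N (i + 1 + l)) ×
      (Π l : ℕ, Fin (j.choose (l + 1)) → N (i + (l + 1 : ℕ))) :=
    (LinearEquiv.piCongrRight fun l => (e0 l _).trans
      (LinearEquiv.prodCongr (LinearEquiv.piCongrRight fun _ => c (by push_cast; ring))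
        (LinearEquiv.refl R _))).trans
    { toFun := fun f => (fun l => (f l).1, fun l => (f l).2)
      invFun := fun p l => (p.1 l, p.2 l)
      map_add' := fun _ _ => rfl
      map_smul' := fun _ _ => rfl
      left_inv := fun _ => rfl
      right_inv := fun _ => rfl }
  refine ⟨?_⟩
  exact (LinearEquiv.prodCongr s1 (LinearEquiv.refl R _)).trans
    ((LinearEquiv.prodAssoc R _ _ _).trans
    ((LinearEquiv.prodCongr (LinearEquiv.refl R _)
      ((LinearEquiv.prodComm R _ _).trans e1.symm)).trans s2.symm))

lemma K_hom (x : ℕ → R) (D : Cx R) (I : Ideal R) (t : ℕ)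
    (hk : ∀ i : ℤ, -1 ≤ i → i + 1 < t → ∀ r ∈ I, ∀ h : D.H i, r • h = 0)
    (hx : ∀ j < t, x j ∈ I * I)
    (W : Type) [AddCommGroup W] [Module R W] (hW : ∀ r ∈ I, ∀ w : W, r • w = 0) (j : ℕ) :
    ∀ i : ℤ, -1 ≤ i → i + 1 + j ≤ t →
    Nonempty ((W →ₗ[R] (K x D j).H i) ≃ₗ[R]
      Π l : ℕ, Fin (j.choose l) → (W →ₗ[R] D.H (i + l))) := by
  induction j with
  | zero =>
    intro i h1 h2
    let c : ∀ {a b : ℤ}, a = b → ((W →ₗ[R] D.H a) ≃ₗ[R] (W →ₗ[R] D.H b)) :=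
      fun h => h ▸ LinearEquiv.refl R _
    refine ⟨(c (by simp : i = i + (0 : ℕ))).trans (LinearEquiv.ofBijective
      (LinearMap.pi fun l => LinearMap.pi fun k : Fin (Nat.choose 0 l) =>
        match l, k with
        | 0, _ => LinearMap.id
        | l + 1, k => 0) ⟨?_, ?_⟩)⟩
    · intro f g h
      exact congrFun (congrFun h 0) ⟨0, by simp⟩
    · intro f
      refine ⟨f 0 ⟨0, by simp⟩, ?_⟩
      funext l k
      match l, k with
      | 0, k =>
        have : k = ⟨0, by simp⟩ := Fin.ext (by have := k.2; simp at this; lia)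
        subst this; rfl
      | l + 1, k => exact absurd k.2 (by simp)
  | succ j ih =>
    intro i h1 h2
    push_cast at h2
    obtain ⟨e⟩ := cone_hom (x j) (K x D j) i I (K_kills x D I t hk hx j i h1 (by lia))
      (hx j (by lia)) W hW
    obtain ⟨e1⟩ := ih i h1 (by lia)
    obtain ⟨e2⟩ := ih (i + 1) (by lia) (by lia)
    obtain ⟨p⟩ := pascal (R := R) (fun i => W →ₗ[R] D.H i) j i
    exact ⟨e.trans ((LinearEquiv.prodCongr e1 e2).trans p)⟩

end
end FRS


namespace FRS
section
variable {R : Type} [CommRing R]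

/-- `v` is annihilated by some power of each element of `𝔞` -/
def IsTor (𝔞 : Ideal R) {V : Type} [AddCommGroup V] [Module R V] (v : V) : Prop :=
  ∀ r ∈ 𝔞, ∃ n : ℕ, r ^ n • v = 0

/-- the torsion submodule -/
def Gam (𝔞 : Ideal R) (V : Type) [AddCommGroup V] [Module R V] : Submodule R V where
  carrier := {v | IsTor 𝔞 v}
  zero_mem' := fun r _ => ⟨0, by simp⟩
  add_mem' := by
    intro a b ha hb r hr
    obtain ⟨n, hn⟩ := ha r hr
    obtain ⟨m, hm⟩ := hb r hr
    refine ⟨n + m, ?_⟩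
    rw [smul_add]
    nth_rewrite 1 [add_comm n m]
    rw [pow_add, pow_add, mul_smul, mul_smul, hn, hm]
    simp
  smul_mem' := by
    intro c v hv r hr
    obtain ⟨n, hn⟩ := hv r hr
    exact ⟨n, by rw [smul_comm, hn, smul_zero]⟩

lemma mem_Gam (𝔞 : Ideal R) {V : Type} [AddCommGroup V] [Module R V] (v : V) :
    v ∈ Gam 𝔞 V ↔ IsTor 𝔞 v := Iff.rfl

lemma IsTor.map {𝔞 : Ideal R} {V W : Type} [AddCommGroup V] [Module R V] [AddCommGroup W]
    [Module R W] (f : V →ₗ[R] W) {v : V} (h : IsTor 𝔞 v) : IsTor 𝔞 (f v) := by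
  intro r hr
  obtain ⟨n, hn⟩ := h r hr
  exact ⟨n, by rw [← map_smul, hn, map_zero]⟩

lemma IsTor.of_inj {𝔞 : Ideal R} {V W : Type} [AddCommGroup V] [Module R V] [AddCommGroup W]
    [Module R W] (f : V →ₗ[R] W) (hf : Function.Injective f) {v : V} (h : IsTor 𝔞 (f v)) :
    IsTor 𝔞 v := by
  intro r hr
  obtain ⟨n, hn⟩ := h r hr
  exact ⟨n, hf (by rw [map_smul, hn, map_zero])⟩

lemma IsTor.of_pow {𝔞 : Ideal R} {V : Type} [AddCommGroup V] [Module R V] {v : V} (n : ℕ)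
    (h : ∀ r ∈ 𝔞 ^ n, r • v = 0) : IsTor 𝔞 v :=
  fun _ hr => ⟨n, h _ (Ideal.pow_mem_pow hr n)⟩

lemma tor_pow [IsNoetherianRing R] (𝔞 : Ideal R) {V : Type} [AddCommGroup V] [Module R V]
    (N : Submodule R V) (hN : N.FG) (h : ∀ v ∈ N, IsTor 𝔞 v) :
    ∃ m : ℕ, ∀ r ∈ 𝔞 ^ m, ∀ v ∈ N, r • v = 0 := by
  have : 𝔞 ≤ (N.annihilator).radical := by
    intro r hr
    obtain ⟨S, hS⟩ := hN
    have hS' : ∀ s : S, ∃ n : ℕ, r ^ n • s.1 = 0 := fun s =>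
      h s.1 (hS ▸ Submodule.subset_span s.2) r hr
    choose n hn using hS'
    refine ⟨∑ s, n s, ?_⟩
    rw [Submodule.mem_annihilator]
    intro v hv
    rw [← hS] at hv
    induction hv using Submodule.span_induction with
    | mem x hx =>
      obtain ⟨c, hc⟩ := pow_dvd_pow r (Finset.single_le_sum (f := n) (fun _ _ => Nat.zero_le _)
        (Finset.mem_univ ⟨x, hx⟩))
      have := hn ⟨x, hx⟩
      rw [hc, mul_comm, mul_smul, this, smul_zero]
    | zero => simp
    | add x y _ _ hx hy => rw [smul_add, hx, hy, add_zero]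
    | smul a x _ hx => rw [smul_comm, hx, smul_zero]
  obtain ⟨m, hm⟩ := Ideal.exists_pow_le_of_le_radical_of_fg this (IsNoetherian.noetherian 𝔞)
  exact ⟨m, fun r hr v hv => Submodule.mem_annihilator.1 (hm hr) v hv⟩

lemma gam_injective [IsNoetherianRing R] (𝔞 : Ideal R) (V : Type) [AddCommGroup V] [Module R V]
    (hV : Module.Injective R V) : Module.Injective R (Gam 𝔞 V) := by
  apply Module.Baer.injective
  intro b g
  obtain ⟨m, hm⟩ := tor_pow 𝔞 (LinearMap.range ((Gam 𝔞 V).subtype ∘ₗ g))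
    (Submodule.FG.of_finite) (by
      rintro _ ⟨y, rfl⟩
      exact (g y).2)
  obtain ⟨k, hk⟩ := Ideal.exists_pow_inf_eq_pow_smul 𝔞 (N := b)
  have key : ∀ y : b, y.1 ∈ 𝔞 ^ (k + m) → g y = 0 := by
    intro y hy
    have h1 : y.1 ∈ 𝔞 ^ (k + m) • (⊤ : Submodule R R) ⊓ b :=
      ⟨by simpa using hy, y.2⟩
    rw [hk (k + m) (by omega)] at h1
    have h2 : 𝔞 ^ (k + m - k) • (𝔞 ^ k • (⊤ : Submodule R R) ⊓ b) ≤
        Submodule.map b.subtype (LinearMap.ker g) := by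
      rw [Submodule.smul_le]
      intro r hr n hn
      refine ⟨r • ⟨n, hn.2⟩, ?_, rfl⟩
      rw [Nat.add_sub_cancel_left] at hr
      have := hm r hr _ ⟨⟨n, hn.2⟩, rfl⟩
      show g _ = 0
      rw [map_smul]
      exact Subtype.ext this
    obtain ⟨z, hz, hzy⟩ := h2 h1
    have : z = y := Subtype.ext hzy
    rw [← this]
    exact hz
  let φ : b →ₗ[R] (R ⧸ 𝔞 ^ (k + m)) := (Submodule.mkQ (𝔞 ^ (k + m))) ∘ₗ b.subtype
  obtain ⟨κ, hκ⟩ := factor φ.rangeRestrict φ.surjective_rangeRestrict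
    ((Gam 𝔞 V).subtype ∘ₗ g) (by
      intro y hy
      have h0 : φ y = 0 := congrArg Subtype.val hy
      have : y.1 ∈ 𝔞 ^ (k + m) := (Submodule.Quotient.mk_eq_zero _).1 h0
      rw [LinearMap.comp_apply, key y this, map_zero])
  obtain ⟨h, hh⟩ := hV.out (LinearMap.range φ).subtype Subtype.val_injective κ
  refine ⟨(h ∘ₗ Submodule.mkQ (𝔞 ^ (k + m))).codRestrict _ ?_, ?_⟩
  · intro c
    refine IsTor.of_pow (k + m) fun r hr => ?_
    rw [← map_smul, LinearMap.comp_apply]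
    have : Submodule.mkQ (𝔞 ^ (k + m)) (r • c) = 0 :=
      (Submodule.Quotient.mk_eq_zero _).2 (Ideal.mul_mem_right _ _ hr)
    rw [this, map_zero]
  · intro y hy
    apply Subtype.ext
    have := hh (φ.rangeRestrict ⟨y, hy⟩)
    rw [hκ] at this
    exact this

lemma inj_retract {Q W : Type} [AddCommGroup Q] [Module R Q] [AddCommGroup W] [Module R W]
    (hQ : Module.Injective R Q) (s : W →ₗ[R] Q) (π : Q →ₗ[R] W) (h : ∀ w, π (s w) = w) :
    Module.Injective R W := by
  constructor
  intro X Y _ _ _ _ f hf g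
  obtain ⟨u, hu⟩ := hQ.out f hf (s ∘ₗ g)
  exact ⟨π ∘ₗ u, fun x => by rw [LinearMap.comp_apply, hu, LinearMap.comp_apply, h]⟩

lemma inj_section {V Q W : Type} [AddCommGroup V] [Module R V] [AddCommGroup Q] [Module R Q]
    [AddCommGroup W] [Module R W] (hV : Module.Injective R V)
    (f : V →ₗ[R] Q) (hf : Function.Injective f) (π : Q →ₗ[R] W) (hπ : Function.Surjective π)
    (hex : ∀ q, π q = 0 ↔ ∃ v, f v = q) : ∃ s : W →ₗ[R] Q, ∀ w, π (s w) = w := by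
  obtain ⟨ρ, hρ⟩ := hV.out f hf LinearMap.id
  obtain ⟨s, hs⟩ := factor π hπ (LinearMap.id - f ∘ₗ ρ) (by
    intro q hq
    obtain ⟨v, rfl⟩ := (hex q).1 hq
    simp [hρ])
  refine ⟨s, fun w => ?_⟩
  obtain ⟨q, rfl⟩ := hπ w
  rw [hs]
  have : π (f (ρ q)) = 0 := (hex _).2 ⟨_, rfl⟩
  simp [this]

/-- torsion free -/
def TF (𝔞 : Ideal R) (V : Type) [AddCommGroup V] [Module R V] : Prop :=
  ∀ v : V, IsTor 𝔞 v → v = 0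

lemma inj_quot [IsNoetherianRing R] (𝔞 : Ideal R) (V : Type) [AddCommGroup V] [Module R V]
    (hV : Module.Injective R V) : Module.Injective R (V ⧸ Gam 𝔞 V) ∧ TF 𝔞 (V ⧸ Gam 𝔞 V) := by
  obtain ⟨s, hs⟩ := inj_section (gam_injective 𝔞 V hV) (Gam 𝔞 V).subtype Subtype.val_injective
    (Gam 𝔞 V).mkQ (Submodule.mkQ_surjective _) (by
      intro q
      rw [Submodule.mkQ_apply, Submodule.Quotient.mk_eq_zero]
      exact ⟨fun h => ⟨⟨q, h⟩, rfl⟩, fun ⟨v, hv⟩ => hv ▸ v.2⟩)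
  refine ⟨inj_retract hV s _ hs, fun v hv => ?_⟩
  rw [← hs v, Submodule.mkQ_apply, Submodule.Quotient.mk_eq_zero]
  exact hv.map s

/-- torsion plus boundaries -/
def L (𝔞 : Ideal R) (D : Cx R) (i : ℤ) : Submodule R (D.X (i + 1)) :=
  Gam 𝔞 (D.X (i + 1)) ⊔ LinearMap.range (D.d i)

lemma L_inj (𝔞 : Ideal R) (D : Cx R) (i : ℤ) (hH : ∀ h : D.H i, IsTor 𝔞 h)
    (hTF : TF 𝔞 (D.X (i + 1) ⧸ L 𝔞 D i)) (w : D.X (i + 1)) (hw : IsTor 𝔞 (D.d (i + 1) w)) :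
    w ∈ L 𝔞 D i := by
  rw [← Submodule.Quotient.mk_eq_zero]
  apply hTF
  intro r hr
  obtain ⟨n, hn⟩ := hw r hr
  rw [← map_smul] at hn
  obtain ⟨m, hm⟩ := hH (D.cls i ⟨r ^ n • w, hn⟩) r hr
  rw [← map_smul, D.cls_eq_zero] at hm
  obtain ⟨y, hy⟩ := hm
  refine ⟨m + n, ?_⟩
  rw [← Submodule.Quotient.mk_smul, Submodule.Quotient.mk_eq_zero]
  refine Submodule.mem_sup_right ⟨y, ?_⟩
  rw [hy, pow_add, mul_smul]
  rfl

lemma L_step [IsNoetherianRing R] (𝔞 : Ideal R) (D : Cx R) (i : ℤ)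
    (hH : ∀ h : D.H i, IsTor 𝔞 h) (hI : Module.Injective R (D.X (i + 1 + 1)))
    (hTF : TF 𝔞 (D.X (i + 1) ⧸ L 𝔞 D i)) (hinj : Module.Injective R (D.X (i + 1) ⧸ L 𝔞 D i)) :
    TF 𝔞 (D.X (i + 1 + 1) ⧸ L 𝔞 D (i + 1)) ∧
    Module.Injective R (D.X (i + 1 + 1) ⧸ L 𝔞 D (i + 1)) := by
  obtain ⟨hQ, hQTF⟩ := inj_quot 𝔞 _ hI
  have hle : L 𝔞 D i ≤ LinearMap.ker ((Gam 𝔞 (D.X (i + 1 + 1))).mkQ ∘ₗ D.d (i + 1)) := by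
    rw [L, sup_le_iff]
    constructor
    · intro v hv
      show Submodule.Quotient.mk _ = _
      rw [Submodule.Quotient.mk_eq_zero]
      exact IsTor.map _ hv
    · rintro _ ⟨y, rfl⟩
      rw [LinearMap.mem_ker, LinearMap.comp_apply, D.dd, map_zero]
  have hle2 : Gam 𝔞 (D.X (i + 1 + 1)) ≤ L 𝔞 D (i + 1) := le_sup_left
  obtain ⟨s, hs⟩ := inj_section hinj (Submodule.liftQ _ _ hle) (by
      rw [injective_iff_map_eq_zero]
      intro v
      obtain ⟨w, rfl⟩ := Submodule.Quotient.mk_surjective _ v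
      intro hv
      rw [Submodule.liftQ_apply, LinearMap.comp_apply, Submodule.mkQ_apply,
        Submodule.Quotient.mk_eq_zero] at hv
      rw [Submodule.Quotient.mk_eq_zero]
      exact L_inj 𝔞 D i hH hTF w hv) (Submodule.factor hle2) (Submodule.factor_surjective hle2) (by
      intro q
      obtain ⟨w, rfl⟩ := Submodule.Quotient.mk_surjective _ q
      have hfm : Submodule.factor hle2 (Submodule.Quotient.mk w) = Submodule.Quotient.mk w := rfl
      rw [hfm, Submodule.Quotient.mk_eq_zero]
      constructor
      · intro hw
        obtain ⟨g, hg, _, ⟨y, rfl⟩, hgy⟩ := Submodule.mem_sup.1 hw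
        refine ⟨Submodule.Quotient.mk y, ?_⟩
        rw [Submodule.liftQ_apply, LinearMap.comp_apply, Submodule.mkQ_apply,
          Submodule.Quotient.eq, ← hgy]
        simpa using hg
      · rintro ⟨v, hv⟩
        obtain ⟨y, rfl⟩ := Submodule.Quotient.mk_surjective _ v
        rw [Submodule.liftQ_apply, LinearMap.comp_apply, Submodule.mkQ_apply,
          Submodule.Quotient.eq] at hv
        have : w = -(D.d (i + 1) y - w) + D.d (i + 1) y := by abel
        rw [this]
        exact Submodule.add_mem_sup (neg_mem hv) ⟨y, rfl⟩)
  refine ⟨fun w hw => ?_, inj_retract hQ s _ hs⟩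
  rw [← hs w, hQTF _ (hw.map s), map_zero]

lemma L_all [IsNoetherianRing R] (𝔞 : Ideal R) (D : Cx R) (N : ℕ)
    (h0 : ∀ i < -(N : ℤ), Subsingleton (D.X i)) (hI : ∀ i, Module.Injective R (D.X i))
    (hH : ∀ i < -1, ∀ h : D.H i, IsTor 𝔞 h) (n : ℕ) :
    (-(N : ℤ) - 2 + n ≤ -1) → 
    TF 𝔞 (D.X (-(N : ℤ) - 2 + n + 1) ⧸ L 𝔞 D (-(N : ℤ) - 2 + n)) ∧
    Module.Injective R (D.X (-(N : ℤ) - 2 + n + 1) ⧸ L 𝔞 D (-(N : ℤ) - 2 + n)) := by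
  induction n with
  | zero =>
    intro _
    have := h0 (-(N : ℤ) - 2 + (0 : ℕ) + 1) (by push_cast; omega)
    have hs : Subsingleton (D.X (-(N : ℤ) - 2 + (0 : ℕ) + 1) ⧸ L 𝔞 D (-(N : ℤ) - 2 + (0 : ℕ))) :=
      (Submodule.mkQ_surjective _).subsingleton
    exact ⟨fun v _ => Subsingleton.elim _ _, ⟨fun X Y _ _ _ _ f hf g =>
      ⟨0, fun x => Subsingleton.elim _ _⟩⟩⟩
  | succ n ih =>
    intro hn
    obtain ⟨h1, h2⟩ := ih (by push_cast at hn; omega)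
    have := L_step 𝔞 D (-(N : ℤ) - 2 + n) (hH _ (by push_cast at hn; omega)) (hI _) h1 h2
    have e : -(N : ℤ) - 2 + n + 1 = -(N : ℤ) - 2 + ((n + 1 : ℕ) : ℤ) := by push_cast; ring
    rw [e] at this
    exact this

lemma L_all' [IsNoetherianRing R] (𝔞 : Ideal R) (D : Cx R) (N : ℕ)
    (h0 : ∀ i < -(N : ℤ), Subsingleton (D.X i)) (hI : ∀ i, Module.Injective R (D.X i))
    (hH : ∀ i < -1, ∀ h : D.H i, IsTor 𝔞 h) (i : ℤ) (hi : -(N : ℤ) - 2 ≤ i) (hi' : i ≤ -1) :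
    TF 𝔞 (D.X (i + 1) ⧸ L 𝔞 D i) := by
  obtain ⟨n, rfl⟩ : ∃ n : ℕ, i = -(N : ℤ) - 2 + n := ⟨(i + N + 2).toNat, by omega⟩
  exact (L_all 𝔞 D N h0 hI hH n hi').1

/-- inclusion of the torsion subcomplex -/
structure TMap (𝔞 : Ideal R) (C D : Cx R) where
  f : ∀ i, C.X i →ₗ[R] D.X i
  comm : ∀ i v, D.d i (f i v) = f (i + 1) (C.d i v)
  inj : ∀ i, Function.Injective (f i)
  range : ∀ i y, (∃ v, f i v = y) ↔ IsTor 𝔞 y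

/-- cones of torsion inclusions -/
def TMap.cone {𝔞 : Ideal R} {C D : Cx R} (T : TMap 𝔞 C D) (x : R) :
    TMap 𝔞 (cone x C) (cone x D) where
  f i :=
    { toFun := fun p => cmk x D i (T.f i (cfst x C i p)) (T.f (i + 1) (csnd x C i p))
      map_add' := fun p q => cext x D i (by simp) (by simp)
      map_smul' := fun r q => cext x D i (by simp) (by simp) }
  comm i p := by
    apply cext
    · simp [T.comm]
    · simp [T.comm]
  inj i p q h := by
    apply cext
    · have := congrArg (cfst x D i) h
      exact T.inj _ this
    · have := congrArg (csnd x D i) h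
      exact T.inj _ this
  range i y := by
    constructor
    · rintro ⟨p, rfl⟩ r hr
      obtain ⟨n, hn⟩ := (T.range i _).1 ⟨cfst x C i p, rfl⟩ r hr
      obtain ⟨m, hm⟩ := (T.range (i + 1) _).1 ⟨csnd x C i p, rfl⟩ r hr
      refine ⟨n + m, cext _ _ _ ?_ ?_⟩
      · rw [map_smul, add_comm, pow_add, mul_smul, map_zero]
        show r ^ m • r ^ n • T.f i _ = 0
        rw [hn, smul_zero]
      · rw [map_smul, pow_add, mul_smul, map_zero]
        show r ^ n • r ^ m • T.f (i + 1) _ = 0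
        rw [hm, smul_zero]
    · intro h
      obtain ⟨a, ha⟩ := (T.range i _).2 (h.map (cfst x D i))
      obtain ⟨b, hb⟩ := (T.range (i + 1) _).2 (h.map (csnd x D i))
      exact ⟨cmk x C i a b, cext _ _ _ ha hb⟩

/-- Koszul version -/
def TMap.K {𝔞 : Ideal R} {C D : Cx R} (T : TMap 𝔞 C D) (x : ℕ → R) :
    ∀ j, TMap 𝔞 (K x C j) (K x D j)
  | 0 => T
  | j + 1 => (T.K x j).cone (x j)

lemma TMap.hom_iso [IsNoetherianRing R] {𝔞 : Ideal R} {C D : Cx R} (T : TMap 𝔞 C D) (N : ℕ)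
    (h0 : ∀ i < -(N : ℤ), Subsingleton (D.X i)) (hI : ∀ i, Module.Injective R (D.X i))
    (hH : ∀ i < -1, ∀ h : D.H i, IsTor 𝔞 h) (W : Type) [AddCommGroup W] [Module R W]
    (hW : ∀ w : W, IsTor 𝔞 w) :
    Nonempty ((W →ₗ[R] C.H (-1)) ≃ₗ[R] (W →ₗ[R] D.H (-1))) := by
  let ρ : LinearMap.ker (C.d (-1 + 1)) →ₗ[R] LinearMap.ker (D.d (-1 + 1)) :=
    (T.f (-1 + 1) ∘ₗ Submodule.subtype _).codRestrict _ (by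
      intro c
      have : C.d (-1 + 1) c.1 = 0 := c.2
      rw [LinearMap.mem_ker]
      show D.d (-1 + 1) (T.f (-1 + 1) c.1) = 0
      rw [T.comm, this, map_zero])
  have hρ : ∀ c, (ρ c).1 = T.f (-1 + 1) c.1 := fun c => rfl
  obtain ⟨u, hu⟩ := factor (C.cls (-1)) (C.cls_surj _) (D.cls (-1) ∘ₗ ρ) (by
    intro c hc
    obtain ⟨y, hy⟩ := (C.cls_eq_zero _ _).1 hc
    rw [LinearMap.comp_apply, D.cls_eq_zero]
    exact ⟨T.f (-1) y, by rw [T.comm, hy, hρ]⟩)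
  have hinj : Function.Injective u := by
    rw [injective_iff_map_eq_zero]
    intro h
    obtain ⟨c, rfl⟩ := C.cls_surj _ h
    intro hc
    rw [hu, LinearMap.comp_apply, D.cls_eq_zero] at hc
    obtain ⟨w, hw⟩ := hc
    have key : ∀ (i : ℤ) (hi : i = -1) (w : D.X i) (c : C.X (i + 1)), D.d i w = T.f (i + 1) c →
        ∃ a, C.d i a = c := by
      intro i hi w c hw
      obtain ⟨l, rfl⟩ : ∃ l, i = l + 1 := ⟨i - 1, by ring⟩
      have hl := L_inj 𝔞 D l (hH l (by omega)) (L_all' 𝔞 D N h0 hI hH l (by omega) (by omega)) w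
        (by rw [hw]; exact (T.range _ _).1 ⟨_, rfl⟩)
      obtain ⟨g, hg, _, ⟨y, rfl⟩, hgy⟩ := Submodule.mem_sup.1 hl
      obtain ⟨a, rfl⟩ := (T.range _ _).2 hg
      refine ⟨a, T.inj _ ?_⟩
      rw [← T.comm, ← hw, ← hgy, map_add, D.dd, add_zero]
    rw [C.cls_eq_zero]
    exact key (-1) rfl w _ hw
  have hran : ∀ h : D.H (-1), IsTor 𝔞 h → ∃ c, u c = h := by
    intro h
    obtain ⟨z, rfl⟩ := D.cls_surj _ h
    intro hz
    have hzL : z.1 ∈ L 𝔞 D (-1) := by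
      rw [← Submodule.Quotient.mk_eq_zero]
      apply L_all' 𝔞 D N h0 hI hH (-1) (by omega) (by omega)
      intro r hr
      obtain ⟨n, hn⟩ := hz r hr
      rw [← map_smul, D.cls_eq_zero] at hn
      obtain ⟨y, hy⟩ := hn
      refine ⟨n, ?_⟩
      rw [← Submodule.Quotient.mk_smul, Submodule.Quotient.mk_eq_zero]
      exact Submodule.mem_sup_right ⟨y, hy⟩
    obtain ⟨g, hg, _, ⟨y, rfl⟩, hgy⟩ := Submodule.mem_sup.1 hzL
    obtain ⟨a, rfl⟩ := (T.range _ _).2 hg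
    have ha : C.d (-1 + 1) a = 0 := by
      apply T.inj
      have hz0 : D.d (-1 + 1) z.1 = 0 := z.2
      rw [← hgy, map_add, D.dd, add_zero, T.comm] at hz0
      rw [hz0, map_zero]
    refine ⟨C.cls (-1) ⟨a, ha⟩, ?_⟩
    rw [hu, ← sub_eq_zero, LinearMap.comp_apply, ← map_sub, D.cls_eq_zero]
    refine ⟨-y, ?_⟩
    rw [Submodule.coe_sub, hρ, ← hgy, map_neg]
    abel
  refine ⟨LinearEquiv.ofBijective (LinearMap.llcomp R W _ _ u) ⟨?_, ?_⟩⟩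
  · intro f g hfg
    ext w
    exact hinj (LinearMap.congr_fun hfg w)
  · intro g
    have : ∀ w, ∃ c, u c = g w := fun w => hran _ ((hW w).map g)
    choose c hc using this
    refine ⟨⟨⟨c, ?_⟩, ?_⟩, ?_⟩
    · intro a b
      apply hinj
      rw [map_add, hc, hc, hc, map_add]
    · intro r b
      apply hinj
      simp only [map_smul, RingHom.id_apply, hc]
    · ext w
      exact hc w

lemma filter_tor [IsNoetherianRing R] (𝔞 : Ideal R) (V : Type) [AddCommGroup V] [Module R V]
    (x : R) (h : ∀ p ∈ associatedPrimes R V, ¬ 𝔞 ≤ p → x ∉ p) (v : V) (hv : x • v = 0) :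
    IsTor 𝔞 v := by
  intro r hr
  by_contra! hne
  obtain ⟨n, hn⟩ := monotone_stabilizes_iff_noetherian.2 (inferInstance : IsNoetherian R R)
    ⟨fun n => (⊥ : Submodule R V).colon {r ^ n • v}, by
      apply monotone_nat_of_le_succ
      intro n s hs
      rw [Submodule.mem_colon_singleton, Submodule.mem_bot] at hs ⊢
      rw [pow_succ', mul_smul, smul_comm, hs, smul_zero]⟩
  have hn' : ∀ s : R, s • r ^ (n + 1) • v = 0 → s • r ^ n • v = 0 := by
    intro s hs
    have e := hn (n + 1) (by omega)
    have : s ∈ (⊥ : Submodule R V).colon {r ^ (n + 1) • v} := by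
      rw [Submodule.mem_colon_singleton, Submodule.mem_bot]; exact hs
    have e' : (⊥ : Submodule R V).colon {r ^ n • v} = (⊥ : Submodule R V).colon {r ^ (n + 1) • v} := e
    rw [← e', Submodule.mem_colon_singleton, Submodule.mem_bot] at this
    exact this
  let N := Submodule.span R {r ^ n • v}
  have hNne : (⟨r ^ n • v, Submodule.mem_span_singleton_self _⟩ : N) ≠ 0 := by
    intro h0
    exact hne n (congrArg Subtype.val h0)
  obtain ⟨P, hP, hle⟩ := exists_le_isAssociatedPrime_of_isNoetherianRing R _ hNne
  have hPV : IsAssociatedPrime P V := hP.map_of_injective N.subtype Subtype.val_injective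
  have hxP : x ∈ P := hle (by
    rw [Submodule.mem_colon_singleton, Submodule.mem_bot]
    apply Subtype.ext
    show x • r ^ n • v = 0
    rw [smul_comm, hv, smul_zero])
  refine h P hPV (fun hap => ?_) hxP
  have hrP := hap hr
  obtain ⟨hprime, y, rfl⟩ := isAssociatedPrime_iff.1 hP
  rw [Submodule.mem_colon_singleton, Submodule.mem_bot] at hrP
  obtain ⟨y, hy⟩ := y
  obtain ⟨s, rfl⟩ := Submodule.mem_span_singleton.1 hy
  have h1 : r • s • r ^ n • v = 0 := congrArg Subtype.val hrP
  have h2 := hn' s (by rw [pow_succ', mul_smul, smul_comm]; exact h1)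
  apply hprime.ne_top
  rw [Ideal.eq_top_iff_one, Submodule.mem_colon_singleton, Submodule.mem_bot]
  apply Subtype.ext
  show (1 : R) • s • r ^ n • v = 0
  rw [h2, smul_zero]

lemma cone_injective (x : R) (D : Cx R) (hI : ∀ i, Module.Injective R (D.X i)) (i : ℤ) :
    Module.Injective R ((cone x D).X i) := by
  constructor
  intro X Y _ _ _ _ f hf g
  obtain ⟨u, hu⟩ := (hI i).out f hf (cfst x D i ∘ₗ g)
  obtain ⟨v, hv⟩ := (hI (i + 1)).out f hf (csnd x D i ∘ₗ g)
  refine ⟨⟨⟨fun y => cmk x D i (u y) (v y), ?_⟩, ?_⟩, ?_⟩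
  · intro a b
    exact cext _ _ _ (by simp) (by simp)
  · intro a b
    exact cext _ _ _ (by simp) (by simp)
  · intro a
    exact cext _ _ _ (hu a) (hv a)

/-- the Koszul complex computes the quotient, up to torsion in negative degrees -/
def Good (𝔞 : Ideal R) (M : Type) [AddCommGroup M] [Module R M] (x : ℕ → R) (j : ℕ)
    (E : Cx R) : Prop :=
  (∀ i < -(j : ℤ), Subsingleton (E.X i)) ∧
      (∀ i, Module.Injective R (E.X i)) ∧
      (∀ i < -1, ∀ h : E.H i, IsTor 𝔞 h) ∧
      (∀ i > -1, ∀ h : E.H i, h = 0) ∧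
      ∃ σ : M →ₗ[R] E.H (-1), Function.Surjective σ ∧
        LinearMap.ker σ = Ideal.span (x '' Set.Iio j) • (⊤ : Submodule R M)

lemma Good_cone [IsNoetherianRing R] (𝔞 : Ideal R) (M : Type) [AddCommGroup M] [Module R M]
    (x : ℕ → R) (j : ℕ)
    (hfr : ∀ p ∈ associatedPrimes R
        (M ⧸ (Ideal.span (x '' Set.Iio j) • (⊤ : Submodule R M))), ¬ 𝔞 ≤ p → x j ∉ p)
    (E : Cx R) (G : Good 𝔞 M x j E) : Good 𝔞 M x (j + 1) (cone (x j) E) := by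
  obtain ⟨g0, gI, gT, gZ, σ, hσ, hker⟩ := G
  have hxT : ∀ h : E.H (-1), x j • h = 0 → IsTor 𝔞 h := by
    intro h hh
    let e := (Submodule.quotEquivOfEq _ _ hker.symm).trans (σ.quotKerEquivOfSurjective hσ)
    have := filter_tor 𝔞 _ (x j) hfr (e.symm h) (by
      rw [← map_smul, hh, map_zero])
    have := this.map e.toLinearMap
    simpa using this
  refine ⟨fun i hi => ?_, cone_injective _ _ gI, fun i hi h => ?_, fun i hi h => ?_, ?_⟩
  · have a := g0 i (by push_cast at hi; omega)
    have b := g0 (i + 1) (by push_cast at hi; omega)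
    exact ⟨fun p q => cext (x j) E i (Subsingleton.elim _ _) (Subsingleton.elim _ _)⟩
  · obtain ⟨ι, hι, hι0⟩ := exists_iota (x j) E i
    obtain ⟨π, hπ, hπ0, hxπ⟩ := exists_pi (x j) E i ι hι
    have h1 : IsTor 𝔞 (π h) := by
      by_cases hi1 : i + 1 < -1
      · exact gT _ hi1 _
      · obtain rfl : i = -2 := by omega
        exact hxT _ (hxπ h)
    intro r hr
    obtain ⟨n, hn⟩ := h1 r hr
    rw [← map_smul] at hn
    obtain ⟨a, ha⟩ := (hπ0 _).1 hn
    obtain ⟨m, hm⟩ := (gT i hi a) r hr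
    refine ⟨m + n, ?_⟩
    rw [pow_add, mul_smul]
    have : r ^ m • r ^ n • h = ι (r ^ m • a) := by rw [map_smul, ha]
    exact this.trans (by rw [hm, map_zero])
  · obtain ⟨ι, hι, hι0⟩ := exists_iota (x j) E i
    obtain ⟨π, hπ, hπ0, hxπ⟩ := exists_pi (x j) E i ι hι
    obtain ⟨a, ha⟩ := (hπ0 h).1 (gZ _ (by omega) _)
    rw [← ha, gZ i hi a, map_zero]
  · obtain ⟨ι, hι, hι0⟩ := exists_iota (x j) E (-1)
    obtain ⟨π, hπ, hπ0, hxπ⟩ := exists_pi (x j) E (-1) ι hι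
    refine ⟨ι ∘ₗ σ, ?_, ?_⟩
    · intro h
      obtain ⟨a, ha⟩ := (hπ0 h).1 (gZ _ (by omega) _)
      obtain ⟨m, rfl⟩ := hσ a
      exact ⟨m, ha⟩
    · have hset : x '' Set.Iio (j + 1) = (x '' Set.Iio j) ∪ {x j} := by
        rw [← Order.succ_eq_add_one, Order.Iio_succ_eq_insert, Set.image_insert_eq,
          Set.union_singleton]
      rw [hset, Ideal.span_union, Submodule.sup_smul, ← hker]
      apply le_antisymm
      · intro m hm
        obtain ⟨k, hk⟩ := (hι0 _).1 hm
        obtain ⟨m', rfl⟩ := hσ k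
        have : m = (m - x j • m') + x j • m' := by abel
        rw [this]
        refine Submodule.add_mem_sup ?_ ?_
        · rw [LinearMap.mem_ker, map_sub, map_smul, hk, sub_self]
        · exact Submodule.smul_mem_smul (Ideal.mem_span_singleton_self _) trivial
      · rw [sup_le_iff]
        constructor
        · intro m hm
          rw [LinearMap.mem_ker] at hm ⊢
          rw [LinearMap.comp_apply, hm, map_zero]
        · rw [Submodule.smul_le]
          intro r hr m _
          obtain ⟨c, rfl⟩ := Ideal.mem_span_singleton'.1 hr
          rw [LinearMap.mem_ker, LinearMap.comp_apply, hι0]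
          exact ⟨c • σ m, by rw [map_smul, mul_comm, mul_smul]⟩

lemma K_res [IsNoetherianRing R] (𝔞 : Ideal R) (M : Type) [AddCommGroup M] [Module R M]
    (x : ℕ → R) (t : ℕ)
    (hfr : ∀ j < t, ∀ p ∈ associatedPrimes R
        (M ⧸ (Ideal.span (x '' Set.Iio j) • (⊤ : Submodule R M))), ¬ 𝔞 ≤ p → x j ∉ p)
    (D : Cx R) (h0 : ∀ i < 0, Subsingleton (D.X i)) (hI : ∀ i, Module.Injective R (D.X i))
    (hH : ∀ i ≠ -1, ∀ h : D.H i, h = 0) (σ₀ : M →ₗ[R] D.H (-1)) (hσ₀ : Function.Bijective σ₀)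
    (j : ℕ) : j ≤ t → Good 𝔞 M x j (K x D j) := by
  induction j with
  | zero =>
    intro _
    show Good 𝔞 M x 0 D
    refine ⟨fun i hi => h0 i (by simpa using hi), hI, fun i hi h => ?_, fun i hi h => ?_, σ₀,
      hσ₀.2, ?_⟩
    · have : h = 0 := hH i (by omega) h
      rw [this]
      exact fun r _ => ⟨0, by simp⟩
    · exact hH i (by omega) h
    · rw [LinearMap.ker_eq_bot.2 hσ₀.1]
      simp
  | succ j ih =>
    intro hj
    exact Good_cone 𝔞 M x j (hfr j (by omega)) _ (ih (by omega))

end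
end FRS


namespace FRS
section
variable {R : Type} [CommRing R]

/-- the map of Hom complexes induced by a map of chain complexes -/
noncomputable def lamMap {K K' : ChainComplex (ModuleCat.{0} R) ℕ} (ψ : K' ⟶ K) (Y : ModuleCat.{0} R) :
    K.linearYonedaObj R Y ⟶ K'.linearYonedaObj R Y :=
  (HomologicalComplex.unopFunctor _ _).map
    ((((linearYoneda R (ModuleCat.{0} R)).obj Y).rightOp.mapHomologicalComplex _).map ψ).op

lemma lamMap_f {K K' : ChainComplex (ModuleCat.{0} R) ℕ} (ψ : K' ⟶ K) (Y : ModuleCat.{0} R) (n : ℕ)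
    (f : K.X n ⟶ Y) :
    (((lamMap ψ Y).f n).hom f : K'.X n ⟶ Y) = ψ.f n ≫ f := rfl

lemma isoExt_nat {X X' : ModuleCat.{0} R} (φ : X' ⟶ X) (P : ProjectiveResolution X)
    (P' : ProjectiveResolution X') (ψ : P'.complex ⟶ P.complex)
    (comm : ψ.f 0 ≫ P.π.f 0 = P'.π.f 0 ≫ φ) (n : ℕ) (Y : ModuleCat.{0} R) :
    (P.isoExt (R := R) n Y).inv ≫ ((Ext R (ModuleCat.{0} R) n).map φ.op).app Y =
      HomologicalComplex.homologyMap (lamMap ψ Y) n ≫ (P'.isoExt (R := R) n Y).inv := by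
  have h1 := ProjectiveResolution.isoLeftDerivedObj_hom_naturality φ P' P ψ comm
    ((linearYoneda R (ModuleCat.{0} R)).obj Y).rightOp n
  have h2 := HomologicalComplex.homologyOp_hom_naturality (lamMap ψ Y) n
  have h1' := congrArg Quiver.Hom.unop h1
  have h2' := congrArg Quiver.Hom.unop h2
  have gen : ∀ {A B C D E F : ModuleCat.{0} R} (a : A ⟶ B) (b : B ⟶ C) (c : C ⟶ D) (e : B ⟶ E)
      (f : E ⟶ D) (g : A ⟶ F) (h : F ⟶ E), b ≫ c = e ≫ f → a ≫ e = g ≫ h →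
      (a ≫ b) ≫ c = g ≫ h ≫ f := by
    intro A B C D E F a b c e f g h h1 h2
    rw [Category.assoc, h1, ← Category.assoc, h2, Category.assoc]
  exact gen _ _ _ _ _ _ _ h1' h2'

lemma iso_inj {A B : ModuleCat.{0} R} (e : A ≅ B) : Function.Injective e.hom.hom :=
  e.toLinearEquiv.injective

lemma iso_surj {A B : ModuleCat.{0} R} (e : A ≅ B) : Function.Surjective e.hom.hom :=
  e.toLinearEquiv.surjective

/-- cocycles -/
abbrev Zc {X : ModuleCat.{0} R} (P : ProjectiveResolution X) (Y : ModuleCat.{0} R) (n : ℕ) :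
    Submodule R (P.complex.X n ⟶ Y) where
  carrier := {f | P.complex.d (n + 1) n ≫ f = 0}
  zero_mem' := by simp
  add_mem' := by
    intro a b ha hb
    simp only [Set.mem_ofPred_eq] at ha hb ⊢
    rw [Preadditive.comp_add, ha, hb, add_zero]
  smul_mem' := by
    intro c a ha
    simp only [Set.mem_ofPred_eq] at ha ⊢
    rw [Linear.comp_smul, ha, smul_zero]

/-- inclusion of cocycles -/
noncomputable def zinc {X : ModuleCat.{0} R} (P : ProjectiveResolution X) (Y : ModuleCat.{0} R) (n : ℕ) :
    ModuleCat.of R (Zc P Y n) ⟶ (P.complex.linearYonedaObj R Y).X n :=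
  ModuleCat.ofHom (Zc P Y n).subtype

lemma zinc_d {X : ModuleCat.{0} R} (P : ProjectiveResolution X) (Y : ModuleCat.{0} R) (n : ℕ) :
    zinc P Y n ≫ (P.complex.linearYonedaObj R Y).d n (n + 1) = 0 := by
  ext f
  exact f.2

/-- cocycles to cohomology -/
noncomputable def zH {X : ModuleCat.{0} R} (P : ProjectiveResolution X) (Y : ModuleCat.{0} R) (n : ℕ) :
    ModuleCat.of R (Zc P Y n) ⟶ (P.complex.linearYonedaObj R Y).homology n :=
  (P.complex.linearYonedaObj R Y).liftCycles (zinc P Y n) (n + 1) (by simp) (zinc_d P Y n) ≫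
    (P.complex.linearYonedaObj R Y).homologyπ n

/-- class of a cocycle in `Ext` -/
noncomputable def oc {X : ModuleCat.{0} R} (P : ProjectiveResolution X) (Y : ModuleCat.{0} R) (n : ℕ) :
    Zc P Y n →ₗ[R] ((Ext R (ModuleCat.{0} R) n).obj (Opposite.op X)).obj Y :=
  (zH P Y n ≫ (P.isoExt n Y).inv).hom

lemma zH_surj {X : ModuleCat.{0} R} (P : ProjectiveResolution X) (Y : ModuleCat.{0} R) (n : ℕ) :
    Function.Surjective (zH P Y n).hom := by
  intro h
  obtain ⟨c, rfl⟩ := (ModuleCat.epi_iff_surjective _).1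
    (inferInstance : Epi ((P.complex.linearYonedaObj R Y).homologyπ n)) h
  have hc : ((P.complex.linearYonedaObj R Y).d n (n + 1)).hom
      (((P.complex.linearYonedaObj R Y).iCycles n).hom c) = 0 := by
    have := (P.complex.linearYonedaObj R Y).iCycles_d n (n + 1)
    exact LinearMap.congr_fun (congrArg ModuleCat.Hom.hom this) c
  refine ⟨⟨((P.complex.linearYonedaObj R Y).iCycles n).hom c, hc⟩, ?_⟩
  rw [zH, ModuleCat.hom_comp, LinearMap.comp_apply]
  congr 1
  apply (ModuleCat.mono_iff_injective _).1
    (inferInstance : Mono ((P.complex.linearYonedaObj R Y).iCycles n))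
  have := (P.complex.linearYonedaObj R Y).liftCycles_i (zinc P Y n) (n + 1) (by simp) (zinc_d P Y n)
  exact LinearMap.congr_fun (congrArg ModuleCat.Hom.hom this) _

lemma zH_zero {X : ModuleCat.{0} R} (P : ProjectiveResolution X) (Y : ModuleCat.{0} R) (n : ℕ)
    (f : Zc P Y n) : (zH P Y n).hom f = 0 ↔
    ∃ g, P.complex.d n ((ComplexShape.up ℕ).prev n) ≫ g = f.1 := by
  let L := P.complex.linearYonedaObj R Y
  have hπ := (L.sc n).π_moduleCatCyclesIso_hom
  have hi := (L.sc n).moduleCatCyclesIso_hom_i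
  let c : L.cycles n := (L.liftCycles (zinc P Y n) (n + 1) (by simp) (zinc_d P Y n)).hom f
  have hc : (L.iCycles n).hom c = f.1 := by
    have := L.liftCycles_i (zinc P Y n) (n + 1) (by simp) (zinc_d P Y n)
    exact LinearMap.congr_fun (congrArg ModuleCat.Hom.hom this) _
  have h1 : (zH P Y n).hom f = 0 ↔ (L.sc n).moduleCatHomologyIso.hom.hom ((L.homologyπ n).hom c) = 0 := by
    exact (map_eq_zero_iff _ (iso_inj (L.sc n).moduleCatHomologyIso)).symm
  rw [h1]
  have h2 : (L.sc n).moduleCatHomologyIso.hom.hom ((L.homologyπ n).hom c) =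
    (L.sc n).moduleCatLeftHomologyData.π.hom ((L.sc n).moduleCatCyclesIso.hom.hom c) :=
    LinearMap.congr_fun (congrArg ModuleCat.Hom.hom hπ) c
  rw [h2]
  have h3 : ((L.sc n).moduleCatCyclesIso.hom.hom c).1 = f.1 :=
    (LinearMap.congr_fun (congrArg ModuleCat.Hom.hom hi) c).trans hc
  have h4 : (L.sc n).moduleCatLeftHomologyData.π.hom ((L.sc n).moduleCatCyclesIso.hom.hom c) = 0 ↔
      (L.sc n).moduleCatCyclesIso.hom.hom c ∈ LinearMap.range (L.sc n).moduleCatToCycles :=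
    Submodule.Quotient.mk_eq_zero _
  rw [h4]
  constructor
  · rintro ⟨g, hg⟩
    refine ⟨g, ?_⟩
    rw [← h3, ← hg]
    rfl
  · rintro ⟨g, hg⟩
    refine ⟨g, ?_⟩
    apply Subtype.ext
    refine Eq.trans ?_ h3.symm
    exact hg

lemma oc_surj {X : ModuleCat.{0} R} (P : ProjectiveResolution X) (Y : ModuleCat.{0} R) (n : ℕ) :
    Function.Surjective (oc P Y n) := by
  rw [oc, ModuleCat.hom_comp]
  exact (iso_surj (P.isoExt n Y).symm).comp (zH_surj P Y n)

lemma oc_zero {X : ModuleCat.{0} R} (P : ProjectiveResolution X) (Y : ModuleCat.{0} R) (n : ℕ)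
    (f : Zc P Y n) : oc P Y n f = 0 ↔
    ∃ g, P.complex.d n ((ComplexShape.up ℕ).prev n) ≫ g = f.1 := by
  rw [← zH_zero, oc, ModuleCat.hom_comp, LinearMap.comp_apply]
  exact map_eq_zero_iff _ (iso_inj (P.isoExt n Y).symm)

lemma oc_nat {X X' : ModuleCat.{0} R} (φ : X' ⟶ X) (P : ProjectiveResolution X)
    (P' : ProjectiveResolution X') (ψ : P'.complex ⟶ P.complex)
    (comm : ψ.f 0 ≫ P.π.f 0 = P'.π.f 0 ≫ φ) (n : ℕ) (Y : ModuleCat.{0} R)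
    (f : Zc P Y n) (f' : Zc P' Y n) (hf : f'.1 = ψ.f n ≫ f.1) :
    (((Ext R (ModuleCat.{0} R) n).map φ.op).app Y).hom (oc P Y n f) = oc P' Y n f' := by
  have h := isoExt_nat φ P P' ψ comm n Y
  have h1 := LinearMap.congr_fun (congrArg ModuleCat.Hom.hom h) ((zH P Y n).hom f)
  refine h1.trans ?_
  show (P'.isoExt n Y).inv.hom ((HomologicalComplex.homologyMap (lamMap ψ Y) n).hom
    ((zH P Y n).hom f)) = (P'.isoExt n Y).inv.hom ((zH P' Y n).hom f')
  congr 1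
  have h2 := HomologicalComplex.homologyπ_naturality (lamMap ψ Y) n
  refine (LinearMap.congr_fun (congrArg ModuleCat.Hom.hom h2)
    (((P.complex.linearYonedaObj R Y).liftCycles (zinc P Y n) (n + 1) (by simp)
      (zinc_d P Y n)).hom f)).trans ?_
  rw [zH, ModuleCat.hom_comp, ModuleCat.hom_comp, LinearMap.comp_apply, LinearMap.comp_apply]
  congr 1
  apply (ModuleCat.mono_iff_injective _).1
    (inferInstance : Mono ((P'.complex.linearYonedaObj R Y).iCycles n))
  have a1 := (P'.complex.linearYonedaObj R Y).liftCycles_i (zinc P' Y n) (n + 1) (by simp) (zinc_d P' Y n)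
  have a1' := LinearMap.congr_fun (congrArg ModuleCat.Hom.hom a1) f'
  have b1 := HomologicalComplex.cyclesMap_i (lamMap ψ Y) n
  have b1' := LinearMap.congr_fun (congrArg ModuleCat.Hom.hom b1)
    (((P.complex.linearYonedaObj R Y).liftCycles (zinc P Y n) (n + 1) (by simp) (zinc_d P Y n)).hom f)
  have c1 := (P.complex.linearYonedaObj R Y).liftCycles_i (zinc P Y n) (n + 1) (by simp) (zinc_d P Y n)
  have c1' := LinearMap.congr_fun (congrArg ModuleCat.Hom.hom c1) f
  refine b1'.trans (Eq.trans ?_ a1'.symm)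
  refine (congrArg ((lamMap ψ Y).f n).hom c1').trans ?_
  exact hf.symm

end
end FRS

namespace FRS
section
variable {R : Type} [CommRing R]

/-- class of a projective cocycle in the derived category version of `Ext` -/
noncomputable def nc {X : ModuleCat.{0} R} (P : ProjectiveResolution X) (Y : ModuleCat.{0} R) (n : ℕ) :
    Zc P Y n →ₗ[R] Abelian.Ext X Y n where
  toFun f := P.extMk f.1 (n + 1) rfl f.2
  map_add' f g := (P.add_extMk f.1 g.1 (n + 1) rfl f.2 g.2).symm
  map_smul' r f := by
    rw [RingHom.id_apply, Abelian.Ext.smul_eq_comp_mk₀, P.extMk_comp_mk₀]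
    congr 1

lemma nc_surj {X : ModuleCat.{0} R} (P : ProjectiveResolution X) (Y : ModuleCat.{0} R) (n : ℕ) :
    Function.Surjective (nc P Y n) := by
  intro a
  obtain ⟨f, hf, h⟩ := P.extMk_surjective a (n + 1) rfl
  exact ⟨⟨f, hf⟩, h⟩

lemma nc_zero {X : ModuleCat.{0} R} (P : ProjectiveResolution X) (Y : ModuleCat.{0} R) (n : ℕ)
    (f : Zc P Y n) : nc P Y n f = 0 ↔
    ∃ g, P.complex.d n ((ComplexShape.up ℕ).prev n) ≫ g = f.1 := by
  rcases n with _ | p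
  · have hz : P.complex.d 0 ((ComplexShape.up ℕ).prev 0) = 0 := P.complex.shape _ _ (by simp)
    have : (∃ g, P.complex.d 0 ((ComplexShape.up ℕ).prev 0) ≫ g = f.1) ↔ f.1 = 0 := by
      rw [hz]
      constructor
      · rintro ⟨g, hg⟩
        rw [← hg, Limits.zero_comp]
      · intro h
        exact ⟨0, by rw [h, Limits.comp_zero]⟩
    rw [this]
    constructor
    · intro h
      have h1 : P.extMk f.1 (0 + 1) rfl f.2 = 0 := h
      rw [← P.extEquivCohomologyClass.apply_eq_iff_eq,
        ProjectiveResolution.extEquivCohomologyClass_extMk,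
        ProjectiveResolution.extEquivCohomologyClass_zero,
        CochainComplex.HomComplex.CohomologyClass.mk_eq_zero_iff,
        CochainComplex.HomComplex.Cocycle.toSingleMk_mem_coboundaries_iff _ _ _ _ _ 1 (by simp)] at h1
      obtain ⟨g, hg⟩ := h1
      have hg0 : g = 0 := (CochainComplex.isZero_of_isStrictlyLE P.cochainComplex 0 1 (by simp)).eq_of_src _ _
      rw [hg0, Limits.comp_zero] at hg
      rw [← cancel_epi (P.cochainComplexXIso (-(0 : ℕ)) 0 rfl).hom, ← hg, Limits.comp_zero]
    · intro h
      have : f = 0 := Subtype.ext h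
      rw [this, map_zero]
  · have hp : (ComplexShape.up ℕ).prev (p + 1) = p := by simp
    rw [hp]
    exact P.extMk_eq_zero_iff f.1 _ rfl f.2 p rfl

lemma nc_nat {X X' : ModuleCat.{0} R} (φ : X' ⟶ X) (P : ProjectiveResolution X)
    (P' : ProjectiveResolution X') (ψ : P'.complex ⟶ P.complex)
    (comm : ψ.f 0 ≫ P.π.f 0 = P'.π.f 0 ≫ φ) (n : ℕ) (Y : ModuleCat.{0} R)
    (f : Zc P Y n) (f' : Zc P' Y n) (hf : f'.1 = ψ.f n ≫ f.1) :
    (Abelian.Ext.mk₀ φ).comp (nc P Y n f) (zero_add _) = nc P' Y n f' := by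
  refine (ProjectiveResolution.mk₀_comp_extMk f.1 (n + 1) rfl f.2
    (φ := ⟨ψ, by simpa using comm⟩)).trans ?_
  show _ = P'.extMk f'.1 (n + 1) rfl f'.2
  congr 1
  exact hf.symm

/-- injective cocycles -/
abbrev Zi (X : ModuleCat.{0} R) {Y : ModuleCat.{0} R} (I : InjectiveResolution Y) (q : ℤ) :
    Submodule R (X ⟶ I.cochainComplex.X q) where
  carrier := {f | f ≫ I.cochainComplex.d q (q + 1) = 0}
  zero_mem' := by simp
  add_mem' := by
    intro a b ha hb
    simp only [Set.mem_ofPred_eq] at ha hb ⊢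
    rw [Preadditive.add_comp, ha, hb, add_zero]
  smul_mem' := by
    intro c a ha
    simp only [Set.mem_ofPred_eq] at ha ⊢
    rw [Linear.smul_comp, ha, smul_zero]

lemma Zi_cond {X : ModuleCat.{0} R} {Y : ModuleCat.{0} R} (I : InjectiveResolution Y) (n : ℕ) (q : ℤ)
    (hq : (n : ℤ) = q) (f : Zi X I q) :
    (f.1 ≫ (I.cochainComplexXIso q n hq).hom) ≫ I.cocomplex.d n (n + 1) = 0 := by
  have := f.2
  simp only [Submodule.mem_mk, AddSubmonoid.mem_mk, AddSubsemigroup.mem_mk, Set.mem_ofPred_eq] at this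
  rw [I.cochainComplex_d q (q + 1) n (n + 1) hq (by simp [hq])] at this
  rw [← cancel_mono (I.cochainComplexXIso (q + 1) (n + 1) (by simp [hq])).inv]
  simpa using this

/-- class of an injective cocycle in the derived category version of `Ext` -/
noncomputable def ic (X : ModuleCat.{0} R) {Y : ModuleCat.{0} R} (I : InjectiveResolution Y) (n : ℕ) (q : ℤ)
    (hq : (n : ℤ) = q) : Zi X I q →ₗ[R] Abelian.Ext X Y n where
  toFun f := I.extMk (f.1 ≫ (I.cochainComplexXIso q n hq).hom) (n + 1) rfl (Zi_cond I n q hq f)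
  map_add' f g := by
    rw [I.add_extMk]
    congr 1
    simp
  map_smul' r f := by
    rw [RingHom.id_apply]
    have : r • I.extMk (f.1 ≫ (I.cochainComplexXIso q n hq).hom) (n + 1) rfl (Zi_cond I n q hq f) =
      (Abelian.Ext.mk₀ (r • 𝟙 X)).comp
        (I.extMk (f.1 ≫ (I.cochainComplexXIso q n hq).hom) (n + 1) rfl (Zi_cond I n q hq f)) (zero_add _) := by
      rw [Abelian.Ext.mk₀_smul, Abelian.Ext.smul_comp, Abelian.Ext.mk₀_id_comp]
    rw [this, I.mk₀_comp_extMk]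
    congr 1
    simp

lemma ic_surj (X : ModuleCat.{0} R) {Y : ModuleCat.{0} R} (I : InjectiveResolution Y) (n : ℕ) (q : ℤ)
    (hq : (n : ℤ) = q) : Function.Surjective (ic X I n q hq) := by
  intro a
  obtain ⟨f, hf, h⟩ := I.extMk_surjective a (n + 1) rfl
  refine ⟨⟨f ≫ (I.cochainComplexXIso q n hq).inv, ?_⟩, ?_⟩
  · simp only [Submodule.mem_mk, AddSubmonoid.mem_mk, AddSubsemigroup.mem_mk, Set.mem_ofPred_eq]
    rw [I.cochainComplex_d q (q + 1) n (n + 1) hq (by simp [hq])]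
    simp [reassoc_of% hf]
  · rw [← h]
    show I.extMk ((f ≫ (I.cochainComplexXIso q n hq).inv) ≫ (I.cochainComplexXIso q n hq).hom)
      (n + 1) rfl (by simpa using hf) = _
    congr 1
    simp

lemma ic_zero (X : ModuleCat.{0} R) {Y : ModuleCat.{0} R} (I : InjectiveResolution Y) (n : ℕ) (q : ℤ)
    (hq : (n : ℤ) = q) (i : ℤ) (hi : i + 1 = q) (f : Zi X I q) :
    ic X I n q hq f = 0 ↔ ∃ g : X ⟶ I.cochainComplex.X i, g ≫ I.cochainComplex.d i q = f.1 := by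
  subst hq
  have : ic X I n n rfl f = 0 ↔
    I.extMk (f.1 ≫ (I.cochainComplexXIso n n rfl).hom) (n + 1) rfl (Zi_cond I n n rfl f) = 0 := Iff.rfl
  rw [this, ← I.extEquivCohomologyClass.apply_eq_iff_eq,
        InjectiveResolution.extEquivCohomologyClass_extMk,
        InjectiveResolution.extEquivCohomologyClass_zero,
        CochainComplex.HomComplex.CohomologyClass.mk_eq_zero_iff,
        CochainComplex.HomComplex.Cocycle.fromSingleMk_mem_coboundaries_iff _ _ _ _ _ i hi]
  simp

lemma ic_nat {X X' : ModuleCat.{0} R} (φ : X' ⟶ X) {Y : ModuleCat.{0} R} (I : InjectiveResolution Y)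
    (n : ℕ) (q : ℤ) (hq : (n : ℤ) = q) (f : Zi X I q) (f' : Zi X' I q) (hf : f'.1 = φ ≫ f.1) :
    (Abelian.Ext.mk₀ φ).comp (ic X I n q hq f) (zero_add _) = ic X' I n q hq f' := by
  refine (I.mk₀_comp_extMk _ _ rfl (Zi_cond I n q hq f) φ).trans ?_
  show _ = I.extMk (f'.1 ≫ (I.cochainComplexXIso q n hq).hom) (n + 1) rfl (Zi_cond I n q hq f')
  congr 1
  rw [hf, Category.assoc]


/-- comparison of the two versions of `Ext` -/
lemma old_new (X Y : ModuleCat.{0} R) (n : ℕ) :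
    ∃ κ : ((Ext R (ModuleCat.{0} R) n).obj (Opposite.op X)).obj Y →ₗ[R] Abelian.Ext X Y n,
      Function.Bijective κ ∧
        ∀ f, κ (oc (projectiveResolution X) Y n f) = nc (projectiveResolution X) Y n f := by
  let P := projectiveResolution X
  obtain ⟨κ, hκ⟩ := factor (oc P Y n) (oc_surj P Y n) (nc P Y n)
    (fun g hg => (nc_zero P Y n g).2 ((oc_zero P Y n g).1 hg))
  refine ⟨κ, ⟨?_, ?_⟩, hκ⟩
  · rw [injective_iff_map_eq_zero]
    intro a ha
    obtain ⟨f, rfl⟩ := oc_surj P Y n a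
    rw [hκ] at ha
    exact (oc_zero P Y n f).2 ((nc_zero P Y n f).1 ha)
  · intro a
    obtain ⟨f, rfl⟩ := nc_surj P Y n a
    exact ⟨_, hκ f⟩

/-- comparison of the two versions of `Ext` -/
noncomputable def kap (X Y : ModuleCat.{0} R) (n : ℕ) :
    ((Ext R (ModuleCat.{0} R) n).obj (Opposite.op X)).obj Y →ₗ[R] Abelian.Ext X Y n :=
  (old_new X Y n).choose

lemma kap_bij (X Y : ModuleCat.{0} R) (n : ℕ) : Function.Bijective (kap X Y n) :=
  (old_new X Y n).choose_spec.1

lemma kap_oc (X Y : ModuleCat.{0} R) (n : ℕ) (f) :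
    kap X Y n (oc (projectiveResolution X) Y n f) = nc (projectiveResolution X) Y n f :=
  (old_new X Y n).choose_spec.2 f

lemma kap_nat {X X' : ModuleCat.{0} R} (φ : X' ⟶ X) (Y : ModuleCat.{0} R) (n : ℕ)
    (a : ((Ext R (ModuleCat.{0} R) n).obj (Opposite.op X)).obj Y) :
    kap X' Y n ((((Ext R (ModuleCat.{0} R) n).map φ.op).app Y).hom a) =
      (Abelian.Ext.mk₀ φ).comp (kap X Y n a) (zero_add _) := by
  obtain ⟨f, rfl⟩ := oc_surj (projectiveResolution X) Y n a
  let ψ := ProjectiveResolution.lift φ (projectiveResolution X') (projectiveResolution X)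
  have comm : ψ.f 0 ≫ (projectiveResolution X).π.f 0 = (projectiveResolution X').π.f 0 ≫ φ := by
    exact ProjectiveResolution.lift_commutes_zero φ (projectiveResolution X') (projectiveResolution X)
  let f' : Zc (projectiveResolution X') Y n := ⟨ψ.f n ≫ f.1, by
    show _ ≫ _ ≫ _ = 0
    rw [← ψ.comm_assoc]
    have h : (projectiveResolution X).complex.d (n + 1) n ≫ f.1 = 0 := f.2
    rw [h, Limits.comp_zero]⟩
  rw [oc_nat φ _ _ ψ comm n Y f f' rfl, kap_oc, kap_oc, nc_nat φ _ _ ψ comm n Y f f' rfl]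

end
end FRS

namespace FRS
section
variable {R : Type} [CommRing R]

/-- the complex of modules underlying an injective resolution -/
noncomputable def DI {Y : ModuleCat.{0} R} (I : InjectiveResolution Y) : Cx R where
  X i := I.cochainComplex.X i
  d i := (I.cochainComplex.d i (i + 1)).hom
  dd i x := by
    have := I.cochainComplex.d_comp_d i (i + 1) (i + 1 + 1)
    exact LinearMap.congr_fun (congrArg ModuleCat.Hom.hom this) x

/-- torsion subcomplex -/
noncomputable def GamCx (𝔞 : Ideal R) (D : Cx R) : Cx R where
  X i := ModuleCat.of R (Gam 𝔞 (D.X i))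
  d i := (D.d i).restrict (fun _ hv => IsTor.map (D.d i) hv)
  dd i x := Subtype.ext (D.dd i x.1)

/-- inclusion of the torsion subcomplex -/
noncomputable def GamT (𝔞 : Ideal R) (D : Cx R) : TMap 𝔞 (GamCx 𝔞 D) D where
  f i := (Gam 𝔞 (D.X i)).subtype
  comm i v := rfl
  inj i := Subtype.val_injective
  range i y := ⟨by rintro ⟨v, rfl⟩; exact v.2, fun h => ⟨⟨y, h⟩, rfl⟩⟩

/-- the quotient by a power of the ideal -/
abbrev Q (𝔞 : Ideal R) (n : ℕ) : ModuleCat.{0} R := ModuleCat.of R (R ⧸ 𝔞 ^ n)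

/-- the generator -/
noncomputable abbrev q1 (𝔞 : Ideal R) (n : ℕ) : Q 𝔞 n := (Submodule.Quotient.mk (1 : R) : R ⧸ 𝔞 ^ n)

lemma q1_tor (𝔞 : Ideal R) (n : ℕ) (r : R) (hr : r ∈ 𝔞 ^ n) : r • q1 𝔞 n = 0 := by
  show r • (Submodule.Quotient.mk (1 : R) : R ⧸ 𝔞 ^ n) = 0
  rw [← Submodule.Quotient.mk_smul, Submodule.Quotient.mk_eq_zero]
  simpa using hr

lemma q1_ext (𝔞 : Ideal R) (n : ℕ) {V : ModuleCat.{0} R} (f g : Q 𝔞 n ⟶ V)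
    (h : f.hom (q1 𝔞 n) = g.hom (q1 𝔞 n)) : f = g := by
  ext : 1
  apply Submodule.linearMap_qext
  ext
  exact h

lemma q1_lift (𝔞 : Ideal R) (n : ℕ) {V : ModuleCat.{0} R} (v : V) (h : ∀ r ∈ 𝔞 ^ n, r • v = 0) :
    ∃ f : Q 𝔞 n ⟶ V, f.hom (q1 𝔞 n) = v := by
  have hle : 𝔞 ^ n ≤ LinearMap.ker (LinearMap.toSpanSingleton R V v) := fun r hr => by
    rw [LinearMap.mem_ker, LinearMap.toSpanSingleton_apply]
    exact h r hr
  exact ⟨ModuleCat.ofHom ((𝔞 ^ n).liftQ (LinearMap.toSpanSingleton R V v) hle),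
    (Submodule.liftQ_apply (𝔞 ^ n) (LinearMap.toSpanSingleton R V v) (1 : R)).trans (one_smul R v)⟩

lemma Q_tor (𝔞 : Ideal R) (n : ℕ) {V : ModuleCat.{0} R} (f : Q 𝔞 n ⟶ V) : IsTor 𝔞 (f.hom (q1 𝔞 n)) :=
  IsTor.of_pow n fun r hr => by rw [← map_smul, q1_tor 𝔞 n r hr, map_zero]

/-- evaluation of cocycles at the generator -/
noncomputable def mu (𝔞 : Ideal R) {Y : ModuleCat.{0} R} (I : InjectiveResolution Y) (n : ℕ) (i : ℤ) :
    Zi (Q 𝔞 n) I (i + 1) →ₗ[R] (GamCx 𝔞 (DI I)).H i :=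
  (GamCx 𝔞 (DI I)).cls i ∘ₗ
  { toFun := fun g => ⟨⟨g.1.hom (q1 𝔞 n), Q_tor 𝔞 n g.1⟩, by
      refine LinearMap.mem_ker.2 (Subtype.ext ?_)
      have h : g.1 ≫ I.cochainComplex.d (i + 1) (i + 1 + 1) = 0 := g.2
      exact LinearMap.congr_fun (congrArg ModuleCat.Hom.hom h) (q1 𝔞 n)⟩
    map_add' := fun f g => rfl
    map_smul' := fun f g => rfl }

lemma mu_zero_iff (𝔞 : Ideal R) {Y : ModuleCat.{0} R} (I : InjectiveResolution Y) (n : ℕ) (i : ℤ)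
    (g : Zi (Q 𝔞 n) I (i + 1)) : mu 𝔞 I n i g = 0 ↔
    ∃ y : I.cochainComplex.X i, IsTor 𝔞 y ∧ (I.cochainComplex.d i (i + 1)).hom y = g.1.hom (q1 𝔞 n) := by
  rw [mu, LinearMap.comp_apply, Cx.cls_eq_zero]
  constructor
  · rintro ⟨y, hy⟩
    exact ⟨y.1, y.2, congrArg Subtype.val hy⟩
  · rintro ⟨y, h, hy⟩
    exact ⟨⟨y, h⟩, Subtype.ext hy⟩

lemma mu_eq (𝔞 : Ideal R) {Y : ModuleCat.{0} R} (I : InjectiveResolution Y) (n m : ℕ) (i : ℤ)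
    (g : Zi (Q 𝔞 n) I (i + 1)) (g' : Zi (Q 𝔞 m) I (i + 1))
    (h : g.1.hom (q1 𝔞 n) = g'.1.hom (q1 𝔞 m)) : mu 𝔞 I n i g = mu 𝔞 I m i g' := by
  rw [mu, mu, LinearMap.comp_apply, LinearMap.comp_apply]
  congr 1
  exact Subtype.ext (Subtype.ext h)

lemma mu_surj [IsNoetherianRing R] (𝔞 : Ideal R) {Y : ModuleCat.{0} R} (I : InjectiveResolution Y) (i : ℤ)
    (h : (GamCx 𝔞 (DI I)).H i) : ∃ n g, mu 𝔞 I n i g = h := by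
  obtain ⟨⟨⟨v, hv⟩, hd⟩, rfl⟩ := Cx.cls_surj _ i h
  obtain ⟨n, hn⟩ := tor_pow 𝔞 (Submodule.span R {v}) (Submodule.fg_span_singleton v) (by
    intro w hw
    rw [Submodule.mem_span_singleton] at hw
    obtain ⟨a, rfl⟩ := hw
    exact (Gam 𝔞 _).smul_mem a hv)
  obtain ⟨f, hf⟩ := q1_lift 𝔞 n (V := I.cochainComplex.X (i + 1)) v
    (fun r hr => hn r hr v (Submodule.mem_span_singleton_self v))
  refine ⟨n, ⟨f, ?_⟩, ?_⟩
  · show f ≫ I.cochainComplex.d (i + 1) (i + 1 + 1) = 0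
    apply q1_ext
    have : (I.cochainComplex.d (i + 1) (i + 1 + 1)).hom v = 0 := congrArg Subtype.val hd
    rw [ModuleCat.hom_comp, LinearMap.comp_apply, hf]
    exact this
  · rw [mu, LinearMap.comp_apply]
    congr 1
    exact Subtype.ext (Subtype.ext hf)

end
end FRS

namespace FRS
section
variable {R : Type} [CommRing R]

lemma exists_lam (𝔞 : Ideal R) {Y : ModuleCat.{0} R} (I : InjectiveResolution Y) (p : ℕ) (i : ℤ)
    (hi : (p : ℤ) = i + 1) (n : ℕ) :
    ∃ l : ((Ext R (ModuleCat.{0} R) p).obj (Opposite.op (Q 𝔞 n))).obj Y →ₗ[R] (GamCx 𝔞 (DI I)).H i,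
      ∀ a g, kap (Q 𝔞 n) Y p a = ic (Q 𝔞 n) I p (i + 1) hi g → l a = mu 𝔞 I n i g := by
  obtain ⟨ρ, hρ⟩ := factor (ic (Q 𝔞 n) I p (i + 1) hi) (ic_surj (Q 𝔞 n) I p (i + 1) hi)
    (mu 𝔞 I n i) (by
      intro g hg
      rw [ic_zero (Q 𝔞 n) I p (i + 1) hi i rfl] at hg
      obtain ⟨h, hh⟩ := hg
      rw [mu_zero_iff]
      exact ⟨h.hom (q1 𝔞 n), Q_tor 𝔞 n h, LinearMap.congr_fun (congrArg ModuleCat.Hom.hom hh) _⟩)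
  refine ⟨ρ ∘ₗ kap (Q 𝔞 n) Y p, ?_⟩
  intro a g h
  rw [LinearMap.comp_apply, h, hρ]

/-- the comparison map at a finite stage -/
noncomputable def lam (𝔞 : Ideal R) {Y : ModuleCat.{0} R} (I : InjectiveResolution Y) (p : ℕ) (i : ℤ)
    (hi : (p : ℤ) = i + 1) (n : ℕ) :
    ((Ext R (ModuleCat.{0} R) p).obj (Opposite.op (Q 𝔞 n))).obj Y →ₗ[R] (GamCx 𝔞 (DI I)).H i :=
  (exists_lam 𝔞 I p i hi n).choose

lemma lam_eq (𝔞 : Ideal R) {Y : ModuleCat.{0} R} (I : InjectiveResolution Y) (p : ℕ) (i : ℤ)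
    (hi : (p : ℤ) = i + 1) (n : ℕ) (a g) (h : kap (Q 𝔞 n) Y p a = ic (Q 𝔞 n) I p (i + 1) hi g) :
    lam 𝔞 I p i hi n a = mu 𝔞 I n i g := (exists_lam 𝔞 I p i hi n).choose_spec a g h

/-- pullback of injective cocycles -/
noncomputable def zpull {X X' : ModuleCat.{0} R} (φ : X' ⟶ X) {Y : ModuleCat.{0} R}
    {I : InjectiveResolution Y} {q : ℤ} (g : Zi X I q) : Zi X' I q :=
  ⟨φ ≫ g.1, by
    show (φ ≫ g.1) ≫ _ = 0
    have h : g.1 ≫ I.cochainComplex.d q (q + 1) = 0 := g.2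
    rw [Category.assoc, h, Limits.comp_zero]⟩

lemma kap_pull {X X' : ModuleCat.{0} R} (φ : X' ⟶ X) {Y : ModuleCat.{0} R}
    (I : InjectiveResolution Y) (p : ℕ) (q : ℤ) (hq : (p : ℤ) = q) (a g)
    (h : kap X Y p a = ic X I p q hq g) :
    kap X' Y p ((((Ext R (ModuleCat.{0} R) p).map φ.op).app Y).hom a) = ic X' I p q hq (zpull φ g) := by
  rw [kap_nat, h, ic_nat φ I p q hq g (zpull φ g) rfl]

lemma lam_nat (𝔞 : Ideal R) {Y : ModuleCat.{0} R} (I : InjectiveResolution Y) (p : ℕ) (i : ℤ)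
    (hi : (p : ℤ) = i + 1) (n m : ℕ) (φ : Q 𝔞 m ⟶ Q 𝔞 n) (hφ : φ.hom (q1 𝔞 m) = q1 𝔞 n) (a) :
    lam 𝔞 I p i hi m ((((Ext R (ModuleCat.{0} R) p).map φ.op).app Y).hom a) = lam 𝔞 I p i hi n a := by
  obtain ⟨g, hg⟩ := ic_surj (Q 𝔞 n) I p (i + 1) hi (kap (Q 𝔞 n) Y p a)
  rw [lam_eq 𝔞 I p i hi n a g hg.symm, lam_eq 𝔞 I p i hi m _ _ (kap_pull φ I p (i + 1) hi a g hg.symm)]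
  apply mu_eq
  exact congrArg g.1.hom hφ

lemma lam_surj [IsNoetherianRing R] (𝔞 : Ideal R) {Y : ModuleCat.{0} R} (I : InjectiveResolution Y)
    (p : ℕ) (i : ℤ) (hi : (p : ℤ) = i + 1) (h : (GamCx 𝔞 (DI I)).H i) :
    ∃ n a, lam 𝔞 I p i hi n a = h := by
  obtain ⟨n, g, rfl⟩ := mu_surj 𝔞 I i h
  obtain ⟨a, ha⟩ := (kap_bij (Q 𝔞 n) Y p).2 (ic (Q 𝔞 n) I p (i + 1) hi g)
  exact ⟨n, a, lam_eq 𝔞 I p i hi n a g ha⟩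

lemma lam_zero [IsNoetherianRing R] (𝔞 : Ideal R) {Y : ModuleCat.{0} R} (I : InjectiveResolution Y)
    (p : ℕ) (i : ℤ) (hi : (p : ℤ) = i + 1) (n : ℕ) (a) (h : lam 𝔞 I p i hi n a = 0) :
    ∃ m, n ≤ m ∧ ∀ φ : Q 𝔞 m ⟶ Q 𝔞 n, φ.hom (q1 𝔞 m) = q1 𝔞 n →
      (((Ext R (ModuleCat.{0} R) p).map φ.op).app Y).hom a = 0 := by
  obtain ⟨g, hg⟩ := ic_surj (Q 𝔞 n) I p (i + 1) hi (kap (Q 𝔞 n) Y p a)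
  rw [lam_eq 𝔞 I p i hi n a g hg.symm, mu_zero_iff] at h
  obtain ⟨y, hy, hyd⟩ := h
  obtain ⟨m, hm⟩ := tor_pow 𝔞 (Submodule.span R {y}) (Submodule.fg_span_singleton y) (by
    intro w hw
    rw [Submodule.mem_span_singleton] at hw
    obtain ⟨a, rfl⟩ := hw
    exact (Gam 𝔞 _).smul_mem a hy)
  refine ⟨n + m, Nat.le_add_right _ _, fun φ hφ => ?_⟩
  apply (kap_bij (Q 𝔞 (n + m)) Y p).1
  rw [kap_pull φ I p (i + 1) hi a g hg.symm, map_zero, ic_zero _ I p (i + 1) hi i rfl]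
  obtain ⟨f, hf⟩ := q1_lift 𝔞 (n + m) (V := I.cochainComplex.X i) y
    (fun r hr => hm r (Ideal.pow_le_pow_right (Nat.le_add_left _ _) hr) y (Submodule.mem_span_singleton_self y))
  refine ⟨f, ?_⟩
  apply q1_ext
  rw [ModuleCat.hom_comp, LinearMap.comp_apply, hf, hyd]
  exact (congrArg g.1.hom hφ).symm

open Limits in
lemma lc_iso [IsNoetherianRing R] (𝔞 : Ideal R) {Y : ModuleCat.{0} R} (I : InjectiveResolution Y)
    (p : ℕ) (i : ℤ) (hi : (p : ℤ) = i + 1) :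
    Nonempty ((localCohomology 𝔞 p).obj Y ≃ₗ[R] (GamCx 𝔞 (DI I)).H i) := by
  let F := localCohomology.diagram (localCohomology.idealPowersDiagram 𝔞) p
  let hc := isColimitOfPreserves ((evaluation (ModuleCat.{0} R) (ModuleCat.{0} R)).obj Y)
    (colimit.isColimit F)
  let c := ((evaluation (ModuleCat.{0} R) (ModuleCat.{0} R)).obj Y).mapCocone (colimit.cocone F)
  let s : Cocone (F ⋙ (evaluation (ModuleCat.{0} R) (ModuleCat.{0} R)).obj Y) :=
    { pt := ModuleCat.of R ((GamCx 𝔞 (DI I)).H i)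
      ι := { app := fun n => ModuleCat.ofHom (lam 𝔞 I p i hi n.unop.unop)
             naturality := by
              intro n m w
              ext a
              refine (lam_nat 𝔞 I p i hi n.unop.unop m.unop.unop
                ((localCohomology.ringModIdeals (localCohomology.idealPowersDiagram 𝔞)).map w.unop) ?_ a)
              rfl } }
  let l := hc.desc s
  have hl : ∀ n a, l.hom ((c.ι.app n).hom a) = lam 𝔞 I p i hi n.unop.unop a := fun n a =>
    LinearMap.congr_fun (congrArg ModuleCat.Hom.hom (hc.fac s n)) a
  have hrep : ∀ z : c.pt, ∃ n a, (c.ι.app n).hom a = z := fun z => Concrete.isColimit_exists_rep _ hc z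
  refine ⟨LinearEquiv.ofBijective (l.hom : c.pt →ₗ[R] (GamCx 𝔞 (DI I)).H i) ⟨?_, ?_⟩⟩
  · rw [injective_iff_map_eq_zero]
    intro z hz
    obtain ⟨n, a, rfl⟩ := hrep z
    have h1 : lam 𝔞 I p i hi n.unop.unop a = 0 := (hl n a).symm.trans hz
    obtain ⟨m, hm, h2⟩ := lam_zero 𝔞 I p i hi n.unop.unop a h1
    let w : n ⟶ Opposite.op (Opposite.op m) := Quiver.Hom.op (Quiver.Hom.op (homOfLE hm))
    have h3 := LinearMap.congr_fun (congrArg ModuleCat.Hom.hom (c.w w)) a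
    rw [← h3]
    have h4 := h2 ((localCohomology.ringModIdeals (localCohomology.idealPowersDiagram 𝔞)).map w.unop) rfl
    refine (congrArg (c.ι.app (Opposite.op (Opposite.op m))).hom h4).trans (map_zero _)
  · intro h
    obtain ⟨n, a, rfl⟩ := lam_surj 𝔞 I p i hi h
    exact ⟨_, hl (Opposite.op (Opposite.op n)) a⟩

end
end FRS

namespace FRS
section
variable {R : Type} [CommRing R]

lemma DI_sub {Y : ModuleCat.{0} R} (I : InjectiveResolution Y) (i : ℤ) (hi : i < 0) :
    Subsingleton ((DI I).X i) :=
  ModuleCat.isZero_iff_subsingleton.1 (CochainComplex.isZero_of_isStrictlyGE I.cochainComplex 0 i hi)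

lemma DI_inj {Y : ModuleCat.{0} R} (I : InjectiveResolution Y) (i : ℤ) :
    Module.Injective R ((DI I).X i) := by
  have : Injective (ModuleCat.of R (I.cochainComplex.X i)) :=
    (inferInstance : Injective (I.cochainComplex.X i))
  exact Module.injective_module_of_injective_object R (I.cochainComplex.X i)

lemma DI_d {Y : ModuleCat.{0} R} (I : InjectiveResolution Y) (i : ℤ) (n : ℕ) (h : (n : ℤ) = i) (v) :
    (I.cochainComplexXIso (i + 1) (n + 1) (by simp [h])).hom.hom ((DI I).d i v) =
      (I.cocomplex.d n (n + 1)).hom ((I.cochainComplexXIso i n h).hom.hom v) := by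
  have : I.cochainComplex.d i (i + 1) ≫ (I.cochainComplexXIso (i + 1) (n + 1) (by simp [h])).hom =
    (I.cochainComplexXIso i n h).hom ≫ I.cocomplex.d n (n + 1) := by
    rw [I.cochainComplex_d i (i + 1) n (n + 1) h (by simp [h])]
    simp
  exact LinearMap.congr_fun (congrArg ModuleCat.Hom.hom this) v

lemma DI_H {Y : ModuleCat.{0} R} (I : InjectiveResolution Y) (i : ℤ) (hi : i ≠ -1)
    (h : (DI I).H i) : h = 0 := by
  obtain ⟨⟨z, hz⟩, rfl⟩ := Cx.cls_surj _ i h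
  rw [Cx.cls_eq_zero]
  rcases lt_or_ge i 0 with hlt | hge
  · have := DI_sub I (i + 1) (by omega)
    exact ⟨0, Subsingleton.elim _ _⟩
  · obtain ⟨n, hn⟩ := Int.eq_ofNat_of_zero_le hge
    have hn' : (n : ℤ) = i := hn.symm
    have hn1 : ((n + 1 : ℕ) : ℤ) = i + 1 := by simp [hn']
    have hex := (ShortComplex.moduleCat_exact_iff _).1 (I.exact_succ n)
    have hz0 : (DI I).d (i + 1) z = 0 := hz
    have h1 : (I.cocomplex.d (n + 1) (n + 1 + 1)).hom
        ((I.cochainComplexXIso (i + 1) (n + 1) hn1).hom.hom z) = 0 :=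
      (DI_d I (i + 1) (n + 1) hn1 z).symm.trans
        ((congrArg (I.cochainComplexXIso (i + 1 + 1) (n + 1 + 1) (by simp [hn'])).hom.hom hz0).trans
          (map_zero _))
    obtain ⟨y, hy⟩ := hex ((I.cochainComplexXIso (i + 1) (n + 1) hn1).hom.hom z) h1
    obtain ⟨y', rfl⟩ := iso_surj (I.cochainComplexXIso i n hn') y
    refine ⟨y', iso_inj (I.cochainComplexXIso (i + 1) (n + 1) hn1) ?_⟩
    exact (DI_d I i n hn' y').trans hy

lemma DI_sig (M : Type) [AddCommGroup M] [Module R M] (I : InjectiveResolution (ModuleCat.of R M)) :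
    ∃ σ : M →ₗ[R] (DI I).H (-1), Function.Bijective σ := by
  let e := I.cochainComplexXIso (-1 + 1) 0 (by simp)
  let ι : M →ₗ[R] (I.cocomplex.X 0) := (I.ι.f 0).hom
  have hex := (ShortComplex.moduleCat_exact_iff _).1 I.exact₀
  have hιd : ∀ m, (I.cocomplex.d 0 1).hom (ι m) = 0 := fun m =>
    LinearMap.congr_fun (congrArg ModuleCat.Hom.hom I.ι_f_zero_comp_complex_d) m
  have hιinj : Function.Injective ι := (ModuleCat.mono_iff_injective (I.ι.f 0)).1 inferInstance
  have he : ∀ v, e.hom.hom (e.inv.hom v) = v := fun v =>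
    LinearMap.congr_fun (congrArg ModuleCat.Hom.hom e.inv_hom_id) v
  let E : I.cocomplex.X 0 →ₗ[R] (DI I).X (-1 + 1) := e.inv.hom
  let ρ : M →ₗ[R] LinearMap.ker ((DI I).d (-1 + 1)) :=
    (E ∘ₗ ι).codRestrict _ (by
      intro m
      refine LinearMap.mem_ker.2 (iso_inj (I.cochainComplexXIso (-1 + 1 + 1) (0 + 1) (by simp)) ?_)
      refine (DI_d I (-1 + 1) 0 (by simp) _).trans ?_
      refine Eq.trans ?_ (map_zero _).symm
      refine Eq.trans ?_ (hιd m)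
      exact congrArg (I.cocomplex.d 0 1).hom (he (ι m)))
  refine ⟨(DI I).cls (-1) ∘ₗ ρ, ?_, ?_⟩
  · rw [injective_iff_map_eq_zero]
    intro m hm
    rw [LinearMap.comp_apply, Cx.cls_eq_zero] at hm
    obtain ⟨y, hy⟩ := hm
    have := DI_sub I (-1) (by simp)
    rw [Subsingleton.elim y 0, map_zero] at hy
    have h2 : e.inv.hom (ι m) = 0 := hy.symm
    apply hιinj
    rw [map_zero, ← he (ι m), h2, map_zero]
  · intro h
    obtain ⟨⟨z, hz⟩, rfl⟩ := Cx.cls_surj _ (-1) h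
    have hz0 : (DI I).d (-1 + 1) z = 0 := hz
    have h1 : (I.cocomplex.d 0 (0 + 1)).hom (e.hom.hom z) = 0 :=
      (DI_d I (-1 + 1) 0 (by simp) z).symm.trans
        ((congrArg (I.cochainComplexXIso (-1 + 1 + 1) (0 + 1) (by simp)).hom.hom hz0).trans
          (map_zero _))
    obtain ⟨m, hm⟩ : ∃ m : M, ι m = e.hom.hom z := hex (e.hom.hom z) h1
    refine ⟨m, ?_⟩
    rw [LinearMap.comp_apply]
    congr 1
    apply Subtype.ext
    apply iso_inj e
    exact (he (ι m)).trans hm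

end
end FRS

theorem hom_quotient_filter_regular_sequence_iso
    {R : Type} [CommRing R] [IsNoetherianRing R] (𝔞 : Ideal R)
    (M : Type) [AddCommGroup M] [Module R M] [Module.Finite R M]
    (t n₀ : ℕ) (ht : 0 < t) (hn₀ : 0 < n₀)
    (hann : ∀ i < t, 𝔞 ^ n₀ ≤ Module.annihilator R
      ((localCohomology 𝔞 i).obj (ModuleCat.of R M)))
    (x : ℕ → R) (hx : ∀ j < t, x j ∈ 𝔞 ^ (2 * n₀))
    (hfr : ∀ j < t, ∀ p ∈ associatedPrimes R
        (M ⧸ (Ideal.span (x '' Set.Iio j) • (⊤ : Submodule R M))), ¬ 𝔞 ≤ p → x j ∉ p)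
    (k : ℕ) (hk : 0 < k) (hkn : k ≤ n₀) (j : ℕ) (hj : 1 ≤ j) (hjt : j ≤ t) :
    Nonempty (((R ⧸ 𝔞 ^ k) →ₗ[R]
        (M ⧸ (Ideal.span (x '' Set.Iio j) • (⊤ : Submodule R M)))) ≃ₗ[R]
      Π i : Fin (j + 1), (Fin (j.choose i) →
        ((R ⧸ 𝔞 ^ k) →ₗ[R] ((localCohomology 𝔞 i).obj (ModuleCat.of R M))))) := by
  let I := injectiveResolution (ModuleCat.of R M)
  let D := FRS.DI I
  let C := FRS.GamCx 𝔞 D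
  obtain ⟨σ₀, hσ₀⟩ := FRS.DI_sig M I
  obtain ⟨g0, gI, gT, gZ, σ, hσ, hker⟩ := FRS.K_res 𝔞 M x t hfr D (FRS.DI_sub I) (FRS.DI_inj I)
    (FRS.DI_H I) σ₀ hσ₀ j hjt
  have hW : ∀ r ∈ 𝔞 ^ k, ∀ w : R ⧸ 𝔞 ^ k, r • w = 0 := by
    intro r hr w
    obtain ⟨b, rfl⟩ := Submodule.Quotient.mk_surjective _ w
    rw [← Submodule.Quotient.mk_smul, Submodule.Quotient.mk_eq_zero]
    exact Ideal.mul_mem_right b _ hr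
  obtain ⟨e1⟩ := FRS.TMap.hom_iso ((FRS.GamT 𝔞 D).K x j) j g0 gI gT (R ⧸ 𝔞 ^ k)
    (fun w => FRS.IsTor.of_pow k fun r hr => hW r hr w)
  obtain ⟨e2⟩ := FRS.K_hom x C (𝔞 ^ n₀) t (by
      intro i h1 h2 r hr h
      obtain ⟨p, hp⟩ := Int.eq_ofNat_of_zero_le (show 0 ≤ i + 1 by omega)
      obtain ⟨e⟩ := FRS.lc_iso 𝔞 I p i hp.symm
      have h3 := Module.mem_annihilator.1 (hann p (by omega) hr) (e.symm h)
      rw [← map_smul] at h3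
      exact (LinearEquiv.map_eq_zero_iff _).1 h3)
    (by
      intro l hl
      rw [← pow_add, ← two_mul]
      exact hx l hl) (R ⧸ 𝔞 ^ k) (fun r hr => hW r (Ideal.pow_le_pow_right hkn hr)) j (-1) le_rfl
    (by omega)
  have e3 : ∀ l : ℕ, ((localCohomology 𝔞 l).obj (ModuleCat.of R M) ≃ₗ[R] C.H (-1 + l)) := fun l =>
    (FRS.lc_iso 𝔞 I l (-1 + l) (by omega)).some
  let e4 : (M ⧸ (Ideal.span (x '' Set.Iio j) • (⊤ : Submodule R M))) ≃ₗ[R] (FRS.K x D j).H (-1) :=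
    (Submodule.quotEquivOfEq _ _ hker.symm).trans (σ.quotKerEquivOfSurjective hσ)
  let W := R ⧸ 𝔞 ^ k
  let e5 : (Π l : ℕ, Fin (j.choose l) → (W →ₗ[R] C.H (-1 + l))) ≃ₗ[R]
      Π i : Fin (j + 1), (Fin (j.choose i) → (W →ₗ[R] C.H (-1 + (i : ℕ)))) :=
    { toFun := fun f i => f i
      map_add' := fun _ _ => rfl
      map_smul' := fun _ _ => rfl
      invFun := fun f l => if h : l < j + 1 then f ⟨l, h⟩ else 0
      left_inv := by
        intro f
        funext l
        by_cases h : l < j + 1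
        · simp [h]
        · funext s
          have : j.choose l = 0 := Nat.choose_eq_zero_of_lt (by omega)
          exact absurd s.2 (by omega)
      right_inv := by
        intro f
        funext i
        simp [i.2] }
  let e6 : (Π i : Fin (j + 1), (Fin (j.choose i) → (W →ₗ[R] C.H (-1 + (i : ℕ))))) ≃ₗ[R]
      Π i : Fin (j + 1), (Fin (j.choose i) →
        (W →ₗ[R] ((localCohomology 𝔞 i).obj (ModuleCat.of R M)))) :=
    LinearEquiv.piCongrRight fun i => LinearEquiv.piCongrRight fun _ =>
      LinearEquiv.congrRight (e3 i).symm
  exact ⟨(((LinearEquiv.congrRight e4).trans e1.symm).trans (e2.trans e5)).trans e6⟩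
end
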